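/- arXiv:1712.03436 — 3 statements merged into one kernel-verified Lean document; each statement's English description precedes it below -/
import Mathlib

section
/- Every TRO-derivation of a TRO is spatial: if H and K are complex Hilbert spaces, X is a TRO in B(K,H), and D is a TRO-derivation on X, then there exist operators α ∈ B(H) and β ∈ B(K) such that α* = −α, β* = −β, α belongs to the double commutant in B(H) of the set {x y* : x, y ∈ X}, β belongs to the double commutant in B(K) of the set {x* y : x, y ∈ X}, and D(x) = α x + x β for every x ∈ X. -/
open ContinuousLinearMap

section ExpGroup

variable {𝔸 : Type*} [NormedRing 𝔸] [NormedAlgebra ℂ 𝔸]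

/-- The one-parameter group `w ↦ exp (w T)` generated by an element `T` of a Banach algebra. -/
noncomputable def expGroup (T : 𝔸) (w : ℂ) : 𝔸 := NormedSpace.exp (w • T)

@[simp] lemma expGroup_zero (T : 𝔸) : expGroup T 0 = 1 := by
  let _ : NormedAlgebra ℚ 𝔸 := NormedAlgebra.restrictScalars ℚ ℂ 𝔸
  simp [expGroup]

lemma expGroup_smul (T : 𝔸) (c w : ℂ) : expGroup (c • T) w = expGroup T (w * c) := by
  rw [expGroup, expGroup, smul_smul]

lemma expGroup_neg (T : 𝔸) (w : ℂ) : expGroup (-T) w = expGroup T (-w) := by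
  rw [expGroup, expGroup, smul_neg, neg_smul]

lemma Commute.expGroup_right {S T : 𝔸} (h : Commute S T) (w : ℂ) : Commute S (expGroup T w) := by
  let _ : NormedAlgebra ℚ 𝔸 := NormedAlgebra.restrictScalars ℚ ℂ 𝔸
  exact (h.smul_right w).exp_right

/-- `T` generates a group of contractions along the imaginary axis. -/
def IsHermitianGenerator (T : 𝔸) : Prop := ∀ u : ℝ, ‖expGroup T (u * Complex.I)‖ ≤ 1

lemma IsHermitianGenerator.neg {T : 𝔸} (hT : IsHermitianGenerator T) :
    IsHermitianGenerator (-T) := fun u => by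
  simpa [expGroup_neg] using hT (-u)

lemma IsHermitianGenerator.real_smul {T : 𝔸} (hT : IsHermitianGenerator T) (c : ℝ) :
    IsHermitianGenerator ((c : ℂ) • T) := fun u => by
  rw [expGroup_smul]
  convert hT (u * c) using 3
  push_cast; ring

variable [CompleteSpace 𝔸]

lemma expGroup_add (T : 𝔸) (z w : ℂ) : expGroup T (z + w) = expGroup T z * expGroup T w := by
  let _ : NormedAlgebra ℚ 𝔸 := NormedAlgebra.restrictScalars ℚ ℂ 𝔸
  rw [expGroup, add_smul]
  exact NormedSpace.exp_add_of_commute (((Commute.refl T).smul_left z).smul_right w)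

lemma expGroup_mul_neg (T : 𝔸) (w : ℂ) : expGroup T w * expGroup T (-w) = 1 := by
  rw [← expGroup_add]; simp

lemma expGroup_neg_mul (T : 𝔸) (w : ℂ) : expGroup T (-w) * expGroup T w = 1 := by
  rw [← expGroup_add]; simp

lemma expGroup_sub_algebraMap (T : 𝔸) (a w : ℂ) :
    expGroup (T - algebraMap ℂ 𝔸 a) w = Complex.exp (-(w * a)) • expGroup T w := by
  let _ : NormedAlgebra ℚ 𝔸 := NormedAlgebra.restrictScalars ℚ ℂ 𝔸
  have h : w • (T - algebraMap ℂ 𝔸 a) = algebraMap ℂ 𝔸 (-(w * a)) + w • T := by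
    rw [smul_sub, Algebra.algebraMap_eq_smul_one, Algebra.algebraMap_eq_smul_one, smul_smul,
      neg_smul]
    abel
  rw [expGroup, h, NormedSpace.exp_add_of_commute (Algebra.commutes _ _),
    ← NormedSpace.algebraMap_exp_comm, ← Complex.exp_eq_exp_ℂ, ← Algebra.smul_def, expGroup]

lemma hasDerivAt_expGroup (T : 𝔸) (w : ℂ) :
    HasDerivAt (expGroup T) (T * expGroup T w) w :=
  hasDerivAt_exp_smul_const' T w

@[fun_prop]
lemma continuous_expGroup (T : 𝔸) : Continuous (expGroup T) :=
  continuous_iff_continuousAt.2 fun w => (hasDerivAt_expGroup T w).continuousAt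

lemma IsHermitianGenerator.sub_algebraMap {T : 𝔸} (hT : IsHermitianGenerator T) (a : ℝ) :
    IsHermitianGenerator (T - algebraMap ℂ 𝔸 a) := fun u => by
  rw [expGroup_sub_algebraMap, norm_smul, Complex.norm_exp]
  simpa using hT u

end ExpGroup

section Split

variable {𝔸 : Type*} [NormedRing 𝔸] [NormedAlgebra ℂ 𝔸]

lemma exists_norm_expGroup_le (T : 𝔸) :
    ∃ C : ℝ, 0 ≤ C ∧ ∀ w : ℂ, ‖expGroup T w‖ ≤ C * Real.exp (‖T‖ * ‖w‖) := by
  refine ⟨max 1 ‖(1 : 𝔸)‖, by positivity, fun w => ?_⟩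
  have hs : HasSum (fun n : ℕ => max 1 ‖(1 : 𝔸)‖ * ((‖T‖ * ‖w‖) ^ n / n.factorial))
      (max 1 ‖(1 : 𝔸)‖ * Real.exp (‖T‖ * ‖w‖)) := by
    have := NormedSpace.expSeries_div_hasSum_exp (‖T‖ * ‖w‖)
    rw [← Real.exp_eq_exp_ℝ] at this
    exact this.mul_left _
  have h := NormedSpace.exp_eq_tsum (𝔸 := 𝔸) ℂ
  rw [expGroup, h]
  refine tsum_of_norm_bounded hs fun n => ?_
  have h1 : ‖(w • T) ^ n‖ ≤ max 1 ‖(1 : 𝔸)‖ * (‖T‖ * ‖w‖) ^ n := by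
    rcases n with _ | n
    · simp
    · calc ‖(w • T) ^ (n + 1)‖ ≤ ‖w • T‖ ^ (n + 1) := norm_pow_le' _ n.succ_pos
        _ = 1 * (‖T‖ * ‖w‖) ^ (n + 1) := by rw [norm_smul, mul_comm, one_mul]
        _ ≤ _ := by gcongr; exact le_max_left _ _
  rw [norm_smul]
  simp only [norm_inv, Complex.norm_natCast]
  calc _ ≤ (n.factorial : ℝ)⁻¹ * (max 1 ‖(1 : 𝔸)‖ * (‖T‖ * ‖w‖) ^ n) := by gcongr
    _ = _ := by ring

lemma norm_poissonKernel_le {T : 𝔸} (hT : IsHermitianGenerator T) (u : ℝ) :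
    ‖((1 + u ^ 2)⁻¹ : ℝ) • expGroup T (u * Complex.I)‖ ≤ (1 + u ^ 2)⁻¹ := by
  rw [norm_smul, Real.norm_of_nonneg (by positivity)]
  exact mul_le_of_le_one_right (by positivity) (hT u)

variable [CompleteSpace 𝔸]

/-- The vertical line integrand whose value at `s = 0` cuts down to the negative spectrum. -/
noncomputable def halfKernel (T : 𝔸) (w : ℂ) : 𝔸 := ((1 + w) ^ 2)⁻¹ • expGroup T w

/-- The (unnormalised) compression of `|T| exp (-|T|)` to the negative half of the spectrum. -/
noncomputable def halfIntegral (T : 𝔸) (s : ℝ) : 𝔸 :=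
  ∫ u : ℝ, halfKernel T (s + u * Complex.I)

lemma one_add_vertical_ne_zero {s : ℝ} (hs : -1 < s) (u : ℝ) :
    (1 + (s + u * Complex.I) : ℂ) ≠ 0 := fun h => by
  have := congrArg Complex.re h
  simp at this; linarith

lemma norm_inv_sq_le {s : ℝ} (hs : -(1 / 2) < s) (u : ℝ) :
    ‖((1 + (s + u * Complex.I) : ℂ) ^ 2)⁻¹‖ ≤ 4 * (1 + u ^ 2)⁻¹ := by
  rw [norm_inv, norm_pow, ← Complex.normSq_eq_norm_sq, inv_le_comm₀, mul_inv, inv_inv]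
  · simp [Complex.normSq_apply]; nlinarith
  · rw [Complex.normSq_pos]; exact one_add_vertical_ne_zero (by linarith) u
  · positivity

lemma hasDerivAt_halfKernel (T : 𝔸) {w : ℂ} (hw : 1 + w ≠ 0) :
    HasDerivAt (halfKernel T) (((1 + w) ^ 2)⁻¹ • ((T - algebraMap ℂ 𝔸 (2 * (1 + w)⁻¹)) *
      expGroup T w)) w := by
  have h1 : HasDerivAt (fun w : ℂ => ((1 + w) ^ 2)⁻¹) (-(2 * (1 + w)⁻¹ * ((1 + w) ^ 2)⁻¹)) w := by
    have := (((hasDerivAt_id w).const_add 1).pow 2).inv (pow_ne_zero 2 hw)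
    refine this.congr_deriv ?_
    have h2 : (((fun x : ℂ => 1 + id x) ^ 2) w) = (1 + w) ^ 2 := rfl
    rw [h2]
    simp only [id]
    field_simp
    norm_num [mul_comm]
  refine (h1.smul (hasDerivAt_expGroup T w)).congr_deriv ?_
  rw [Algebra.algebraMap_eq_smul_one, sub_mul, smul_sub, smul_mul_assoc, one_mul, smul_smul,
    neg_smul, sub_eq_add_neg, mul_comm (((1 + w) ^ 2)⁻¹)]

lemma norm_expGroup_vertical_le {T : 𝔸} (hT : IsHermitianGenerator T) (s u : ℝ) :
    ‖expGroup T (s + u * Complex.I)‖ ≤ ‖expGroup T s‖ := by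
  rw [expGroup_add]
  exact (norm_mul_le _ _).trans (mul_le_of_le_one_right (norm_nonneg _) (hT u))

lemma continuous_halfKernel_vertical (T : 𝔸) {s : ℝ} (hs : -1 < s) :
    Continuous fun u : ℝ => halfKernel T (s + u * Complex.I) := by
  refine continuous_iff_continuousAt.2 fun u => ?_
  exact ContinuousAt.comp (f := fun u : ℝ => (s + u * Complex.I : ℂ))
    (hasDerivAt_halfKernel T (one_add_vertical_ne_zero hs u)).continuousAt (by fun_prop)

lemma integrable_halfKernel_vertical {T : 𝔸} (hT : IsHermitianGenerator T) {s : ℝ}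
    (hs : -(1 / 2) < s) :
    MeasureTheory.Integrable fun u : ℝ => halfKernel T (s + u * Complex.I) := by
  refine MeasureTheory.Integrable.mono'
    ((integrable_inv_one_add_sq.const_mul 4).mul_const ‖expGroup T s‖)
    (continuous_halfKernel_vertical T (by linarith)).aestronglyMeasurable
    (Filter.Eventually.of_forall fun u => ?_)
  rw [halfKernel, norm_smul]
  gcongr
  · exact norm_inv_sq_le hs u
  · exact norm_expGroup_vertical_le hT s u

lemma hasDerivAt_halfIntegral {T : 𝔸} (hT : IsHermitianGenerator T) {s₀ : ℝ}
    (hs₀ : -(1 / 2) < s₀) : HasDerivAt (halfIntegral T) 0 s₀ := by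
  obtain ⟨C, hC0, hC⟩ := exists_norm_expGroup_le T
  let F' : ℂ → 𝔸 := fun w => ((1 + w) ^ 2)⁻¹ • ((T - algebraMap ℂ 𝔸 (2 * (1 + w)⁻¹)) *
      expGroup T w)
  let b : ℝ := (‖T‖ + 4 * ‖(1 : 𝔸)‖) * (C * Real.exp (‖T‖ * (|s₀| + 1)))
  let S : Set ℝ := Set.Ioi (-(1 / 2)) ∩ Metric.ball s₀ 1
  have hS : S ∈ nhds s₀ := Filter.inter_mem (Ioi_mem_nhds hs₀) (Metric.ball_mem_nhds _ one_pos)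
  have hb : ∀ (u : ℝ), ∀ s ∈ S, ‖F' (s + u * Complex.I)‖ ≤ 4 * (1 + u ^ 2)⁻¹ * b := by
    rintro u s ⟨hs, hs1⟩
    have hs : -(1 / 2) < s := hs
    have h2 : ‖(1 + (s + u * Complex.I) : ℂ)⁻¹‖ ≤ 2 := by
      rw [norm_inv]
      have : (1 / 2 : ℝ) ≤ ‖(1 + (s + u * Complex.I) : ℂ)‖ :=
        le_trans (by simp; linarith) (Complex.re_le_norm _)
      calc _ ≤ (1 / 2 : ℝ)⁻¹ := inv_anti₀ (by norm_num) this
        _ = 2 := by norm_num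
    have h3 : ‖expGroup T s‖ ≤ C * Real.exp (‖T‖ * (|s₀| + 1)) := by
      refine (hC s).trans ?_
      gcongr
      rw [Complex.norm_real, Real.norm_eq_abs]
      rw [Metric.mem_ball, Real.dist_eq] at hs1
      have := abs_sub_abs_le_abs_sub s s₀
      linarith
    have h4 : ‖T - algebraMap ℂ 𝔸 (2 * (1 + (s + u * Complex.I))⁻¹)‖ ≤ ‖T‖ + 4 * ‖(1 : 𝔸)‖ := by
      refine (norm_sub_le _ _).trans ?_
      rw [norm_algebraMap, norm_mul, Complex.norm_ofNat]
      gcongr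
      linarith
    refine (norm_smul_le _ _).trans (mul_le_mul (norm_inv_sq_le hs u) ?_ (norm_nonneg _)
      (by positivity))
    exact (norm_mul_le _ _).trans (mul_le_mul h4
      ((norm_expGroup_vertical_le hT s u).trans h3) (norm_nonneg _) (by positivity))
  have hd : ∀ s : ℝ, -1 < s → ∀ u : ℝ, HasDerivAt (halfKernel T) (F' (s + u * Complex.I))
      (s + u * Complex.I) := fun s hs u => hasDerivAt_halfKernel T (one_add_vertical_ne_zero hs u)
  have hF'c : Continuous fun u : ℝ => F' (s₀ + u * Complex.I) := by
    have : ∀ u : ℝ, (1 + (s₀ + u * Complex.I) : ℂ) ≠ 0 := one_add_vertical_ne_zero (by linarith)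
    have hi : Continuous fun u : ℝ => (1 + (s₀ + u * Complex.I) : ℂ)⁻¹ :=
      Continuous.inv₀ (by fun_prop) this
    have hi2 : Continuous fun u : ℝ => ((1 + (s₀ + u * Complex.I) : ℂ) ^ 2)⁻¹ :=
      Continuous.inv₀ (by fun_prop) fun u => pow_ne_zero 2 (this u)
    have ha : Continuous (algebraMap ℂ 𝔸) := continuous_algebraMap ℂ 𝔸
    exact hi2.smul ((continuous_const.sub (ha.comp (continuous_const.mul hi))).mul
      ((continuous_expGroup T).comp (by fun_prop)))
  have key := hasDerivAt_integral_of_dominated_loc_of_deriv_le (𝕜 := ℝ) (μ := MeasureTheory.volume)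
    (F := fun s u => halfKernel T ((s : ℝ) + (u : ℝ) * Complex.I))
    (F' := fun s u => F' ((s : ℝ) + (u : ℝ) * Complex.I))
    (bound := fun u => 4 * (1 + u ^ 2)⁻¹ * b) hS
    (Filter.eventually_of_mem hS fun s hs => (continuous_halfKernel_vertical T
      (by have : -(1/2) < s := hs.1
          linarith)).aestronglyMeasurable)
    (integrable_halfKernel_vertical hT hs₀) hF'c.aestronglyMeasurable
    (Filter.Eventually.of_forall hb) ((integrable_inv_one_add_sq.const_mul 4).mul_const b)
    (Filter.Eventually.of_forall fun u s hs => by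
      have hs1 : -(1 / 2) < s := hs.1
      have := HasDerivAt.scomp s (hd s (by linarith) u)
        ((Complex.ofRealCLM.hasDerivAt (x := s)).add_const (u * Complex.I))
      simpa [Function.comp_def] using this)
  have hzero : ∫ u : ℝ, Complex.I • F' (s₀ + u * Complex.I) = 0 := by
    refine MeasureTheory.integral_eq_zero_of_hasDerivAt_of_integrable
      (f := fun u : ℝ => halfKernel T (s₀ + u * Complex.I)) (fun u => ?_)
      (key.1.smul Complex.I) (integrable_halfKernel_vertical hT hs₀)
    have := HasDerivAt.scomp u (hd s₀ (by linarith) u)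
      (((Complex.ofRealCLM.hasDerivAt (x := u)).mul_const Complex.I).const_add (s₀ : ℂ))
    simpa [Function.comp_def] using this
  rw [MeasureTheory.integral_smul, smul_eq_zero] at hzero
  have h0 := hzero.resolve_left Complex.I_ne_zero
  have := key.2
  rw [h0] at this
  exact this

lemma halfIntegral_eq {T : 𝔸} (hT : IsHermitianGenerator T) {s : ℝ} (hs : 0 ≤ s) :
    halfIntegral T s = halfIntegral T 0 := by
  refine IsOpen.is_const_of_deriv_eq_zero (s := Set.Ioi (-(1 / 2) : ℝ)) isOpen_Ioi
    (convex_Ioi _).isPreconnected (fun t ht => ?_) (fun t ht => ?_) ?_ ?_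
  · exact (hasDerivAt_halfIntegral hT ht).differentiableAt.differentiableWithinAt
  · exact (hasDerivAt_halfIntegral hT ht).deriv
  · exact lt_of_lt_of_le (by norm_num) hs
  · simp

lemma norm_expGroup_mul_halfIntegral_le {T : 𝔸} (hT : IsHermitianGenerator T) {s : ℝ}
    (hs : 0 ≤ s) : ‖expGroup T (-s) * halfIntegral T 0‖ ≤ 4 * Real.pi := by
  rw [← halfIntegral_eq hT hs, halfIntegral, ← integral_const_mul_of_integrable
    (integrable_halfKernel_vertical hT (by linarith)), ← integral_univ_inv_one_add_sq,
    ← MeasureTheory.integral_const_mul]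
  refine MeasureTheory.norm_integral_le_of_norm_le (integrable_inv_one_add_sq.const_mul 4)
    (Filter.Eventually.of_forall fun u => ?_)
  rw [halfKernel, mul_smul_comm, ← expGroup_add, neg_add_cancel_left, norm_smul]
  calc _ ≤ 4 * (1 + u ^ 2)⁻¹ * 1 := by
        gcongr
        · exact norm_inv_sq_le (by linarith) u
        · exact hT u
    _ = _ := mul_one _

lemma Commute.halfIntegral_right {S T : 𝔸} (hT : IsHermitianGenerator T)
    (h : Commute S T) : Commute S (halfIntegral T 0) := by
  have hi := integrable_halfKernel_vertical hT (s := 0) (by norm_num)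
  rw [Commute, SemiconjBy, halfIntegral, ← integral_const_mul_of_integrable hi,
    ← integral_mul_const_of_integrable hi]
  congr 1 with u
  exact (h.expGroup_right _).smul_right _

/-- The Poisson integral `∫ exp (iuT) / (1 + u²) du`. -/
noncomputable def poissonIntegral (T : 𝔸) : 𝔸 :=
  ∫ u : ℝ, ((1 + u ^ 2)⁻¹ : ℝ) • expGroup T (u * Complex.I)

lemma continuous_poissonKernel (T : 𝔸) :
    Continuous fun u : ℝ => ((1 + u ^ 2)⁻¹ : ℝ) • expGroup T (u * Complex.I) := by
  have h : Continuous fun u : ℝ => ((1 + u ^ 2)⁻¹ : ℝ) :=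
    Continuous.inv₀ (by fun_prop) fun u => by positivity
  have h' : Continuous fun u : ℝ => (u * Complex.I : ℂ) := by fun_prop
  exact h.smul ((continuous_expGroup T).comp h')

lemma integrable_poissonKernel {T : 𝔸} (hT : IsHermitianGenerator T) :
    MeasureTheory.Integrable fun u : ℝ => ((1 + u ^ 2)⁻¹ : ℝ) • expGroup T (u * Complex.I) :=
  integrable_inv_one_add_sq.mono' (continuous_poissonKernel T).aestronglyMeasurable
    (Filter.Eventually.of_forall (norm_poissonKernel_le hT))

lemma hasDerivAt_poissonKernel (T : 𝔸) {w : ℂ} (h1 : 1 + w ≠ 0) (h2 : 1 - w ≠ 0) :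
    HasDerivAt (fun w : ℂ => ((1 + w)⁻¹ + (1 - w)⁻¹) • expGroup T w)
      (((1 - w) ^ 2)⁻¹ • expGroup T w - ((1 + w) ^ 2)⁻¹ • expGroup T w +
        ((1 + w)⁻¹ + (1 - w)⁻¹) • (T * expGroup T w)) w := by
  have d1 : HasDerivAt (fun w : ℂ => (1 + w)⁻¹) (-((1 + w) ^ 2)⁻¹) w := by
    refine (((hasDerivAt_id w).const_add 1).fun_inv h1).congr_deriv ?_
    simp [div_eq_mul_inv]
  have d2 : HasDerivAt (fun w : ℂ => (1 - w)⁻¹) (((1 - w) ^ 2)⁻¹) w := by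
    refine (((hasDerivAt_id w).const_sub 1).fun_inv h2).congr_deriv ?_
    simp [div_eq_mul_inv]
  refine ((d1.add d2).smul (hasDerivAt_expGroup T w)).congr_deriv ?_
  simp only [Pi.add_apply, add_smul, neg_smul]
  abel

lemma halfIntegral_sub_halfIntegral_neg {T : 𝔸} (hT : IsHermitianGenerator T) :
    halfIntegral T 0 - halfIntegral (-T) 0 = (2 : ℂ) • (T * poissonIntegral T) := by
  have i1 := integrable_halfKernel_vertical hT (s := 0) (by norm_num)
  have i2 := (integrable_halfKernel_vertical hT.neg (s := 0) (by norm_num)).comp_neg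
  have hk1 : ∀ u : ℝ, halfKernel T ((0 : ℝ) + u * Complex.I) =
      ((1 + u * Complex.I) ^ 2)⁻¹ • expGroup T (u * Complex.I) := fun u => by
    simp [halfKernel]
  have hk2 : ∀ u : ℝ, halfKernel (-T) ((0 : ℝ) + (-u : ℝ) * Complex.I) =
      ((1 - u * Complex.I) ^ 2)⁻¹ • expGroup T (u * Complex.I) := fun u => by
    simp [halfKernel, expGroup_neg, sub_eq_add_neg]
  have h2 : halfIntegral (-T) 0 = ∫ u : ℝ, ((1 - u * Complex.I) ^ 2)⁻¹ •
      expGroup T (u * Complex.I) := by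
    rw [halfIntegral, ← MeasureTheory.integral_neg_eq_self]
    exact MeasureTheory.integral_congr_ae (Filter.Eventually.of_forall hk2)
  have h1 : halfIntegral T 0 = ∫ u : ℝ, ((1 + u * Complex.I) ^ 2)⁻¹ •
      expGroup T (u * Complex.I) :=
    MeasureTheory.integral_congr_ae (Filter.Eventually.of_forall hk1)
  simp only [hk1] at i1
  simp only [hk2] at i2
  have hP : MeasureTheory.Integrable fun u : ℝ =>
      ((1 + u ^ 2)⁻¹ : ℝ) • expGroup T (u * Complex.I) := integrable_poissonKernel hT
  have hφ : ∀ u : ℝ, (1 + u * Complex.I : ℂ)⁻¹ + (1 - u * Complex.I)⁻¹ =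
      2 * ((1 + u ^ 2)⁻¹ : ℝ) := fun u => by
    have a : (1 + u * Complex.I : ℂ) ≠ 0 := by
      simpa using one_add_vertical_ne_zero (s := 0) (by norm_num) u
    have b : (1 - u * Complex.I : ℂ) ≠ 0 := by
      simpa [sub_eq_add_neg] using one_add_vertical_ne_zero (s := 0) (by norm_num) (-u)
    have c : (1 + u ^ 2 : ℂ) = (1 + u * Complex.I) * (1 - u * Complex.I) := by
      ring_nf; simp
    push_cast
    rw [c]
    field_simp
    ring
  have hTP : MeasureTheory.Integrable fun u : ℝ => ((1 + u * Complex.I : ℂ)⁻¹ +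
      (1 - u * Complex.I)⁻¹) • (T * expGroup T (u * Complex.I)) := by
    refine ((hP.const_mul T).smul (2 : ℂ)).congr (Filter.Eventually.of_forall fun u => ?_)
    simp only [hφ, Pi.smul_apply, mul_smul, mul_smul_comm, Complex.coe_smul]
  have hTPv : ∫ u : ℝ, ((1 + u * Complex.I : ℂ)⁻¹ + (1 - u * Complex.I)⁻¹) •
      (T * expGroup T (u * Complex.I)) = (2 : ℂ) • (T * poissonIntegral T) := by
    rw [poissonIntegral, ← integral_const_mul_of_integrable hP, ← MeasureTheory.integral_smul]
    refine MeasureTheory.integral_congr_ae (Filter.Eventually.of_forall fun u => ?_)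
    simp only [hφ, mul_smul, mul_smul_comm, Complex.coe_smul]
  have hgi : MeasureTheory.Integrable fun u : ℝ => ((1 + u * Complex.I : ℂ)⁻¹ +
      (1 - u * Complex.I)⁻¹) • expGroup T (u * Complex.I) := by
    refine (hP.smul (2 : ℂ)).congr (Filter.Eventually.of_forall fun u => ?_)
    simp only [hφ, Pi.smul_apply, mul_smul, Complex.coe_smul]
  have hzero := MeasureTheory.integral_eq_zero_of_hasDerivAt_of_integrable
    (f := fun u : ℝ => ((1 + u * Complex.I : ℂ)⁻¹ + (1 - u * Complex.I)⁻¹) •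
      expGroup T (u * Complex.I))
    (f' := fun u : ℝ => Complex.I • (((1 - u * Complex.I) ^ 2)⁻¹ • expGroup T (u * Complex.I) -
      ((1 + u * Complex.I) ^ 2)⁻¹ • expGroup T (u * Complex.I) +
        ((1 + u * Complex.I)⁻¹ + (1 - u * Complex.I)⁻¹) • (T * expGroup T (u * Complex.I))))
    (fun u => ?_) (((i2.sub i1).add hTP).smul Complex.I) hgi
  · rw [MeasureTheory.integral_smul, smul_eq_zero] at hzero
    have h0 := hzero.resolve_left Complex.I_ne_zero
    have e1 := MeasureTheory.integral_add (i2.sub i1) hTP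
    have e2 := MeasureTheory.integral_sub i2 i1
    simp only [Pi.sub_apply] at e1
    rw [e1, e2, hTPv, ← h1, ← h2] at h0
    rw [← sub_eq_zero, ← neg_eq_zero, ← h0]
    abel
  · have a : (1 + u * Complex.I : ℂ) ≠ 0 := by
      simpa using one_add_vertical_ne_zero (s := 0) (by norm_num) u
    have b : (1 - u * Complex.I : ℂ) ≠ 0 := by
      simpa [sub_eq_add_neg] using one_add_vertical_ne_zero (s := 0) (by norm_num) (-u)
    have := HasDerivAt.scomp u (hasDerivAt_poissonKernel T a b)
      ((Complex.ofRealCLM.hasDerivAt (x := u)).mul_const Complex.I)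
    simpa [Function.comp_def] using this

lemma exists_isUnit_poissonIntegral {T : 𝔸} (hT : IsHermitianGenerator T) :
    ∃ c : ℝ, 0 < c ∧ IsUnit (poissonIntegral ((c : ℂ) • T)) := by
  have hc : Continuous fun c : ℝ => poissonIntegral ((c : ℂ) • T) := by
    refine MeasureTheory.continuous_of_dominated (bound := fun u => (1 + u ^ 2)⁻¹)
      (fun c => (continuous_poissonKernel _).aestronglyMeasurable)
      (fun c => Filter.Eventually.of_forall fun u => norm_poissonKernel_le (hT.real_smul c) u)
      integrable_inv_one_add_sq (Filter.Eventually.of_forall fun u => ?_)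
    simp only [expGroup_smul]
    exact ((continuous_expGroup T).comp (by fun_prop)).const_smul _
  have h0 : IsUnit (poissonIntegral (((0 : ℝ) : ℂ) • T)) := by
    simp only [poissonIntegral, expGroup_smul, Complex.ofReal_zero, mul_zero, expGroup_zero,
      integral_smul_const, integral_univ_inv_one_add_sq]
    rw [← Complex.coe_smul, ← Algebra.algebraMap_eq_smul_one]
    exact (IsUnit.mk0 _ (by exact_mod_cast Real.pi_ne_zero)).map _
  have hev : ∀ᶠ c : ℝ in nhds 0, IsUnit (poissonIntegral ((c : ℂ) • T)) :=
    hc.continuousAt.eventually (Units.isOpen.mem_nhds h0)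
  obtain ⟨c, hc, hpos⟩ := ((hev.filter_mono nhdsWithin_le_nhds).and
    (self_mem_nhdsWithin (s := Set.Ioi (0 : ℝ)))).exists
  exact ⟨c, hpos, hc⟩

lemma Commute.poissonIntegral_right {S T : 𝔸} (hT : IsHermitianGenerator T)
    (h : Commute S T) : Commute S (poissonIntegral T) := by
  have hi : MeasureTheory.Integrable fun u : ℝ =>
      ((1 + u ^ 2)⁻¹ : ℝ) • expGroup T (u * Complex.I) := integrable_poissonKernel hT
  rw [Commute, SemiconjBy, poissonIntegral, ← integral_const_mul_of_integrable hi,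
    ← integral_mul_const_of_integrable hi]
  congr 1 with u
  exact (h.expGroup_right _).smul_right _

/-- A Hermitian generator splits into parts growing only in the negative, respectively
the positive direction. -/
lemma exists_add_eq_self {T : 𝔸} (hT : IsHermitianGenerator T) :
    ∃ (Y Z : 𝔸) (C : ℝ), Commute T Y ∧ Commute T Z ∧ Y + Z = T ∧
      ∀ s : ℝ, 0 ≤ s → ‖expGroup T (-s) * Y‖ ≤ C ∧ ‖expGroup T s * Z‖ ≤ C := by
  obtain ⟨c, hc, Q, hQ⟩ := exists_isUnit_poissonIntegral hT
  have hcT := hT.real_smul c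
  have hc' : (c : ℂ) ≠ 0 := by exact_mod_cast hc.ne'
  have hcomm : Commute T ((c : ℂ) • T) := (Commute.refl T).smul_right _
  have hQi : Commute T (↑Q⁻¹ : 𝔸) :=
    (by rw [hQ]; exact Commute.poissonIntegral_right hcT hcomm : Commute T (Q : 𝔸)).units_inv_right
  set Y₀ := halfIntegral ((c : ℂ) • T) 0
  set Z₀ := halfIntegral (-((c : ℂ) • T)) 0
  have hYc : Commute T Y₀ := Commute.halfIntegral_right hcT hcomm
  have hZc : Commute T Z₀ := Commute.halfIntegral_right hcT.neg hcomm.neg_right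
  have key : Y₀ - Z₀ = (2 * c : ℂ) • (T * Q) := by
    rw [halfIntegral_sub_halfIntegral_neg hcT, ← hQ, smul_mul_assoc, smul_smul]
  refine ⟨(2 * c : ℂ)⁻¹ • (Y₀ * ↑Q⁻¹), (2 * c : ℂ)⁻¹ • (-Z₀ * ↑Q⁻¹),
    ‖(2 * c : ℂ)⁻¹‖ * (4 * Real.pi * ‖(↑Q⁻¹ : 𝔸)‖), (hYc.mul_right hQi).smul_right _,
    (hZc.neg_right.mul_right hQi).smul_right _, ?_, fun s hs => ⟨?_, ?_⟩⟩
  · rw [← smul_add, ← add_mul, ← sub_eq_add_neg, key, smul_mul_assoc, smul_smul,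
      inv_mul_cancel₀ (by simpa using hc'), one_smul, mul_assoc, Units.mul_inv, mul_one]
  · rw [mul_smul_comm, norm_smul, ← mul_assoc]
    gcongr
    refine (norm_mul_le _ _).trans ?_
    gcongr
    have := norm_expGroup_mul_halfIntegral_le hcT (div_nonneg hs hc.le)
    rwa [expGroup_smul, Complex.ofReal_div, neg_mul, div_mul_cancel₀ _ hc'] at this
  · rw [mul_smul_comm, norm_smul, ← mul_assoc, mul_neg, neg_mul, norm_neg]
    gcongr
    refine (norm_mul_le _ _).trans ?_
    gcongr
    have := norm_expGroup_mul_halfIntegral_le hcT.neg (div_nonneg hs hc.le)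
    rwa [expGroup_neg, neg_neg, expGroup_smul, Complex.ofReal_div, div_mul_cancel₀ _ hc'] at this

/-- For `a < b` the identity splits into parts whose spectral subspaces lie essentially above `a`
and below `b`. -/
lemma IsHermitianGenerator.exists_add_eq_one {T : 𝔸} (hT : IsHermitianGenerator T) {a b : ℝ}
    (hab : a < b) : ∃ (Y Z : 𝔸) (C : ℝ), Commute T Y ∧ Commute T Z ∧ Y + Z = 1 ∧
      ∀ s : ℝ, 0 ≤ s → ‖expGroup T (-s) * Y‖ ≤ C * Real.exp (-(s * a)) ∧
        ‖expGroup T s * Z‖ ≤ C * Real.exp (s * b) := by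
  obtain ⟨Y₁, Z₁, C₁, hY₁, hZ₁, h₁, hC₁⟩ := exists_add_eq_self (hT.sub_algebraMap a)
  obtain ⟨Y₂, Z₂, C₂, hY₂, hZ₂, h₂, hC₂⟩ := exists_add_eq_self (hT.sub_algebraMap b)
  have hcomm : ∀ {c : ℝ} {S : 𝔸}, Commute (T - algebraMap ℂ 𝔸 c) S → Commute T S :=
    fun {c S} h => by simpa using h.add_left (Algebra.commutes (c : ℂ) S)
  have hexp : ∀ (c s : ℝ) (S : 𝔸), ‖expGroup T s * S‖ =
      Real.exp (s * c) * ‖expGroup (T - algebraMap ℂ 𝔸 c) s * S‖ := fun c s S => by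
    rw [expGroup_sub_algebraMap, smul_mul_assoc, norm_smul, ← mul_assoc, Complex.norm_exp,
      ← Real.exp_add]
    simp
  have hC₁0 : 0 ≤ C₁ := (norm_nonneg _).trans (hC₁ 0 le_rfl).1
  have hC₂0 : 0 ≤ C₂ := (norm_nonneg _).trans (hC₂ 0 le_rfl).1
  have hba : (b - a : ℂ) ≠ 0 := by
    rw [sub_ne_zero]; exact_mod_cast hab.ne'
  refine ⟨(b - a : ℂ)⁻¹ • (Y₁ - Y₂), (b - a : ℂ)⁻¹ • (Z₁ - Z₂), ‖(b - a : ℂ)⁻¹‖ * (C₁ + C₂),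
    ((hcomm hY₁).sub_right (hcomm hY₂)).smul_right _,
    ((hcomm hZ₁).sub_right (hcomm hZ₂)).smul_right _, ?_, fun s hs => ⟨?_, ?_⟩⟩
  · have : Y₁ - Y₂ + (Z₁ - Z₂) = (b - a : ℂ) • 1 := by
      rw [sub_add_sub_comm, h₁, h₂, sub_smul, Algebra.algebraMap_eq_smul_one,
        Algebra.algebraMap_eq_smul_one]
      abel
    rw [← smul_add, this, smul_smul, inv_mul_cancel₀ hba, one_smul]
  · rw [mul_smul_comm, norm_smul, mul_assoc, mul_sub]
    gcongr
    refine (norm_sub_le _ _).trans ?_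
    have e₁ := hexp a (-s) Y₁
    have e₂ := hexp b (-s) Y₂
    push_cast at e₁ e₂
    rw [e₁, e₂, add_mul, mul_comm C₁, mul_comm C₂, neg_mul, neg_mul]
    gcongr
    · exact (hC₁ s hs).1
    · exact (hC₂ s hs).1
  · rw [mul_smul_comm, norm_smul, mul_assoc, mul_sub]
    gcongr
    refine (norm_sub_le _ _).trans ?_
    rw [hexp a s Z₁, hexp b s Z₂, add_mul, mul_comm C₁, mul_comm C₂]
    gcongr
    · exact (hC₁ s hs).2
    · exact (hC₂ s hs).2

end Split

section ExponentialType

variable {F : Type*} [NormedAddCommGroup F] [NormedSpace ℂ F]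

lemma norm_le_exp_of_re_nonneg {f : ℂ → F} (hf : Differentiable ℂ f) {A B C M a : ℝ}
    (hA : ∀ w, ‖f w‖ ≤ A * Real.exp (B * ‖w‖)) (hM : ∀ u : ℝ, ‖f (u * Complex.I)‖ ≤ M)
    (hC : ∀ s : ℝ, 0 ≤ s → ‖f s‖ ≤ C * Real.exp (a * s)) {w : ℂ} (hw : 0 ≤ w.re) :
    ‖f w‖ ≤ M * Real.exp (a * w.re) := by
  let g : ℂ → F := fun w => Complex.exp (-(a * w)) • f w
  have hg : ∀ w : ℂ, ‖g w‖ = Real.exp (-(a * w.re)) * ‖f w‖ := fun w => by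
    simp [g, norm_smul, Complex.norm_exp]
  have key : ‖g w‖ ≤ M := by
    refine PhragmenLindelof.right_half_plane_of_bounded_on_real (f := g) ?_ ?_ ?_ ?_ hw
    · refine Differentiable.diffContOnCl ?_
      fun_prop
    · refine ⟨1, one_lt_two, |a| + B, ?_⟩
      refine Asymptotics.IsBigO.of_bound A (Filter.Eventually.of_forall fun w => ?_)
      rw [hg, Real.rpow_one, Real.norm_of_nonneg (Real.exp_pos _).le, add_mul, Real.exp_add]
      calc _ ≤ Real.exp (|a| * ‖w‖) * (A * Real.exp (B * ‖w‖)) := by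
            gcongr
            · rw [← mul_neg]
              refine (le_abs_self _).trans ?_
              rw [abs_mul, abs_neg]
              gcongr
              exact Complex.abs_re_le_norm w
            · exact hA w
        _ = _ := by ring
    · refine ⟨C, Filter.eventually_map.2 ?_⟩
      filter_upwards [Filter.eventually_ge_atTop 0] with s hs
      rw [hg, Complex.ofReal_re]
      calc _ ≤ Real.exp (-(a * s)) * (C * Real.exp (a * s)) := by gcongr; exact hC s hs
        _ = C := by rw [Real.exp_neg]; field_simp
    · intro u
      simpa [hg] using hM u
  rw [hg, Real.exp_neg, inv_mul_le_iff₀ (Real.exp_pos _)] at key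
  rwa [mul_comm]

/-- An entire function of exponential type which is bounded by `M` on the imaginary axis and whose
type along the real axis is at most `a` has derivative at most `a e M` at the origin. -/
lemma norm_deriv_zero_le_of_exponential_type {f : ℂ → F} (hf : Differentiable ℂ f)
    {A B C M a : ℝ} (ha : 0 < a) (hA : ∀ w, ‖f w‖ ≤ A * Real.exp (B * ‖w‖))
    (hM : ∀ u : ℝ, ‖f (u * Complex.I)‖ ≤ M)
    (hC : ∀ s : ℝ, ‖f s‖ ≤ C * Real.exp (a * |s|)) :
    ‖deriv f 0‖ ≤ a * Real.exp 1 * M := by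
  have hM0 : 0 ≤ M := (norm_nonneg _).trans (hM 0)
  have key : ∀ w : ℂ, ‖f w‖ ≤ M * Real.exp (a * |w.re|) := by
    intro w
    rcases le_total 0 w.re with hw | hw
    · rw [abs_of_nonneg hw]
      exact norm_le_exp_of_re_nonneg hf hA hM
        (fun s hs => by simpa [abs_of_nonneg hs] using hC s) hw
    · rw [abs_of_nonpos hw]
      have := norm_le_exp_of_re_nonneg (f := fun w => f (-w)) (by fun_prop) (A := A) (B := B)
        (C := C) (M := M) (a := a) (fun w => by simpa using hA (-w))
        (fun u => by simpa using hM (-u))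
        (fun s hs => by simpa [abs_of_nonneg hs] using hC (-s)) (w := -w) (by simpa using hw)
      simpa using this
  have := Complex.norm_deriv_le_of_forall_mem_sphere_norm_le (f := f) (c := 0) (R := a⁻¹)
    (C := M * Real.exp 1) (inv_pos.2 ha) hf.diffContOnCl fun z hz => by
      refine (key z).trans ?_
      gcongr
      have hz' : ‖z‖ = a⁻¹ := by simpa using hz
      calc a * |z.re| ≤ a * a⁻¹ := by
            gcongr; rw [← hz']; exact Complex.abs_re_le_norm z
        _ = 1 := mul_inv_cancel₀ ha.ne'
  refine this.trans_eq ?_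
  rw [div_inv_eq_mul]; ring

end ExponentialType

section Growth

variable {E : Type*} [NormedAddCommGroup E] [NormedSpace ℂ E]

/-- The vectors on which `exp (s T)` grows at most like `exp (s b)` as `s → ∞`. -/
def upperGrowth (T : E →L[ℂ] E) (b : ℝ) : Submodule ℂ E where
  carrier := {x | ∃ C : ℝ, ∀ s : ℝ, 0 ≤ s → ‖expGroup T s x‖ ≤ C * Real.exp (s * b)}
  zero_mem' := ⟨0, by simp⟩
  add_mem' := by
    rintro x y ⟨C, hC⟩ ⟨C', hC'⟩
    refine ⟨C + C', fun s hs => ?_⟩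
    rw [map_add, add_mul]
    exact (norm_add_le _ _).trans (add_le_add (hC s hs) (hC' s hs))
  smul_mem' := by
    rintro c x ⟨C, hC⟩
    refine ⟨‖c‖ * C, fun s hs => ?_⟩
    rw [map_smul, norm_smul, mul_assoc]
    gcongr
    exact hC s hs

/-- The vectors on which `exp (-s T)` grows at most like `exp (-s t)` as `s → ∞`. -/
def lowerGrowth (T : E →L[ℂ] E) (t : ℝ) : Submodule ℂ E := upperGrowth (-T) (-t)

lemma mem_upperGrowth {T : E →L[ℂ] E} {b : ℝ} {x : E} : x ∈ upperGrowth T b ↔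
    ∃ C : ℝ, ∀ s : ℝ, 0 ≤ s → ‖expGroup T s x‖ ≤ C * Real.exp (s * b) := Iff.rfl

lemma mem_lowerGrowth {T : E →L[ℂ] E} {t : ℝ} {x : E} : x ∈ lowerGrowth T t ↔
    ∃ C : ℝ, ∀ s : ℝ, 0 ≤ s → ‖expGroup T (-s) x‖ ≤ C * Real.exp (-(s * t)) := by
  simp only [lowerGrowth, mem_upperGrowth, expGroup_neg, mul_neg]

lemma upperGrowth_mono (T : E →L[ℂ] E) : Monotone (upperGrowth T) := by
  rintro a b hab x ⟨C, hC⟩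
  refine ⟨max C 0, fun s hs => (hC s hs).trans ?_⟩
  gcongr
  exact le_max_left _ _

lemma lowerGrowth_antitone (T : E →L[ℂ] E) : Antitone (lowerGrowth T) :=
  fun _ _ h => upperGrowth_mono _ (neg_le_neg h)

lemma map_mem_upperGrowth {S T : E →L[ℂ] E} (h : Commute S T) {b : ℝ} {x : E}
    (hx : x ∈ upperGrowth T b) : S x ∈ upperGrowth T b := by
  obtain ⟨C, hC⟩ := hx
  refine ⟨‖S‖ * C, fun s hs => ?_⟩
  rw [← mul_apply_eq_comp, ← (h.expGroup_right s).eq, mul_apply_eq_comp, mul_assoc]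
  exact (S.le_opNorm _).trans (by gcongr; exact hC s hs)

lemma map_mem_lowerGrowth {S T : E →L[ℂ] E} (h : Commute S T) {t : ℝ} {x : E}
    (hx : x ∈ lowerGrowth T t) : S x ∈ lowerGrowth T t :=
  map_mem_upperGrowth h.neg_right hx

lemma upperGrowth_eq_top {T : E →L[ℂ] E} {b : ℝ} (hb : ‖T‖ ≤ b) : upperGrowth T b = ⊤ := by
  refine eq_top_iff.2 fun x _ => ?_
  obtain ⟨C, hC0, hC⟩ := exists_norm_expGroup_le T
  refine ⟨C * ‖x‖, fun s hs => ((expGroup T s).le_opNorm x).trans ?_⟩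
  have := hC s
  rw [Complex.norm_real, Real.norm_of_nonneg hs] at this
  calc _ ≤ C * Real.exp (‖T‖ * s) * ‖x‖ := by gcongr
    _ ≤ C * Real.exp (b * s) * ‖x‖ := by gcongr
    _ = _ := by rw [mul_comm b]; ring

lemma lowerGrowth_eq_top {T : E →L[ℂ] E} {t : ℝ} (ht : t ≤ -‖T‖) : lowerGrowth T t = ⊤ :=
  upperGrowth_eq_top (by rw [norm_neg]; linarith)

variable [CompleteSpace E]

lemma upperGrowth_eq_bot {T : E →L[ℂ] E} {b : ℝ} (hb : b < -‖T‖) : upperGrowth T b = ⊥ := by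
  refine eq_bot_iff.2 fun x ⟨C, hC⟩ => ?_
  obtain ⟨C', hC0', hC'⟩ := exists_norm_expGroup_le T
  have hle : ∀ s : ℝ, 0 ≤ s → ‖x‖ ≤ C' * C * Real.exp (s * (‖T‖ + b)) := by
    intro s hs
    have h1 : x = expGroup T (-s) (expGroup T s x) := by
      rw [← mul_apply_eq_comp, expGroup_neg_mul, one_apply_eq_self]
    have h2 := hC' (-s)
    rw [norm_neg, Complex.norm_real, Real.norm_of_nonneg hs] at h2
    calc ‖x‖ = ‖expGroup T (-s) (expGroup T s x)‖ := by rw [← h1]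
      _ ≤ ‖expGroup T (-s)‖ * ‖expGroup T s x‖ := le_opNorm _ _
      _ ≤ C' * Real.exp (‖T‖ * s) * (C * Real.exp (s * b)) := by
          gcongr
          exact hC s hs
      _ = C' * C * Real.exp (s * (‖T‖ + b)) := by
          rw [mul_add, Real.exp_add, mul_comm s ‖T‖]; ring
  have hlim : Filter.Tendsto (fun s : ℝ => C' * C * Real.exp (s * (‖T‖ + b))) Filter.atTop
      (nhds (C' * C * 0)) :=
    (Real.tendsto_exp_atBot.comp
      (Filter.tendsto_id.atTop_mul_const_of_neg (by linarith))).const_mul _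
  rw [mul_zero] at hlim
  have := ge_of_tendsto hlim (Filter.eventually_atTop.2 ⟨0, hle⟩)
  exact norm_le_zero_iff.1 this

lemma lowerGrowth_eq_bot {T : E →L[ℂ] E} {t : ℝ} (ht : ‖T‖ < t) : lowerGrowth T t = ⊥ :=
  upperGrowth_eq_bot (by rw [norm_neg]; linarith)

/-- Spectral bands of any positive width span the whole space. -/
lemma IsHermitianGenerator.iSup_band_eq_top {T : E →L[ℂ] E} (hT : IsHermitianGenerator T) {ε : ℝ}
    (hε : 0 < ε) :
    ⨆ k : ℤ, lowerGrowth T (k * ε) ⊓ upperGrowth T ((k + 2) * ε) = ⊤ := by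
  obtain ⟨m, hm⟩ := exists_nat_gt (‖T‖ / ε)
  rw [div_lt_iff₀ hε] at hm
  set V := ⨆ k : ℤ, lowerGrowth T (k * ε) ⊓ upperGrowth T ((k + 2) * ε)
  have key : ∀ n : ℕ, lowerGrowth T (((m - n : ℤ) : ℝ) * ε) ≤ V := by
    intro n
    induction n with
    | zero => rw [lowerGrowth_eq_bot (by simpa using hm)]; exact bot_le
    | succ n ih =>
      set k : ℤ := m - (n + 1 : ℕ) with hk
      have hk1 : (m - n : ℤ) = k + 1 := by rw [hk]; push_cast; ring
      rw [hk1] at ih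
      intro x hx
      obtain ⟨Y, Z, C, hY, hZ, hYZ, hC⟩ := hT.exists_add_eq_one (a := (k + 1) * ε)
        (b := (k + 2) * ε) (by nlinarith)
      have hxx : x = Y x + Z x := by rw [← add_apply, hYZ, one_apply_eq_self]
      rw [hxx]
      refine V.add_mem (ih (mem_lowerGrowth.2 ⟨C * ‖x‖, fun s hs => ?_⟩))
        ((le_iSup (fun k : ℤ => lowerGrowth T (k * ε) ⊓ upperGrowth T ((k + 2) * ε)) k)
          ⟨map_mem_lowerGrowth hZ.symm hx, mem_upperGrowth.2 ⟨C * ‖x‖, fun s hs => ?_⟩⟩)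
      · push_cast
        rw [← mul_apply_eq_comp, mul_right_comm]
        exact (le_opNorm _ _).trans (by gcongr; exact (hC s hs).1)
      · rw [← mul_apply_eq_comp, mul_right_comm]
        exact (le_opNorm _ _).trans (by gcongr; exact (hC s hs).2)
  rw [eq_top_iff]
  refine le_trans (le_of_eq ?_) (key (2 * m))
  rw [lowerGrowth_eq_top]
  push_cast
  nlinarith

end Growth

section Derivation

variable {H K : Type*}
  [NormedAddCommGroup H] [InnerProductSpace ℂ H] [CompleteSpace H]
  [NormedAddCommGroup K] [InnerProductSpace ℂ K] [CompleteSpace K]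

lemma norm_pow_three_le_norm_comp_adjoint_comp (a : K →L[ℂ] H) :
    ‖a‖ ^ 3 ≤ ‖a ∘L adjoint a ∘L a‖ := by
  rcases (norm_nonneg a).eq_or_lt with h | h
  · rw [← h]; simp
  have hsa : adjoint (adjoint a ∘L a) = adjoint a ∘L a := by
    rw [adjoint_comp, adjoint_adjoint]
  have h1 := norm_adjoint_comp_self (adjoint a ∘L a)
  rw [hsa, norm_adjoint_comp_self, comp_assoc] at h1
  have h2 := opNorm_comp_le (adjoint a) (a ∘L adjoint a ∘L a)
  rw [h1, LinearIsometryEquiv.norm_map] at h2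
  refine le_of_mul_le_mul_left ?_ h
  calc _ = ‖a‖ * ‖a‖ * (‖a‖ * ‖a‖) := by ring
    _ ≤ _ := h2

lemma HasDerivAt.of_linearIsometry {E F : Type*} [NormedAddCommGroup E] [NormedSpace ℂ E]
    [NormedAddCommGroup F] [NormedSpace ℂ F] (ι : E →ₗᵢ[ℂ] F) {f : ℂ → E} {f' : E} {w : ℂ}
    (h : HasDerivAt (fun z => ι (f z)) (ι f') w) : HasDerivAt f f' w := by
  rw [hasDerivAt_iff_tendsto_slope] at h ⊢
  rw [ι.isometry.isEmbedding.tendsto_nhds_iff]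
  exact h.congr fun z => by simp [slope_def_module]

lemma HasDerivAt.adjoint_conj {f : ℂ → K →L[ℂ] H} {f' : K →L[ℂ] H} {w : ℂ}
    (h : HasDerivAt f f' (starRingEnd ℂ w)) :
    HasDerivAt (fun z => adjoint (f (starRingEnd ℂ z))) (adjoint f') w := by
  rw [hasDerivAt_iff_tendsto_slope] at h ⊢
  have hconj : Filter.Tendsto (starRingEnd ℂ) (nhdsWithin w {w}ᶜ)
      (nhdsWithin (starRingEnd ℂ w) {starRingEnd ℂ w}ᶜ) :=
    (Complex.continuous_conj.continuousWithinAt).tendsto_nhdsWithin fun z hz h => hz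
      ((starRingEnd ℂ).injective h)
  refine (((adjoint.continuous.tendsto f').comp (h.comp hconj))).congr fun z => ?_
  simp [slope_def_module, map_sub, map_smulₛₗ]

variable {E : Type*} [NormedAddCommGroup E] [NormedSpace ℂ E] [CompleteSpace E]
  {ι : E →ₗᵢ[ℂ] (K →L[ℂ] H)} {tp : E → E → E → E}
  (htp : ∀ x y z, ι (tp x y z) = ι x ∘L adjoint (ι y) ∘L ι z)
  {δ : E →L[ℂ] E} (hδ : ∀ x y z, δ (tp x y z) = tp (δ x) y z + tp x (δ y) z + tp x y (δ z))

include htp hδ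

lemma expGroup_tripleProduct (w : ℂ) (x y z : E) : expGroup δ w (tp x y z) =
    tp (expGroup δ w x) (expGroup δ (starRingEnd ℂ w) y) (expGroup δ w z) := by
  have hd : ∀ (x : E) (w : ℂ), HasDerivAt (fun w => expGroup δ w x) (δ (expGroup δ w x)) w :=
    fun x w => by
      simpa using (hasDerivAt_expGroup δ w).clm_apply (hasDerivAt_const w x)
  have hι : ∀ (x : E) (w : ℂ), HasDerivAt (fun w => ι (expGroup δ w x))
      (ι (δ (expGroup δ w x))) w := fun x w =>
    ι.toContinuousLinearMap.hasFDerivAt.comp_hasDerivAt w (hd x w)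
  let G : ℂ → E := fun w =>
    tp (expGroup δ w x) (expGroup δ (starRingEnd ℂ w) y) (expGroup δ w z)
  have hG : ∀ w, HasDerivAt G (δ (G w)) w := by
    intro w
    refine HasDerivAt.of_linearIsometry ι ?_
    simp only [G, hδ, map_add, htp]
    refine ((hι x w).clm_comp ((hι y _).adjoint_conj.clm_comp (hι z w))).congr_deriv ?_
    rw [comp_add, add_assoc]
  have hP : ∀ w, HasDerivAt (fun w => expGroup (-δ) w (G w)) 0 w := by
    intro w
    refine ((hasDerivAt_expGroup (-δ) w).clm_apply (hG w)).congr_deriv ?_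
    have := ((Commute.refl δ).neg_right.expGroup_right w).eq
    rw [neg_mul, this, neg_apply, mul_apply_eq_comp, neg_add_cancel]
  have hconst := is_const_of_deriv_eq_zero (fun w => (hP w).differentiableAt)
    (fun w => (hP w).deriv) w 0
  simp only [expGroup_neg, expGroup_zero, one_apply_eq_self] at hconst
  have h0 : G 0 = tp x y z := by simp [G]
  rw [← h0, ← hconst, ← mul_apply_eq_comp, expGroup_mul_neg, one_apply_eq_self]

/-- A derivation of a ternary ring of operators exponentiates to isometries. -/
lemma norm_expGroup_le_one_of_derivation (u : ℝ) : ‖expGroup δ u‖ ≤ 1 := by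
  set M := ‖expGroup δ u‖ with hM
  have hM0 : 0 ≤ M := norm_nonneg _
  have h1 : ∀ x : E, ‖expGroup δ u x‖ ^ 3 ≤ M * ‖x‖ ^ 3 := by
    intro x
    have h2 := norm_pow_three_le_norm_comp_adjoint_comp (ι (expGroup δ u x))
    have h3 := expGroup_tripleProduct htp hδ u x x x
    rw [Complex.conj_ofReal] at h3
    rw [← htp, ← h3, ι.norm_map, ι.norm_map] at h2
    refine h2.trans ((le_opNorm _ _).trans ?_)
    gcongr
    rw [← ι.norm_map, htp]
    refine (opNorm_comp_le _ _).trans ?_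
    calc _ ≤ ‖ι x‖ * (‖adjoint (ι x)‖ * ‖ι x‖) := by gcongr; exact opNorm_comp_le _ _
      _ = ‖x‖ ^ 3 := by rw [LinearIsometryEquiv.norm_map, ι.norm_map]; ring
  have hc : (M ^ (3⁻¹ : ℝ)) ^ 3 = M := by
    rw [← Real.rpow_natCast, ← Real.rpow_mul hM0]; norm_num
  have h4 : M ≤ M ^ (3⁻¹ : ℝ) := by
    refine opNorm_le_bound _ (by positivity) fun x => ?_
    refine le_of_pow_le_pow_left₀ (n := 3) three_ne_zero (by positivity) ?_
    rw [mul_pow, hc]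
    exact h1 x
  by_contra! h
  have h5 : M ^ 3 ≤ M := by
    calc M ^ 3 ≤ (M ^ (3⁻¹ : ℝ)) ^ 3 := by gcongr
      _ = M := hc
  exact absurd h5 (lt_self_pow₀ h (by norm_num)).not_ge

/-- Rotating a derivation gives a Hermitian generator. -/
lemma isHermitianGenerator_of_derivation : IsHermitianGenerator (-Complex.I • δ) := fun u => by
  rw [expGroup_smul]
  have : (u * Complex.I * -Complex.I : ℂ) = u := by
    rw [mul_neg, mul_assoc, Complex.I_mul_I]; ring
  rw [this]
  exact norm_expGroup_le_one_of_derivation htp hδ u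

lemma expGroup_tripleProduct_of_rotated (s : ℝ) (x y z : E) :
    expGroup (-Complex.I • δ) s (tp x y z) = tp (expGroup (-Complex.I • δ) s x)
      (expGroup (-Complex.I • δ) (-s) y) (expGroup (-Complex.I • δ) s z) := by
  simp only [expGroup_smul]
  rw [expGroup_tripleProduct htp hδ]
  simp

end Derivation

section Filtration

/-- An increasing family of closed subspaces, trivial below `-R` and full from `R` on. -/
structure BoundedFiltration (H : Type*) [NormedAddCommGroup H] [InnerProductSpace ℂ H]
    (R : ℕ) where
  /-- The subspace at a real parameter. -/
  space : ℝ → Submodule ℂ H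
  isClosed : ∀ r, IsClosed (space r : Set H)
  mono : Monotone space
  eq_bot : ∀ r : ℝ, r ≤ -R → space r = ⊥
  eq_top : ∀ r : ℝ, R ≤ r → space r = ⊤

variable {H K : Type*}
  [NormedAddCommGroup H] [InnerProductSpace ℂ H] [CompleteSpace H]
  [NormedAddCommGroup K] [InnerProductSpace ℂ K] [CompleteSpace K]
  {E : Type*} [NormedAddCommGroup E] [NormedSpace ℂ E]
  {ι : E →ₗᵢ[ℂ] (K →L[ℂ] H)} {tp : E → E → E → E}
  (htp : ∀ x y z, ι (tp x y z) = ι x ∘L adjoint (ι y) ∘L ι z)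
  {T : E →L[ℂ] E}
  (hTtp : ∀ (s : ℝ) (x y z : E), expGroup T s (tp x y z) =
    tp (expGroup T s x) (expGroup T (-s) y) (expGroup T s z))

include htp in
lemma norm_tripleProduct_le (x y z : E) : ‖tp x y z‖ ≤ ‖x‖ * ‖y‖ * ‖z‖ := by
  rw [← ι.norm_map, htp]
  refine (opNorm_comp_le _ _).trans ?_
  calc _ ≤ ‖ι x‖ * (‖adjoint (ι y)‖ * ‖ι z‖) := by gcongr; exact opNorm_comp_le _ _
    _ = _ := by simp only [LinearIsometryEquiv.norm_map, ι.norm_map]; ring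

include htp hTtp in
lemma tripleProduct_mem_lowerGrowth {t b r : ℝ} {x y z : E} (hx : x ∈ lowerGrowth T t)
    (hy : y ∈ upperGrowth T b) (hz : z ∈ lowerGrowth T (r + b)) :
    tp x y z ∈ lowerGrowth T (t + r) := by
  obtain ⟨C₁, hC₁⟩ := mem_lowerGrowth.1 hx
  obtain ⟨C₂, hC₂⟩ := mem_upperGrowth.1 hy
  obtain ⟨C₃, hC₃⟩ := mem_lowerGrowth.1 hz
  refine mem_lowerGrowth.2 ⟨C₁ * C₂ * C₃, fun s hs => ?_⟩
  have h := hTtp (-s) x y z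
  simp only [Complex.ofReal_neg, neg_neg] at h
  rw [h]
  have h₁ := (norm_nonneg _).trans (hC₁ s hs)
  have h₂ := (norm_nonneg _).trans (hC₂ s hs)
  refine (norm_tripleProduct_le htp _ _ _).trans ((mul_le_mul (mul_le_mul (hC₁ s hs) (hC₂ s hs)
    (norm_nonneg _) h₁) (hC₃ s hs) (norm_nonneg _) (mul_nonneg h₁ h₂)).trans_eq ?_)
  have : Real.exp (-(s * (t + r))) =
      Real.exp (-(s * t)) * Real.exp (s * b) * Real.exp (-(s * (r + b))) := by
    rw [← Real.exp_add, ← Real.exp_add]; ring_nf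
  rw [this]; ring

variable (ι T)

/-- The orthogonal complement of the ranges of the operators with spectrum above `r`. -/
noncomputable def leftNull (r : ℝ) : Submodule ℂ H := ⨅ y ∈ lowerGrowth T r, (adjoint (ι y)).ker

/-- The vectors annihilated by every `y* x` with spectrum above `r`. -/
noncomputable def rightNull (r : ℝ) : Submodule ℂ K :=
  ⨅ b : ℝ, ⨅ x ∈ upperGrowth T b, ⨅ y ∈ lowerGrowth T (r + b), (adjoint (ι y) ∘L ι x).ker

variable {ι T}

lemma mem_leftNull {r : ℝ} {η : H} :
    η ∈ leftNull ι T r ↔ ∀ y ∈ lowerGrowth T r, adjoint (ι y) η = 0 := by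
  simp [leftNull, Submodule.mem_iInf]

lemma mem_rightNull {r : ℝ} {ξ : K} : ξ ∈ rightNull ι T r ↔ ∀ b : ℝ, ∀ x ∈ upperGrowth T b,
    ∀ y ∈ lowerGrowth T (r + b), adjoint (ι y) (ι x ξ) = 0 := by
  simp [rightNull, Submodule.mem_iInf]

variable [CompleteSpace E] {R : ℕ} (hR : 2 * ‖T‖ < R)

variable (ι) in
/-- The filtration of `H` by the subspaces `leftNull`. -/
noncomputable def leftFiltration : BoundedFiltration H R where
  space r := if r ≤ -R then ⊥ else leftNull ι T r
  isClosed r := by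
    split_ifs
    · simp
    · simp only [leftNull, Submodule.coe_iInf]
      exact isClosed_iInter fun y => isClosed_iInter fun _ => isClosed_ker _
  mono r s hrs := by
    dsimp only
    split_ifs with h1 h2 h2
    · exact bot_le
    · exact bot_le
    · linarith
    · exact fun η hη => mem_leftNull.2 fun y hy =>
        mem_leftNull.1 hη y (lowerGrowth_antitone T hrs hy)
  eq_bot r hr := if_pos hr
  eq_top r hr := by
    have : ‖T‖ < R := by linarith [norm_nonneg T]
    rw [if_neg (by linarith [norm_nonneg T]), eq_top_iff]
    intro η _
    refine mem_leftNull.2 fun y hy => ?_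
    rw [lowerGrowth_eq_bot (by linarith), Submodule.mem_bot] at hy
    simp [hy]

variable (ι) in
/-- The filtration of `K` by the subspaces `rightNull`. -/
noncomputable def rightFiltration : BoundedFiltration K R where
  space r := if r ≤ -R then ⊥ else rightNull ι T r
  isClosed r := by
    split_ifs
    · simp
    · simp only [rightNull, Submodule.coe_iInf]
      exact isClosed_iInter fun b => isClosed_iInter fun x => isClosed_iInter fun _ =>
        isClosed_iInter fun y => isClosed_iInter fun _ => isClosed_ker _
  mono r s hrs := by
    dsimp only
    split_ifs with h1 h2 h2
    · exact bot_le
    · exact bot_le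
    · linarith
    · exact fun ξ hξ => mem_rightNull.2 fun b x hx y hy =>
        mem_rightNull.1 hξ b x hx y (lowerGrowth_antitone T (by linarith) hy)
  eq_bot r hr := if_pos hr
  eq_top r hr := by
    have : ‖T‖ < R := by linarith [norm_nonneg T]
    rw [if_neg (by linarith [norm_nonneg T]), eq_top_iff]
    intro ξ _
    refine mem_rightNull.2 fun b x hx y hy => ?_
    rcases lt_or_ge b (-‖T‖) with hb | hb
    · rw [upperGrowth_eq_bot hb, Submodule.mem_bot] at hx
      simp [hx]
    · rw [lowerGrowth_eq_bot (by linarith), Submodule.mem_bot] at hy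
      simp [hy]

include htp hTtp in
lemma adjoint_map_leftFiltration {t r : ℝ} {z : E} (hz : z ∈ lowerGrowth T t) {η : H}
    (hη : η ∈ (leftFiltration ι hR).space (r + t)) :
    adjoint (ι z) η ∈ (rightFiltration ι hR).space r := by
  simp only [leftFiltration, rightFiltration] at hη ⊢
  split_ifs at hη with h1
  · rw [(Submodule.mem_bot ℂ).1 hη, map_zero]
    exact zero_mem _
  · rw [mem_leftNull] at hη
    split_ifs with h2
    · have hr : r ≤ 0 := h2.trans (by simp)
      exact (Submodule.mem_bot ℂ).2 (hη z (lowerGrowth_antitone T (by linarith) hz))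
    · refine mem_rightNull.2 fun b x hx y hy => ?_
      have h := hη _ (add_comm t r ▸ tripleProduct_mem_lowerGrowth htp hTtp hz hx hy)
      rw [htp, adjoint_comp, adjoint_comp, adjoint_adjoint] at h
      exact h

lemma map_rightFiltration {b r : ℝ} {x : E} (hx : x ∈ upperGrowth T b) {ξ : K}
    (hξ : ξ ∈ (rightFiltration ι hR).space r) :
    ι x ξ ∈ (leftFiltration ι hR).space (r + b) := by
  simp only [leftFiltration, rightFiltration] at hξ ⊢
  split_ifs at hξ with h1
  · rw [(Submodule.mem_bot ℂ).1 hξ, map_zero]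
    exact zero_mem _
  · rw [mem_rightNull] at hξ
    split_ifs with h2
    · have h3 : x ∈ lowerGrowth T (r + b) := by
        rw [lowerGrowth_eq_top (by linarith [norm_nonneg T])]; trivial
      have h4 := apply_norm_sq_eq_inner_adjoint_left (ι x) ξ
      rw [coe_comp, Function.comp_apply, hξ b x hx x h3] at h4
      simpa using h4
    · exact mem_leftNull.2 fun y hy => hξ b x hx y hy

lemma map_leftFiltration_of_commute {t : H →L[ℂ] H}
    (ht : ∀ x y : E, t ∘L (ι x ∘L adjoint (ι y)) = (ι x ∘L adjoint (ι y)) ∘L t) {r : ℝ} {η : H}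
    (hη : η ∈ (leftFiltration ι hR).space r) : t η ∈ (leftFiltration ι hR).space r := by
  simp only [leftFiltration] at hη ⊢
  split_ifs at hη ⊢ with h
  · simp [(Submodule.mem_bot ℂ).1 hη]
  · refine mem_leftNull.2 fun y hy => ?_
    have h1 : ι y (adjoint (ι y) (t η)) = 0 := by
      have := congrArg (fun A : H →L[ℂ] H => A η) (ht y y)
      simp only [comp_apply, mem_leftNull.1 hη y hy, map_zero] at this
      exact this.symm
    have h2 := apply_norm_sq_eq_inner_adjoint_left (adjoint (ι y)) (t η)
    rw [adjoint_adjoint, comp_apply, h1] at h2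
    simpa using h2

lemma map_rightFiltration_of_commute {t : K →L[ℂ] K}
    (ht : ∀ x y : E, t ∘L (adjoint (ι x) ∘L ι y) = (adjoint (ι x) ∘L ι y) ∘L t) {r : ℝ} {ξ : K}
    (hξ : ξ ∈ (rightFiltration ι hR).space r) : t ξ ∈ (rightFiltration ι hR).space r := by
  simp only [rightFiltration] at hξ ⊢
  split_ifs at hξ ⊢ with h
  · simp [(Submodule.mem_bot ℂ).1 hξ]
  · refine mem_rightNull.2 fun b x hx y hy => ?_
    have := congrArg (fun A : K →L[ℂ] K => A ξ) (ht y x)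
    simp only [comp_apply, mem_rightNull.1 hξ b x hx y hy, map_zero] at this
    exact this.symm

end Filtration

section Resolution

open Finset

variable {H : Type*} [NormedAddCommGroup H] [InnerProductSpace ℂ H] [CompleteSpace H]

lemma norm_sum_smul_le_of_orthogonal {N : ℕ} {Q : ℕ → H →L[ℂ] H}
    (hadj : ∀ i, adjoint (Q i) = Q i) (hmul : ∀ i j, Q i * Q j = if i = j then Q i else 0)
    (hsum : ∑ i ∈ range N, Q i = 1) {a : ℕ → ℂ} {C : ℝ} (hC : 0 ≤ C)
    (ha : ∀ i ∈ range N, ‖a i‖ ≤ C) : ‖∑ i ∈ range N, a i • Q i‖ ≤ C := by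
  have hin : ∀ (i j : ℕ) (ξ : H), inner ℂ (Q i ξ) (Q j ξ) =
      if i = j then ((‖Q i ξ‖ ^ 2 : ℝ) : ℂ) else 0 := by
    intro i j ξ
    split_ifs with h
    · rw [h, inner_self_eq_norm_sq_to_K]; norm_cast
    · conv_lhs => rw [← hadj i]
      rw [adjoint_inner_left]
      have := congrArg (fun A : H →L[ℂ] H => A ξ) (hmul i j)
      simp only [if_neg h, mul_apply_eq_comp] at this
      rw [this]; simp
  have key : ∀ (b : ℕ → ℂ) (ξ : H), ‖∑ i ∈ range N, b i • Q i ξ‖ ^ 2 =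
      ∑ i ∈ range N, ‖b i‖ ^ 2 * ‖Q i ξ‖ ^ 2 := by
    intro b ξ
    have h : ((‖∑ i ∈ range N, b i • Q i ξ‖ ^ 2 : ℝ) : ℂ) =
        ((∑ i ∈ range N, ‖b i‖ ^ 2 * ‖Q i ξ‖ ^ 2 : ℝ) : ℂ) := by
      have := inner_self_eq_norm_sq_to_K (𝕜 := ℂ) (∑ i ∈ range N, b i • Q i ξ)
      push_cast
      rw [← Complex.coe_algebraMap] 
      rw [← this, sum_inner]
      refine sum_congr rfl fun i hi => ?_
      rw [inner_sum, sum_eq_single i]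
      · rw [inner_smul_left, inner_smul_right, hin, if_pos rfl, ← mul_assoc, Complex.conj_mul']
        push_cast; rfl
      · intro j _ hj
        rw [inner_smul_left, inner_smul_right, hin, if_neg hj.symm]; simp
      · exact fun h => absurd hi h
    exact_mod_cast h
  refine opNorm_le_bound _ hC fun ξ => ?_
  have h1 : ‖ξ‖ ^ 2 = ∑ i ∈ range N, ‖Q i ξ‖ ^ 2 := by
    have h := key 1 ξ
    have h' := congrArg (fun A : H →L[ℂ] H => A ξ) hsum
    simp only [_root_.sum_apply, one_apply_eq_self] at h'
    simpa [h'] using h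
  rw [← sq_le_sq₀ (norm_nonneg _) (by positivity), mul_pow, h1, _root_.sum_apply]
  simp only [smul_apply]
  rw [key, mul_sum]
  refine sum_le_sum fun i hi => ?_
  gcongr
  exact ha i hi

end Resolution

namespace BoundedFiltration

open Finset Filter Topology

variable {H K : Type*}
  [NormedAddCommGroup H] [InnerProductSpace ℂ H] [CompleteSpace H]
  [NormedAddCommGroup K] [InnerProductSpace ℂ K] [CompleteSpace K]
  {R : ℕ} (G : BoundedFiltration H R) (G' : BoundedFiltration K R)

/-- The projection onto the orthogonal complement of a subspace of the filtration. -/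
noncomputable def proj (r : ℝ) : H →L[ℂ] H := (G.space r)ᗮ.starProjection

lemma adjoint_proj (r : ℝ) : adjoint (G.proj r) = G.proj r :=
  (isStarProjection_starProjection (U := (G.space r)ᗮ)).isSelfAdjoint

variable {G} in
lemma proj_apply_eq_zero {r : ℝ} {ξ : H} (h : ξ ∈ G.space r) : G.proj r ξ = 0 :=
  (Submodule.starProjection_apply_eq_zero_iff _).2 (Submodule.le_orthogonal_orthogonal _ h)

lemma sub_proj_mem (r : ℝ) (ξ : H) : ξ - G.proj r ξ ∈ G.space r := by
  have h := Submodule.sub_starProjection_mem_orthogonal (K := (G.space r)ᗮ) ξ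
  rwa [Submodule.orthogonal_orthogonal_eq_closure, (G.isClosed r).submodule_topologicalClosure_eq]
    at h

variable {G G'} in
lemma proj_comp_eq {A : H →L[ℂ] K} {r s : ℝ} (hA : ∀ ξ ∈ G.space r, A ξ ∈ G'.space s) :
    G'.proj s ∘L A ∘L G.proj r = G'.proj s ∘L A := by
  ext ξ
  have h := proj_apply_eq_zero (hA _ (G.sub_proj_mem r ξ))
  rw [map_sub, map_sub, sub_eq_zero] at h
  exact h.symm

variable {G G'} in
lemma comp_proj_eq {A : H →L[ℂ] K} {r s : ℝ} (hA : ∀ ξ ∈ G'.space s, adjoint A ξ ∈ G.space r) :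
    G'.proj s ∘L A ∘L G.proj r = A ∘L G.proj r := by
  have h := congrArg adjoint (proj_comp_eq hA)
  simpa only [adjoint_comp, adjoint_adjoint, adjoint_proj, comp_assoc] using h

variable {G} in
lemma commute_proj {t : H →L[ℂ] H} {r : ℝ} (ht : ∀ ξ ∈ G.space r, t ξ ∈ G.space r)
    (ht' : ∀ ξ ∈ G.space r, adjoint t ξ ∈ G.space r) : Commute t (G.proj r) :=
  (comp_proj_eq ht').symm.trans (proj_comp_eq ht)

lemma proj_mul_proj_of_ge {r s : ℝ} (h : s ≤ r) : G.proj r * G.proj s = G.proj r :=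
  proj_comp_eq (G := G) (G' := G) (A := .id ℂ H) fun _ hξ => G.mono h hξ

lemma proj_mul_proj_of_le {r s : ℝ} (h : r ≤ s) : G.proj r * G.proj s = G.proj s := by
  have h := congrArg adjoint (G.proj_mul_proj_of_ge h)
  rwa [ContinuousLinearMap.mul_def, adjoint_comp, adjoint_proj, adjoint_proj] at h

lemma proj_eq_one {r : ℝ} (hr : r ≤ -R) : G.proj r = 1 := by
  ext ξ
  have h := G.sub_proj_mem r ξ
  rw [G.eq_bot r hr, Submodule.mem_bot, sub_eq_zero] at h
  exact h.symm

lemma proj_eq_zero {r : ℝ} (hr : R ≤ r) : G.proj r = 0 := by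
  ext ξ
  exact proj_apply_eq_zero (by rw [G.eq_top r hr]; trivial)

/-- The dyadic points of level `n`, starting from `-R`. -/
noncomputable def point (R n i : ℕ) : ℝ := -R + i / 2 ^ n

lemma point_le_point {n i j : ℕ} (h : i ≤ j) : point R n i ≤ point R n j := by
  unfold point; gcongr

/-- The spectral projection of a dyadic interval. -/
noncomputable def gap (n i : ℕ) : H →L[ℂ] H :=
  G.proj (point R n i) - G.proj (point R n (i + 1))

lemma adjoint_gap (n i : ℕ) : adjoint (G.gap n i) = G.gap n i := by
  simp [gap, adjoint_proj]

lemma gap_mul_proj_eq_zero {n i : ℕ} {r : ℝ} (h : point R n (i + 1) ≤ r) :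
    G.gap n i * G.proj r = 0 := by
  rw [gap, sub_mul, proj_mul_proj_of_le _ h,
    proj_mul_proj_of_le _ ((point_le_point i.le_succ).trans h), sub_self]

lemma proj_mul_gap_eq_zero {n i : ℕ} {r : ℝ} (h : point R n (i + 1) ≤ r) :
    G.proj r * G.gap n i = 0 := by
  rw [gap, mul_sub, proj_mul_proj_of_ge _ h,
    proj_mul_proj_of_ge _ ((point_le_point i.le_succ).trans h), sub_self]

lemma gap_mul_proj {n i : ℕ} {r : ℝ} (h : r ≤ point R n i) :
    G.gap n i * G.proj r = G.gap n i := by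
  rw [gap, sub_mul, proj_mul_proj_of_ge _ h,
    proj_mul_proj_of_ge _ (h.trans (point_le_point i.le_succ))]

lemma proj_mul_gap {n i : ℕ} {r : ℝ} (h : r ≤ point R n i) :
    G.proj r * G.gap n i = G.gap n i := by
  rw [gap, mul_sub, proj_mul_proj_of_le _ h,
    proj_mul_proj_of_le _ (h.trans (point_le_point i.le_succ))]

lemma gap_mul_gap (n i j : ℕ) : G.gap n i * G.gap n j = if i = j then G.gap n i else 0 := by
  rcases lt_trichotomy i j with h | rfl | h
  · rw [if_neg h.ne, ← G.proj_mul_gap (le_refl (point R n j)), ← mul_assoc,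
      G.gap_mul_proj_eq_zero (point_le_point h), zero_mul]
  · conv_lhs => enter [1]; rw [gap]
    rw [sub_mul, if_pos rfl, G.proj_mul_gap (le_refl (point R n i)),
      G.proj_mul_gap_eq_zero le_rfl, sub_zero]
  · rw [if_neg h.ne', ← G.gap_mul_proj (le_refl (point R n i)), mul_assoc,
      G.proj_mul_gap_eq_zero (point_le_point h), mul_zero]

lemma sum_gap (n : ℕ) : ∑ i ∈ range (2 * R * 2 ^ n), G.gap n i = 1 := by
  simp only [gap]
  rw [sum_range_sub' (fun i => G.proj (point R n i)), G.proj_eq_one (by simp [point]),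
    G.proj_eq_zero, sub_zero]
  have : (2 : ℝ) ^ n ≠ 0 := by positivity
  simp only [point, Nat.cast_mul, Nat.cast_pow, Nat.cast_ofNat, mul_div_cancel_right₀ _ this]
  linarith

/-- The functional calculus of a function on the dyadic points of level `n`. -/
noncomputable def dyadicSum (n : ℕ) (a : ℕ → ℂ) : H →L[ℂ] H :=
  ∑ i ∈ range (2 * R * 2 ^ n), a i • G.gap n i

lemma norm_dyadicSum_le {n : ℕ} {a : ℕ → ℂ} {C : ℝ} (hC : 0 ≤ C)
    (ha : ∀ i < 2 * R * 2 ^ n, ‖a i‖ ≤ C) :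
    ‖G.dyadicSum n a‖ ≤ C :=
  norm_sum_smul_le_of_orthogonal (G.adjoint_gap n) (G.gap_mul_gap n) (G.sum_gap n) hC
    fun i hi => ha i (mem_range.1 hi)

lemma dyadicSum_comp_comp_dyadicSum (n : ℕ) (a b : ℕ → ℂ) (A : K →L[ℂ] H) :
    G.dyadicSum n a ∘L A ∘L G'.dyadicSum n b = ∑ i ∈ range (2 * R * 2 ^ n),
      ∑ j ∈ range (2 * R * 2 ^ n), (a i * b j) • (G.gap n i ∘L A ∘L G'.gap n j) := by
  simp only [dyadicSum, finsetSum_comp, comp_finsetSum, smul_comp, comp_smul, smul_sum, smul_smul]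
  rw [sum_comm]
  exact sum_congr rfl fun i _ => sum_congr rfl fun j _ => by rw [mul_comm]

lemma dyadicSum_one (n : ℕ) : G.dyadicSum n (fun _ => 1) = 1 := by
  simp only [dyadicSum, one_smul, sum_gap]

lemma hasDerivAt_dyadicSum_exp (n : ℕ) (a : ℕ → ℂ) (w : ℂ) :
    HasDerivAt (fun w => G.dyadicSum n fun i => Complex.exp (w * a i))
      (G.dyadicSum n fun i => Complex.exp (w * a i) * a i) w := by
  refine HasDerivAt.fun_sum fun i _ => HasDerivAt.smul_const ?_ _
  simpa using ((hasDerivAt_id w).mul_const (a i)).cexp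

lemma dyadicSum_succ (n : ℕ) (a : ℕ → ℂ) :
    G.dyadicSum (n + 1) (fun i => a (i / 2)) = G.dyadicSum n a := by
  have hgap : ∀ i, G.gap n i = G.gap (n + 1) (2 * i) + G.gap (n + 1) (2 * i + 1) := by
    intro i
    have h : ∀ j : ℕ, point R (n + 1) (2 * j) = point R n j := fun j => by
      simp only [point]; push_cast; rw [pow_succ']; field_simp
    simp only [gap]
    rw [h, show 2 * i + 1 + 1 = 2 * (i + 1) by ring, h]
    abel
  have hsum : ∀ (N : ℕ) (F : ℕ → H →L[ℂ] H), ∑ i ∈ range (2 * N), F i =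
      ∑ i ∈ range N, (F (2 * i) + F (2 * i + 1)) := by
    intro N F
    induction N with
    | zero => simp
    | succ k ih => rw [mul_add_one, sum_range_succ, sum_range_succ, ih, sum_range_succ, add_assoc]
  rw [dyadicSum, show 2 * R * 2 ^ (n + 1) = 2 * (2 * R * 2 ^ n) by ring, hsum]
  refine sum_congr rfl fun i _ => ?_
  rw [hgap, smul_add, show 2 * i / 2 = i by omega, show (2 * i + 1) / 2 = i by omega]

/-- The dyadic approximations of the self-adjoint operator attached to the filtration. -/
noncomputable def approx (n : ℕ) : H →L[ℂ] H := G.dyadicSum n fun i => point R n i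

lemma dist_approx_succ_le (n : ℕ) : dist (G.approx n) (G.approx (n + 1)) ≤ 1 * (1 / 2) ^ n := by
  rw [dist_comm, dist_eq_norm, approx, approx, ← G.dyadicSum_succ n, dyadicSum, dyadicSum,
    ← sum_sub_distrib]
  simp only [← sub_smul]
  refine G.norm_dyadicSum_le (by positivity) fun i _ => ?_
  rw [← Complex.ofReal_sub, Complex.norm_real, Real.norm_eq_abs]
  have h : point R (n + 1) i - point R n (i / 2) = (i - 2 * (i / 2 : ℕ)) / 2 * (1 / 2) ^ n := by
    simp only [point]; rw [pow_succ', one_div_pow]; field_simp; ring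
  have h' : ((i : ℝ) - 2 * (i / 2 : ℕ)) = (i % 2 : ℕ) := by
    rw [sub_eq_iff_eq_add]; exact_mod_cast (Nat.mod_add_div i 2).symm
  have h'' : ((i % 2 : ℕ) : ℝ) ≤ 1 := by exact_mod_cast Nat.le_of_lt_succ (Nat.mod_lt i two_pos)
  rw [h, h', abs_of_nonneg (by positivity)]
  gcongr
  linarith

lemma adjoint_approx (n : ℕ) : adjoint (G.approx n) = G.approx n := by
  simp only [approx, dyadicSum, map_sum, map_smulₛₗ, adjoint_gap, Complex.conj_ofReal]

variable {G} in
lemma commute_approx {t : H →L[ℂ] H} (ht : ∀ r, Commute t (G.proj r)) (n : ℕ) :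
    Commute t (G.approx n) :=
  Commute.sum_right _ _ _ fun _ _ => ((ht _).sub_right (ht _)).smul_right _

lemma exists_tendsto_approx : ∃ h : H →L[ℂ] H, Tendsto G.approx atTop (𝓝 h) ∧ adjoint h = h ∧
    ∀ t : H →L[ℂ] H, (∀ r, Commute t (G.proj r)) → t * h = h * t := by
  obtain ⟨h, hh⟩ := cauchySeq_tendsto_of_complete
    (cauchySeq_of_le_geometric (1 / 2) 1 (by norm_num) G.dist_approx_succ_le)
  refine ⟨h, hh, ?_, fun t ht => ?_⟩
  · have h1 := ((adjoint (𝕜 := ℂ) (E := H) (F := H)).continuous.tendsto h).comp hh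
    refine tendsto_nhds_unique h1 (hh.congr fun n => (G.adjoint_approx n).symm)
  · exact tendsto_nhds_unique (hh.const_mul t)
      ((hh.mul_const t).congr fun n => (commute_approx ht n).eq.symm)

end BoundedFiltration

section Approximation

open BoundedFiltration Finset Filter Topology

variable {H K : Type*}
  [NormedAddCommGroup H] [InnerProductSpace ℂ H] [CompleteSpace H]
  [NormedAddCommGroup K] [InnerProductSpace ℂ K] [CompleteSpace K]
  {E : Type*} [NormedAddCommGroup E] [NormedSpace ℂ E] [CompleteSpace E]
  {ι : E →ₗᵢ[ℂ] (K →L[ℂ] H)} {tp : E → E → E → E}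
  (htp : ∀ x y z, ι (tp x y z) = ι x ∘L adjoint (ι y) ∘L ι z)
  {T : E →L[ℂ] E}
  (hTtp : ∀ (s : ℝ) (x y z : E), expGroup T s (tp x y z) =
    tp (expGroup T s x) (expGroup T (-s) y) (expGroup T s z))
  {R : ℕ} (hR : 2 * ‖T‖ < R)

include htp hTtp in
lemma gap_comp_gap_eq_zero_of_lt {n i j : ℕ} {t : ℝ} {z : E} (hz : z ∈ lowerGrowth T t)
    (h : point R n (i + 1) ≤ point R n j + t) :
    (leftFiltration ι hR).gap n i ∘L ι z ∘L (rightFiltration ι hR).gap n j = 0 := by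
  have h1 := comp_proj_eq (G := rightFiltration ι hR) (G' := leftFiltration ι hR) (A := ι z)
    (r := point R n j) (s := point R n j + t)
    fun η hη => adjoint_map_leftFiltration htp hTtp hR hz hη
  rw [← (rightFiltration ι hR).proj_mul_gap (le_refl (point R n j)), ContinuousLinearMap.mul_def,
    ← comp_assoc (ι z), ← h1, comp_assoc, ← comp_assoc, ← ContinuousLinearMap.mul_def,
    gap_mul_proj_eq_zero _ h, zero_comp]

lemma gap_comp_gap_eq_zero_of_gt {n i j : ℕ} {b : ℝ} {z : E} (hz : z ∈ upperGrowth T b)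
    (h : point R n (j + 1) + b ≤ point R n i) :
    (leftFiltration ι hR).gap n i ∘L ι z ∘L (rightFiltration ι hR).gap n j = 0 := by
  have h1 := proj_comp_eq (G := rightFiltration ι hR) (G' := leftFiltration ι hR) (A := ι z)
    (r := point R n (j + 1)) (s := point R n (j + 1) + b)
    fun η hη => map_rightFiltration hR hz hη
  rw [← (leftFiltration ι hR).gap_mul_proj h, ContinuousLinearMap.mul_def,
    comp_assoc, ← comp_assoc _ (ι z), ← h1, comp_assoc, comp_assoc, ← ContinuousLinearMap.mul_def,
    proj_mul_gap_eq_zero _ le_rfl, comp_zero, comp_zero, comp_zero]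

/-- The transport of `exp (w T) x` back by the dyadic approximations of the filtrations. -/
noncomputable def bandTransport (ι : E →ₗᵢ[ℂ] (K →L[ℂ] H)) (hR : 2 * ‖T‖ < R) (n : ℕ) (x : E)
    (w : ℂ) : K →L[ℂ] H :=
  (leftFiltration ι hR).dyadicSum n (fun i => Complex.exp (w * -point R n i)) ∘L
    ι (expGroup T w x) ∘L
    (rightFiltration ι hR).dyadicSum n (fun i => Complex.exp (w * point R n i))

variable (ι) in
lemma hasDerivAt_bandTransport (n : ℕ) (x : E) (w : ℂ) : HasDerivAt (bandTransport ι hR n x)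
    ((leftFiltration ι hR).dyadicSum n
        (fun i => Complex.exp (w * -point R n i) * -point R n i) ∘L
      (ι (expGroup T w x) ∘L
        (rightFiltration ι hR).dyadicSum n (fun i => Complex.exp (w * point R n i))) +
      (leftFiltration ι hR).dyadicSum n (fun i => Complex.exp (w * -point R n i)) ∘L
      (ι (T (expGroup T w x)) ∘L
        (rightFiltration ι hR).dyadicSum n (fun i => Complex.exp (w * point R n i)) +
      ι (expGroup T w x) ∘L
        (rightFiltration ι hR).dyadicSum n
          (fun i => Complex.exp (w * point R n i) * point R n i))) w := by
  have h1 : HasDerivAt (fun w => ι (expGroup T w x)) (ι (T (expGroup T w x))) w := by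
    have := (hasDerivAt_expGroup T w).clm_apply (hasDerivAt_const w x)
    simp only [map_zero, add_zero] at this
    exact ι.toContinuousLinearMap.hasFDerivAt.comp_hasDerivAt w this
  exact ((leftFiltration ι hR).hasDerivAt_dyadicSum_exp n (fun i => -point R n i) w).clm_comp
    (h1.clm_comp ((rightFiltration ι hR).hasDerivAt_dyadicSum_exp n (fun i => point R n i) w))

variable (ι) in
lemma deriv_bandTransport_zero (n : ℕ) (x : E) : deriv (bandTransport ι hR n x) 0 =
    ι (T x) - ((leftFiltration ι hR).approx n ∘L ι x - ι x ∘L (rightFiltration ι hR).approx n) := by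
  have h : (leftFiltration ι hR).dyadicSum n (fun i => -point R n i) =
      -(leftFiltration ι hR).approx n := by
    simp [approx, dyadicSum, neg_smul, sum_neg_distrib]
  rw [(hasDerivAt_bandTransport ι hR n x 0).deriv]
  simp only [zero_mul, Complex.exp_zero, one_mul, dyadicSum_one, expGroup_zero,
    one_apply_eq_self, h]
  simp only [one_def, id_comp, comp_id, neg_comp, approx]
  abel

lemma abs_point_le {n i : ℕ} (hi : i < 2 * R * 2 ^ n) : |point R n i| ≤ R := by
  have h : (i : ℝ) / 2 ^ n ≤ 2 * R := by
    rw [div_le_iff₀ (by positivity)]; exact_mod_cast hi.le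
  have h' : 0 ≤ (i : ℝ) / 2 ^ n := by positivity
  rw [point, abs_le]
  constructor <;> linarith

variable (ι) in
lemma exists_norm_bandTransport_le_exp (n : ℕ) (x : E) :
    ∃ A B : ℝ, ∀ w, ‖bandTransport ι hR n x w‖ ≤ A * Real.exp (B * ‖w‖) := by
  obtain ⟨C, hC0, hC⟩ := exists_norm_expGroup_le T
  have h : ∀ (c : ℂ) (w : ℂ) (i : ℕ), i < 2 * R * 2 ^ n → ‖c‖ = 1 →
      ‖Complex.exp (w * (c * point R n i))‖ ≤ Real.exp (R * ‖w‖) := fun c w i hi hc => by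
    refine (Complex.norm_exp_le_exp_norm _).trans (Real.exp_le_exp.2 ?_)
    rw [norm_mul, norm_mul, hc, one_mul, Complex.norm_real, mul_comm]
    exact mul_le_mul_of_nonneg_right (abs_point_le hi) (norm_nonneg _)
  refine ⟨C * ‖x‖, R + ‖T‖ + R, fun w => ?_⟩
  refine (opNorm_comp_le _ _).trans ((mul_le_mul_of_nonneg_left (opNorm_comp_le _ _)
    (norm_nonneg _)).trans ?_)
  have h1 := (leftFiltration ι hR).norm_dyadicSum_le (Real.exp_pos (R * ‖w‖)).le
    fun i hi => by simpa only [neg_one_mul] using h (-1) w i hi (by simp)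
  have h2 := (rightFiltration ι hR).norm_dyadicSum_le (Real.exp_pos (R * ‖w‖)).le
    fun i hi => by simpa using h 1 w i hi (by simp)
  have h3 : ‖ι (expGroup T w x)‖ ≤ C * Real.exp (‖T‖ * ‖w‖) * ‖x‖ := by
    rw [ι.norm_map]
    exact (le_opNorm _ _).trans (mul_le_mul_of_nonneg_right (hC w) (norm_nonneg _))
  calc _ ≤ Real.exp (R * ‖w‖) * (C * Real.exp (‖T‖ * ‖w‖) * ‖x‖ * Real.exp (R * ‖w‖)) := by
        gcongr
    _ = _ := by rw [add_mul, add_mul, Real.exp_add, Real.exp_add]; ring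

variable (ι) in
lemma norm_bandTransport_mul_I_le (hT : IsHermitianGenerator T) (n : ℕ) (x : E) (u : ℝ) :
    ‖bandTransport ι hR n x (u * Complex.I)‖ ≤ ‖x‖ := by
  have h : ∀ r : ℝ, ‖Complex.exp (u * Complex.I * r)‖ ≤ 1 := fun r => by
    rw [mul_right_comm, ← Complex.ofReal_mul, Complex.norm_exp_ofReal_mul_I]
  refine (opNorm_comp_le _ _).trans ((mul_le_mul_of_nonneg_left (opNorm_comp_le _ _)
    (norm_nonneg _)).trans ?_)
  have h1 := (leftFiltration ι hR).norm_dyadicSum_le (n := n) zero_le_one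
    fun i _ => by simpa only [Complex.ofReal_neg] using h (-point R n i)
  have h2 := (rightFiltration ι hR).norm_dyadicSum_le (n := n) zero_le_one
    fun i _ => h (point R n i)
  have h3 : ‖ι (expGroup T (u * Complex.I) x)‖ ≤ 1 * ‖x‖ := by
    rw [ι.norm_map]
    exact (le_opNorm _ _).trans (mul_le_mul_of_nonneg_right (hT u) (norm_nonneg _))
  calc _ ≤ 1 * (1 * ‖x‖ * 1) := by gcongr
    _ = _ := by ring

include htp hTtp in
lemma exists_norm_bandTransport_le_of_mem_band (n : ℕ) {k : ℤ} {x : E}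
    (hl : x ∈ lowerGrowth T (k * (1 / 2) ^ n)) (hu : x ∈ upperGrowth T ((k + 2) * (1 / 2) ^ n)) :
    ∃ C : ℝ, ∀ s : ℝ, ‖bandTransport ι hR n x s‖ ≤ C * Real.exp (2 * (1 / 2) ^ n * |s|) := by
  obtain ⟨C₁, hC₁⟩ := mem_lowerGrowth.1 hl
  obtain ⟨C₂, hC₂⟩ := mem_upperGrowth.1 hu
  have hC₂0 : 0 ≤ C₂ := by simpa using (norm_nonneg _).trans (hC₂ 0 le_rfl)
  have hC₁0 : 0 ≤ C₁ := by simpa using (norm_nonneg _).trans (hC₁ 0 le_rfl)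
  set C := max C₁ C₂ with hC
  refine ⟨∑ i ∈ range (2 * R * 2 ^ n), ∑ j ∈ range (2 * R * 2 ^ n),
    ‖(leftFiltration ι hR).gap n i‖ * (C * ‖(rightFiltration ι hR).gap n j‖), fun s => ?_⟩
  rw [bandTransport, dyadicSum_comp_comp_dyadicSum, sum_mul]
  refine (norm_sum_le _ _).trans (sum_le_sum fun i _ => ?_)
  rw [sum_mul]
  refine (norm_sum_le _ _).trans (sum_le_sum fun j _ => ?_)
  have hcomm : Commute (expGroup T s) T := (Commute.expGroup_right (Commute.refl T) s).symm
  have hstep : ∀ m : ℕ, point R n m = -R + m * (1 / 2) ^ n := fun m => by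
    rw [point, one_div_pow, mul_one_div]
  have hε : (0 : ℝ) < (1 / 2) ^ n := by positivity
  rcases lt_or_ge (i : ℤ) (j + k) with h | h
  · rw [gap_comp_gap_eq_zero_of_lt htp hTtp hR (map_mem_lowerGrowth hcomm hl), smul_zero, norm_zero]
    · positivity
    · have h' : ((i + 1 : ℕ) : ℝ) ≤ j + k := by exact_mod_cast Int.add_one_le_iff.2 h
      rw [hstep, hstep, add_assoc, ← add_mul]
      gcongr
  rcases lt_or_ge ((j : ℤ) + k + 2) i with h' | h'
  · rw [gap_comp_gap_eq_zero_of_gt hR (map_mem_upperGrowth hcomm hu), smul_zero, norm_zero]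
    · positivity
    · have h' : ((j + 1 : ℕ) : ℝ) + (k + 2) ≤ i := by
        exact_mod_cast (by lia : ((j + 1 : ℕ) : ℤ) + (k + 2) ≤ i)
      rw [hstep, hstep, add_assoc, ← add_mul]
      gcongr
  have h₁ : (k : ℝ) ≤ i - j := by exact_mod_cast (by lia : k ≤ i - j)
  have h₂ : (i - j : ℝ) ≤ k + 2 := by exact_mod_cast (by lia : (i - j : ℤ) ≤ k + 2)
  have hexp : ‖Complex.exp (s * -point R n i) * Complex.exp (s * point R n j)‖ =
      Real.exp (-(s * ((i - j) * (1 / 2) ^ n))) := by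
    rw [← Complex.exp_add, Complex.norm_exp]
    congr 1
    have : (s * -point R n i + s * point R n j : ℂ) =
      ((-(s * ((i - j) * (1 / 2) ^ n)) : ℝ) : ℂ) := by
      rw [hstep, hstep]; push_cast; ring
    rw [this, Complex.ofReal_re]
  have key : Real.exp (-(s * ((i - j) * (1 / 2) ^ n))) * ‖ι (expGroup T s x)‖ ≤
      C * Real.exp (2 * (1 / 2) ^ n * |s|) := by
    rw [ι.norm_map]
    rcases le_total 0 s with hs | hs
    · calc _ ≤ Real.exp (-(s * (k * (1 / 2) ^ n))) *
            (C₂ * Real.exp (s * ((k + 2) * (1 / 2) ^ n))) := by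
            gcongr
            exact hC₂ s hs
        _ = C₂ * Real.exp (2 * (1 / 2) ^ n * |s|) := by
            rw [abs_of_nonneg hs, mul_left_comm, ← Real.exp_add]; ring_nf
        _ ≤ _ := by gcongr; exact le_max_right _ _
    · have hs' : 0 ≤ -s := neg_nonneg.2 hs
      have h3 := hC₁ (-s) hs'
      rw [Complex.ofReal_neg, neg_neg] at h3
      calc _ ≤ Real.exp (-s * ((k + 2) * (1 / 2) ^ n)) *
            (C₁ * Real.exp (-(-s * (k * (1 / 2) ^ n)))) := by
            rw [← neg_mul]
            gcongr
        _ = C₁ * Real.exp (2 * (1 / 2) ^ n * |s|) := by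
            rw [abs_of_nonpos hs, mul_left_comm, ← Real.exp_add]; ring_nf
        _ ≤ _ := by gcongr; exact le_max_left _ _
  rw [norm_smul, hexp]
  calc _ ≤ Real.exp (-(s * ((i - j) * (1 / 2) ^ n))) * (‖(leftFiltration ι hR).gap n i‖ *
        (‖ι (expGroup T s x)‖ * ‖(rightFiltration ι hR).gap n j‖)) := by
        gcongr
        exact (opNorm_comp_le _ _).trans
          (mul_le_mul_of_nonneg_left (opNorm_comp_le _ _) (norm_nonneg _))
    _ = Real.exp (-(s * ((i - j) * (1 / 2) ^ n))) * ‖ι (expGroup T s x)‖ *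
        (‖(leftFiltration ι hR).gap n i‖ * ‖(rightFiltration ι hR).gap n j‖) := by ring
    _ ≤ C * Real.exp (2 * (1 / 2) ^ n * |s|) *
        (‖(leftFiltration ι hR).gap n i‖ * ‖(rightFiltration ι hR).gap n j‖) := by gcongr
    _ = _ := by ring

include htp hTtp in
lemma exists_norm_bandTransport_le (hT : IsHermitianGenerator T) (n : ℕ) (x : E) :
    ∃ C : ℝ, ∀ s : ℝ, ‖bandTransport ι hR n x s‖ ≤ C * Real.exp (2 * (1 / 2) ^ n * |s|) := by
  have hx : x ∈ ⨆ k : ℤ, lowerGrowth T (k * (1 / 2) ^ n) ⊓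
      upperGrowth T ((k + 2) * (1 / 2) ^ n) := by
    rw [hT.iSup_band_eq_top (by positivity)]; trivial
  induction hx using Submodule.iSup_induction' with
  | mem k x hx => exact exists_norm_bandTransport_le_of_mem_band htp hTtp hR n hx.1 hx.2
  | zero => exact ⟨0, fun s => by simp [bandTransport]⟩
  | add x y _ _ hx hy =>
    obtain ⟨C₁, h₁⟩ := hx
    obtain ⟨C₂, h₂⟩ := hy
    refine ⟨C₁ + C₂, fun s => ?_⟩
    have : bandTransport ι hR n (x + y) s =
        bandTransport ι hR n x s + bandTransport ι hR n y s := by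
      simp only [bandTransport, map_add, add_comp, comp_add]
    rw [this, add_mul]
    exact norm_add_le_of_le (h₁ s) (h₂ s)

include htp hTtp in
lemma norm_map_sub_commutator_approx_le (hT : IsHermitianGenerator T) (n : ℕ) (x : E) :
    ‖ι (T x) - ((leftFiltration ι hR).approx n ∘L ι x - ι x ∘L (rightFiltration ι hR).approx n)‖ ≤
      2 * (1 / 2) ^ n * Real.exp 1 * ‖x‖ := by
  obtain ⟨A, B, hAB⟩ := exists_norm_bandTransport_le_exp ι hR n x
  obtain ⟨C, hC⟩ := exists_norm_bandTransport_le htp hTtp hR hT n x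
  rw [← deriv_bandTransport_zero]
  exact norm_deriv_zero_le_of_exponential_type
    (fun w => (hasDerivAt_bandTransport ι hR n x w).differentiableAt) (by positivity) hAB
    (norm_bandTransport_mul_I_le ι hR hT n x) hC

include htp hTtp in
/-- A Hermitian operator on a ternary ring of operators whose real exponentials are compatible
with the triple product is implemented by a pair of self-adjoint operators in the double
commutants of the products `x y*` and `x* y`. -/
theorem exists_selfAdjoint_implementing (hT : IsHermitianGenerator T) :
    ∃ (h : H →L[ℂ] H) (h' : K →L[ℂ] K), adjoint h = h ∧ adjoint h' = h' ∧
      h ∈ Set.centralizer (Set.centralizer {a | ∃ x y : E, a = ι x ∘L adjoint (ι y)}) ∧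
      h' ∈ Set.centralizer (Set.centralizer {b | ∃ x y : E, b = adjoint (ι x) ∘L ι y}) ∧
      ∀ x, ι (T x) = h ∘L ι x - ι x ∘L h' := by
  obtain ⟨R, hR⟩ := exists_nat_gt (2 * ‖T‖)
  obtain ⟨h, hlim, hadj, hcomm⟩ := (leftFiltration ι hR).exists_tendsto_approx
  obtain ⟨h', hlim', hadj', hcomm'⟩ := (rightFiltration ι hR).exists_tendsto_approx
  refine ⟨h, h', hadj, hadj', fun t ht => hcomm t fun r => ?_, fun t ht => hcomm' t fun r => ?_,
    fun x => ?_⟩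
  · have h1 : ∀ x y : E, t ∘L (ι x ∘L adjoint (ι y)) = (ι x ∘L adjoint (ι y)) ∘L t :=
      fun x y => (ht _ ⟨x, y, rfl⟩).symm
    have h2 : ∀ x y : E, adjoint t ∘L (ι x ∘L adjoint (ι y)) =
        (ι x ∘L adjoint (ι y)) ∘L adjoint t := fun x y => by
      simpa only [adjoint_comp, adjoint_adjoint] using (congrArg adjoint (h1 y x)).symm
    exact commute_proj (fun ξ hξ => map_leftFiltration_of_commute hR h1 hξ)
      fun ξ hξ => map_leftFiltration_of_commute hR h2 hξ
  · have h1 : ∀ x y : E, t ∘L (adjoint (ι x) ∘L ι y) = (adjoint (ι x) ∘L ι y) ∘L t :=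
      fun x y => (ht _ ⟨x, y, rfl⟩).symm
    have h2 : ∀ x y : E, adjoint t ∘L (adjoint (ι x) ∘L ι y) =
        (adjoint (ι x) ∘L ι y) ∘L adjoint t := fun x y => by
      simpa only [adjoint_comp, adjoint_adjoint] using (congrArg adjoint (h1 y x)).symm
    exact commute_proj (fun ξ hξ => map_rightFiltration_of_commute hR h1 hξ)
      fun ξ hξ => map_rightFiltration_of_commute hR h2 hξ
  · have hL : Tendsto (fun n => (leftFiltration ι hR).approx n ∘L ι x -
        ι x ∘L (rightFiltration ι hR).approx n) atTop (𝓝 (h ∘L ι x - ι x ∘L h')) :=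
      ((((compL ℂ K H H).flip (ι x)).continuous.tendsto h).comp hlim).sub
        (((compL ℂ K K H (ι x)).continuous.tendsto h').comp hlim')
    have h0 : Tendsto (fun n : ℕ => 2 * (1 / 2 : ℝ) ^ n * Real.exp 1 * ‖x‖) atTop (𝓝 0) := by
      simpa using (((tendsto_pow_atTop_nhds_zero_of_lt_one (r := (1 / 2 : ℝ)) (by norm_num)
        (by norm_num)).const_mul 2).mul_const (Real.exp 1)).mul_const ‖x‖
    have hz := squeeze_zero_norm (norm_map_sub_commutator_approx_le htp hTtp hR hT · x) h0
    exact sub_eq_zero.1 (tendsto_nhds_unique (hL.const_sub (ι (T x))) hz)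

end Approximation

/-- Every derivation of a ternary ring of operators is spatial, for a ring of operators given as
the range of a linear isometry. -/
theorem exists_skewAdjoint_implementing_derivation {H K : Type*}
    [NormedAddCommGroup H] [InnerProductSpace ℂ H] [CompleteSpace H]
    [NormedAddCommGroup K] [InnerProductSpace ℂ K] [CompleteSpace K]
    {E : Type*} [NormedAddCommGroup E] [NormedSpace ℂ E] [CompleteSpace E]
    {ι : E →ₗᵢ[ℂ] (K →L[ℂ] H)} {tp : E → E → E → E}
    (htp : ∀ x y z, ι (tp x y z) = ι x ∘L adjoint (ι y) ∘L ι z) {δ : E →L[ℂ] E}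
    (hδ : ∀ x y z, δ (tp x y z) = tp (δ x) y z + tp x (δ y) z + tp x y (δ z)) :
    ∃ (α : H →L[ℂ] H) (β : K →L[ℂ] K), adjoint α = -α ∧ adjoint β = -β ∧
      α ∈ Set.centralizer (Set.centralizer {a | ∃ x y : E, a = ι x ∘L adjoint (ι y)}) ∧
      β ∈ Set.centralizer (Set.centralizer {b | ∃ x y : E, b = adjoint (ι x) ∘L ι y}) ∧
      ∀ x, ι (δ x) = α ∘L ι x + ι x ∘L β := by
  obtain ⟨h, h', hadj, hadj', hmem, hmem', hx⟩ := exists_selfAdjoint_implementing htp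
    (expGroup_tripleProduct_of_rotated htp hδ) (isHermitianGenerator_of_derivation htp hδ)
  refine ⟨Complex.I • h, -Complex.I • h', ?_, ?_, fun t ht => ?_, fun t ht => ?_, fun x => ?_⟩
  · rw [map_smulₛₗ, hadj, Complex.conj_I, neg_smul]
  · rw [map_smulₛₗ, hadj', map_neg, Complex.conj_I, neg_smul]
  · rw [mul_smul_comm, smul_mul_assoc, hmem t ht]
  · rw [mul_smul_comm, smul_mul_assoc, hmem' t ht]
  · have h1 := congrArg (Complex.I • ·) (hx x)
    simp only [smul_apply, map_smul, smul_smul, mul_neg, Complex.I_mul_I, neg_neg, one_smul] at h1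
    rw [h1, smul_sub, smul_comp, comp_smul, neg_smul, sub_eq_add_neg]

/-- Every TRO-derivation of a TRO `X ⊆ B(K,H)` is spatial:  there exist skew-adjoint
`α ∈ {xy* : x,y ∈ X}''` and `β ∈ {x*y : x,y ∈ X}''` with `D x = α x + x β` on `X`. -/
theorem stmt_7 {H K : Type*}
    [NormedAddCommGroup H] [InnerProductSpace ℂ H] [CompleteSpace H]
    [NormedAddCommGroup K] [InnerProductSpace ℂ K] [CompleteSpace K]
    (X : Submodule ℂ (K →L[ℂ] H)) (hXclosed : IsClosed (X : Set (K →L[ℂ] H)))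
    (hXtro : ∀ x ∈ X, ∀ y ∈ X, ∀ z ∈ X, x ∘L (adjoint y) ∘L z ∈ X)
    (D : X →L[ℂ] X)
    (hder : ∀ x y z w : X,
      (w : K →L[ℂ] H) = (x : K →L[ℂ] H) ∘L (adjoint (y : K →L[ℂ] H)) ∘L (z : K →L[ℂ] H) →
      (D w : K →L[ℂ] H) =
        (D x : K →L[ℂ] H) ∘L (adjoint (y : K →L[ℂ] H)) ∘L (z : K →L[ℂ] H)
          + (x : K →L[ℂ] H) ∘L (adjoint (D y : K →L[ℂ] H)) ∘L (z : K →L[ℂ] H)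
          + (x : K →L[ℂ] H) ∘L (adjoint (y : K →L[ℂ] H)) ∘L (D z : K →L[ℂ] H)) :
    ∃ (α : H →L[ℂ] H) (β : K →L[ℂ] K),
      adjoint α = -α ∧ adjoint β = -β ∧
      α ∈ Set.centralizer (Set.centralizer
        {a : H →L[ℂ] H | ∃ x ∈ X, ∃ y ∈ X, a = x ∘L adjoint y}) ∧
      β ∈ Set.centralizer (Set.centralizer
        {b : K →L[ℂ] K | ∃ x ∈ X, ∃ y ∈ X, b = adjoint x ∘L y}) ∧
      ∀ x : X, (D x : K →L[ℂ] H) = α ∘L (x : K →L[ℂ] H) + (x : K →L[ℂ] H) ∘L β := by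
  have := hXclosed.completeSpace_coe
  let tp : X → X → X → X := fun x y z =>
    ⟨x ∘L adjoint (y : K →L[ℂ] H) ∘L z, hXtro x x.2 y y.2 z z.2⟩
  obtain ⟨α, β, hα, hβ, hαmem, hβmem, hD⟩ := exists_skewAdjoint_implementing_derivation
    (ι := X.subtypeₗᵢ) (tp := tp) (fun _ _ _ => rfl) (δ := D)
    fun x y z => Subtype.ext (hder x y z (tp x y z) rfl)
  refine ⟨α, β, hα, hβ, ?_, ?_, hD⟩
  · convert hαmem using 4
    ext a
    exact ⟨fun ⟨x, hx, y, hy, h⟩ => ⟨⟨x, hx⟩, ⟨y, hy⟩, h⟩, fun ⟨x, y, h⟩ => ⟨x, x.2, y, y.2, h⟩⟩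
  · convert hβmem using 4
    ext b
    exact ⟨fun ⟨x, hx, y, hy, h⟩ => ⟨⟨x, hx⟩, ⟨y, hy⟩, h⟩, fun ⟨x, y, h⟩ => ⟨x, x.2, y, y.2, h⟩⟩
end

section
/- Every TRO-derivation of a von Neumann algebra is an inner TRO-derivation: if M is a von Neumann algebra on a complex Hilbert space H and D : M → M is a bounded linear map satisfying D(x y* z) = D(x) y* z + x D(y)* z + x y* D(z) for all x, y, z ∈ M, then there exist α, β ∈ M with α* = −α and β* = −β such that D(x) = α x + x β for all x ∈ M. -/
section KadisonSakai

open Filter Topology Asymptotics Complex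

section ExpWrappers

variable {E F : Type*} [NormedRing E] [NormedAlgebra ℂ E] [CompleteSpace E]
  [NormedRing F] [NormedAlgebra ℂ F]

theorem NormedSpace.exp_add_smul_complex (z w : ℂ) (a : E) :
    NormedSpace.exp ((z + w) • a) = NormedSpace.exp (z • a) * NormedSpace.exp (w • a) := by
  let _ := NormedAlgebra.restrictScalars ℚ ℂ E
  rw [add_smul]
  exact NormedSpace.exp_add_of_commute (((Commute.refl a).smul_left z).smul_right w)

theorem NormedSpace.exp_add_of_commute_complex {a b : E} (h : Commute a b) :
    NormedSpace.exp (a + b) = NormedSpace.exp a * NormedSpace.exp b := by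
  let _ := NormedAlgebra.restrictScalars ℚ ℂ E
  exact NormedSpace.exp_add_of_commute h

theorem NormedSpace.map_exp_complex (f : E →ₐ[ℂ] F) (hf : Continuous f) (a : E) :
    f (NormedSpace.exp a) = NormedSpace.exp (f a) := by
  let _ := NormedAlgebra.restrictScalars ℚ ℂ E
  let _ := NormedAlgebra.restrictScalars ℚ ℂ F
  exact NormedSpace.map_exp f hf a

theorem NormedSpace.norm_exp_le_complex [NormOneClass E] (a : E) :
    ‖NormedSpace.exp a‖ ≤ Real.exp ‖a‖ := by
  have h := NormedSpace.exp_series_hasSum_exp' (𝕂 := ℂ) a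
  refine h.norm_le_of_bounded (g := fun n => ‖a‖ ^ n / n.factorial) ?_ fun n => ?_
  · rw [Real.exp_eq_exp_ℝ]
    exact NormedSpace.expSeries_div_hasSum_exp _
  · rw [norm_smul, norm_inv, Complex.norm_natCast, inv_mul_eq_div]
    gcongr
    exact norm_pow_le a n

theorem NormedSpace.differentiable_exp_smul (a : E) :
    Differentiable ℂ fun z : ℂ => NormedSpace.exp (z • a) :=
  fun z => (hasDerivAt_exp_smul_const a z).differentiableAt

end ExpWrappers

/-- Bounded operators on a complex normed space. -/
abbrev BoundedEndo (E : Type*) [NormedAddCommGroup E] [NormedSpace ℂ E] := E →L[ℂ] E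

theorem exp_smul_exp_smul_apply {E : Type*} [NormedAddCommGroup E] [NormedSpace ℂ E]
    [CompleteSpace E] (A : BoundedEndo E) (z w : ℂ) (x : E) :
    NormedSpace.exp (z • A) (NormedSpace.exp (w • A) x) = NormedSpace.exp ((z + w) • A) x :=
  congrArg (fun S : BoundedEndo E => S x) (NormedSpace.exp_add_smul_complex z w A).symm

section Derivation

variable {M : Type*} [CStarAlgebra M]

/-- Exponentials of bounded derivations are multiplicative. -/
theorem exp_derivation_mul (δ : BoundedEndo M) (hδ : ∀ x y, δ (x * y) = δ x * y + x * δ y)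
    (z : ℂ) (x y : M) :
    NormedSpace.exp (z • δ) (x * y) = NormedSpace.exp (z • δ) x * NormedSpace.exp (z • δ) y := by
  have hd : ∀ (w : ℂ) (v : M), HasDerivAt (fun t : ℂ => NormedSpace.exp (t • δ) v)
      (δ (NormedSpace.exp (w • δ) v)) w := fun w v =>
    ((hasDerivAt_exp_smul_const' (𝕂 := ℂ) δ w).clm_apply (hasDerivAt_const w v)).congr_deriv
      (by simp)
  have hn : ∀ w : ℂ, HasDerivAt (fun t : ℂ => NormedSpace.exp ((-t) • δ))
      (-(NormedSpace.exp ((-w) • δ) * δ)) w := fun w => by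
    have := (hasDerivAt_exp_smul_const (𝕂 := ℂ) δ (-w)).scomp w (hasDerivAt_neg w)
    simpa only [Function.comp_def, neg_one_smul] using this
  set f : ℂ → M := fun t =>
    NormedSpace.exp ((-t) • δ) (NormedSpace.exp (t • δ) x * NormedSpace.exp (t • δ) y) with hf
  have hder : ∀ w, HasDerivAt f 0 w := fun w => by
    refine ((hn w).clm_apply ((hd w x).mul (hd w y))).congr_deriv ?_
    simp [hδ]
  have hc : f z = f 0 := is_const_of_deriv_eq_zero (fun w => (hder w).differentiableAt)
    (fun w => (hder w).deriv) z 0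
  have h0 : f 0 = x * y := by simp [hf]
  have hz : NormedSpace.exp (z • δ) (f z) = NormedSpace.exp (z • δ) x * NormedSpace.exp (z • δ) y := by
    rw [hf, exp_smul_exp_smul_apply]
    simp
  rw [← hz, hc, h0]

theorem exp_star_apply (A : BoundedEndo M) (hs : ∀ x, A (star x) = -star (A x)) (z : ℂ) (x : M) :
    star (NormedSpace.exp (z • A) x) = NormedSpace.exp ((-star z) • A) (star x) := by
  have hpow : ∀ (n : ℕ) (x : M), star ((A ^ n) x) = (-1 : ℂ) ^ n • (A ^ n) (star x) := by
    intro n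
    induction n with
    | zero => simp
    | succ n ih =>
      intro x
      rw [pow_succ', mul_apply_eq_comp, ← neg_eq_iff_eq_neg.mpr (hs _), ih]
      simp [pow_succ]
  have happ : ∀ (w : ℂ) (v : M), HasSum (fun n : ℕ => ((n.factorial : ℂ)⁻¹ * w ^ n) • (A ^ n) v)
      (NormedSpace.exp (w • A) v) := fun w v => by
    have := (NormedSpace.exp_series_hasSum_exp' (𝕂 := ℂ) (w • A)).mapL
      (ContinuousLinearMap.apply ℂ M v)
    simp only [smul_pow, smul_smul] at this
    exact this
  refine ((happ z x).star).unique ?_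
  convert happ (-star z) (star x) using 2 with n
  rw [star_smul, hpow, smul_smul, neg_pow (star z)]
  congr 1
  simp
  ring

theorem exp_derivation_one (δ : BoundedEndo M) (hδ : ∀ x y, δ (x * y) = δ x * y + x * δ y)
    (z : ℂ) : NormedSpace.exp (z • δ) (1 : M) = 1 := by
  have h := exp_derivation_mul δ hδ z (NormedSpace.exp ((-z) • δ) 1) 1
  have hinv : NormedSpace.exp (z • δ) (NormedSpace.exp ((-z) • δ) (1 : M)) = 1 := by
    rw [exp_smul_exp_smul_apply]
    simp
  rwa [mul_one, hinv, one_mul, eq_comm] at h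

theorem norm_exp_I_smul_derivation_le (A : BoundedEndo M)
    (hA : ∀ x y, A (x * y) = A x * y + x * A y)
    (hs : ∀ x, A (star x) = -star (A x)) (t : ℝ) :
    ‖NormedSpace.exp (((t : ℂ) * I) • A)‖ ≤ 1 := by
  let φ : M →⋆ₙₐ[ℂ] M :=
    { toFun := fun x => NormedSpace.exp (((t : ℂ) * I) • A : BoundedEndo M) x
      map_smul' := fun c x => by simp
      map_zero' := by simp
      map_add' := fun x y => by simp
      map_mul' := fun x y => exp_derivation_mul A hA _ x y
      map_star' := fun x => by
        rw [exp_star_apply A hs]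
        congr 3
        simp }
  exact ContinuousLinearMap.opNorm_le_bound _ zero_le_one fun x => by
    rw [one_mul]; exact NonUnitalStarAlgHom.norm_apply_le φ x

end Derivation

/-- The vectors on which the semigroup `exp (-s A)` decays at least as fast as `exp (-μ s)`. -/
def decaySpace {E : Type*} [NormedAddCommGroup E] [NormedSpace ℂ E]
    (A : BoundedEndo E) (μ : ℝ) : Set E :=
  {x | ∃ C : ℝ, ∀ s : ℝ, 0 ≤ s →
    ‖NormedSpace.exp ((-(s : ℂ)) • A) x‖ ≤ C * Real.exp (-(μ * s))}

section DecaySpace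

theorem decaySpace_antitone {E : Type*} [NormedAddCommGroup E] [NormedSpace ℂ E]
    (A : BoundedEndo E) : Antitone (decaySpace A) := by
  rintro μ ν h x ⟨C, hC⟩
  refine ⟨max C 0, fun s hs => (hC s hs).trans ?_⟩
  gcongr
  exact le_max_left _ _

theorem eq_zero_of_mem_decaySpace {E : Type*} [NormedAddCommGroup E] [NormedSpace ℂ E]
    [CompleteSpace E] {A : BoundedEndo E} {μ : ℝ} (hμ : ‖A‖ < μ) {x : E}
    (hx : x ∈ decaySpace A μ) : x = 0 := by
  obtain ⟨C, hC⟩ := hx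
  rcases subsingleton_or_nontrivial E with hE | hE
  · exact Subsingleton.elim _ _
  have hle : ∀ s : ℝ, 0 ≤ s → ‖x‖ ≤ C * Real.exp ((‖A‖ - μ) * s) := fun s hs => by
    have hx : NormedSpace.exp ((s : ℂ) • A) (NormedSpace.exp ((-(s : ℂ)) • A) x) = x := by
      rw [exp_smul_exp_smul_apply]; simp
    calc ‖x‖ ≤ ‖NormedSpace.exp ((s : ℂ) • A)‖ * ‖NormedSpace.exp ((-(s : ℂ)) • A) x‖ := by
          conv_lhs => rw [← hx]
          exact ContinuousLinearMap.le_opNorm _ _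
      _ ≤ Real.exp (s * ‖A‖) * (C * Real.exp (-(μ * s))) := by
          gcongr
          · refine (NormedSpace.norm_exp_le_complex _).trans ?_
            rw [norm_smul, Complex.norm_real, Real.norm_of_nonneg hs]
          · exact hC s hs
      _ = C * Real.exp ((‖A‖ - μ) * s) := by
          rw [mul_left_comm, ← Real.exp_add]; ring_nf
  have hlim : Tendsto (fun s : ℝ => C * Real.exp ((‖A‖ - μ) * s)) atTop (𝓝 (C * 0)) :=
    (Real.tendsto_exp_atBot.comp
      (tendsto_id.const_mul_atTop_of_neg (sub_neg.mpr hμ))).const_mul C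
  rw [mul_zero] at hlim
  exact norm_le_zero_iff.mp (ge_of_tendsto hlim (eventually_atTop.mpr ⟨0, hle⟩))

variable {M : Type*} [CStarAlgebra M] {A : BoundedEndo M}

theorem mul_mem_decaySpace (hA : ∀ x y, A (x * y) = A x * y + x * A y) {μ ν : ℝ} {x y : M}
    (hx : x ∈ decaySpace A μ) (hy : y ∈ decaySpace A ν) : x * y ∈ decaySpace A (μ + ν) := by
  obtain ⟨C, hC⟩ := hx
  obtain ⟨C', hC'⟩ := hy
  refine ⟨C * C', fun s hs => ?_⟩
  rw [exp_derivation_mul A hA]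
  calc _ ≤ (C * Real.exp (-(μ * s))) * (C' * Real.exp (-(ν * s))) :=
        (norm_mul_le _ _).trans (mul_le_mul (hC s hs) (hC' s hs) (norm_nonneg _)
          ((norm_nonneg _).trans (hC s hs)))
    _ = C * C' * Real.exp (-((μ + ν) * s)) := by
        rw [mul_mul_mul_comm, ← Real.exp_add]; ring_nf

theorem map_mem_decaySpace {μ : ℝ} {x : M} (hx : x ∈ decaySpace A μ) :
    A x ∈ decaySpace A μ := by
  obtain ⟨C, hC⟩ := hx
  refine ⟨‖A‖ * C, fun s hs => ?_⟩
  have hcomm : Commute A (NormedSpace.exp ((-(s : ℂ)) • A)) :=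
    ((Commute.refl A).smul_right _).exp_right
  have h : NormedSpace.exp ((-(s : ℂ)) • A) (A x) = A (NormedSpace.exp ((-(s : ℂ)) • A) x) :=
    (congrArg (fun S : BoundedEndo M => S x) hcomm.eq).symm
  rw [h, mul_assoc]
  exact (A.le_opNorm _).trans (by gcongr; exact hC s hs)

theorem one_mem_decaySpace (hA : ∀ x y, A (x * y) = A x * y + x * A y) :
    (1 : M) ∈ decaySpace A 0 :=
  ⟨‖(1 : M)‖, fun s _ => by rw [exp_derivation_one A hA]; simp⟩

/-- A bounded derivation has a decreasing family of spectral projections, as soon as every subset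
of the algebra has a left support projection. -/
theorem exists_spectral_projections
    (hsupp : ∀ S : Set M, ∃ q : M, IsStarProjection q ∧ ∀ y, (∀ x ∈ S, y * x = 0) ↔ y * q = 0)
    (hA : ∀ x y, A (x * y) = A x * y + x * A y) (hs : ∀ x, A (star x) = -star (A x)) :
    ∃ q : ℝ → M, (∀ μ, IsStarProjection (q μ)) ∧ (∀ μ, A (q μ) = 0) ∧ (∀ μ ≤ 0, q μ = 1) ∧
      (∀ μ, ‖A‖ < μ → q μ = 0) ∧ (∀ μ ν, μ ≤ ν → q μ * q ν = q ν) ∧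
      ∀ μ, ∀ x ∈ decaySpace A μ, ∀ ν, q (ν + μ) * x * q ν = x * q ν := by
  choose q hq hqy using fun μ => hsupp (decaySpace A μ)
  have hqx : ∀ μ, ∀ x ∈ decaySpace A μ, (1 - q μ) * x = 0 := fun μ =>
    (hqy μ (1 - q μ)).mpr (by rw [sub_mul, one_mul, (hq μ).isIdempotentElem.eq, sub_self])
  refine ⟨q, hq, fun μ => ?_, fun μ hμ => ?_, fun μ hμ => ?_, fun μ ν h => ?_,
    fun μ x hx ν => ?_⟩
  · have h1 : A (q μ) * q μ = 0 := (hqy μ _).mp fun x hx => by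
      have h := hqx μ x hx
      have h' := hqx μ (A x) (map_mem_decaySpace hx)
      rw [sub_mul, one_mul, sub_eq_zero] at h h'
      have h2 := hA (q μ) x
      rw [← h, ← h'] at h2
      simpa using h2
    have h2 : q μ * A (q μ) = 0 := by
      have h3 := congrArg star h1
      have h4 := hs (q μ)
      rw [(hq μ).isSelfAdjoint.star_eq] at h4
      rw [star_mul, (hq μ).isSelfAdjoint.star_eq, star_zero] at h3
      rw [h4, mul_neg, h3, neg_zero]
    have h3 := hA (q μ) (q μ)
    rwa [(hq μ).isIdempotentElem.eq, h1, h2, add_zero] at h3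
  · have h := hqx μ 1 (decaySpace_antitone A hμ (one_mem_decaySpace hA))
    rw [mul_one, sub_eq_zero] at h
    exact h.symm
  · have h := (hqy μ 1).mp fun x hx => by rw [eq_zero_of_mem_decaySpace hμ hx, mul_zero]
    rwa [one_mul] at h
  · have h' := (hqy ν (1 - q μ)).mp fun x hx => hqx μ x (decaySpace_antitone A h hx)
    rw [sub_mul, one_mul, sub_eq_zero] at h'
    exact h'.symm
  · have h := (hqy ν ((1 - q (ν + μ)) * x)).mp fun y hy => by
      rw [mul_assoc]
      exact hqx _ _ (add_comm μ ν ▸ mul_mem_decaySpace hA hx hy)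
    rw [sub_mul, one_mul, sub_mul, sub_eq_zero] at h
    exact h.symm

end DecaySpace

section Discretization

variable {M : Type*} [CStarAlgebra M]

/-- The inner derivation `x ↦ h x - x h`. -/
noncomputable def innerDerivation (h : M) : BoundedEndo M :=
  ContinuousLinearMap.mul ℂ M h - (ContinuousLinearMap.mul ℂ M).flip h

@[simp]
theorem innerDerivation_apply (h x : M) : innerDerivation h x = h * x - x * h := rfl

theorem mul_aeval_innerDerivation_mul {h u v : M} {a b : ℂ} (hu : u * h = a • u)
    (hv : h * v = b • v) (P : Polynomial ℂ) (x : M) :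
    u * (Polynomial.aeval (innerDerivation h) P) x * v = P.eval (a - b) • (u * x * v) := by
  have hstep : ∀ x, u * innerDerivation h x * v = (a - b) • (u * x * v) := fun x => by
    rw [innerDerivation_apply, mul_sub, sub_mul, ← mul_assoc, hu, mul_assoc u (x * h) v,
      mul_assoc x, hv, sub_smul]
    simp [mul_assoc]
  have hpow : ∀ (n : ℕ) x, u * (innerDerivation h ^ n) x * v = (a - b) ^ n • (u * x * v) := by
    intro n
    induction n with
    | zero => simp
    | succ n ih =>
      intro x
      rw [pow_succ', mul_apply_eq_comp, hstep, ih, smul_smul, pow_succ']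
  induction P using Polynomial.induction_on' with
  | add p q hp hq =>
    rw [map_add, add_apply, mul_add, add_mul, hp, hq, Polynomial.eval_add,
      add_smul]
  | monomial n c =>
    rw [Polynomial.aeval_monomial, ← Algebra.smul_def, smul_apply,
      mul_smul_comm, smul_mul_assoc, hpow, smul_smul, Polynomial.eval_monomial]

variable {q : ℝ → M}

/-- The Riemann sum with mesh `1 / n` of a decreasing family of projections. -/
noncomputable def projectionSum (q : ℝ → M) (n K : ℕ) : M :=
  (n : ℂ)⁻¹ • ∑ i ∈ Finset.range K, q ((i + 1 : ℕ) / (n : ℝ))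

theorem isSelfAdjoint_projectionSum (hq : ∀ μ, IsStarProjection (q μ)) (n K : ℕ) :
    IsSelfAdjoint (projectionSum q n K) := by
  refine IsSelfAdjoint.smul (by simp [isSelfAdjoint_iff]) ?_
  exact isSelfAdjoint_sum _ fun i _ => (hq _).isSelfAdjoint

theorem projection_mul_projection (hq : ∀ μ, IsStarProjection (q μ))
    (hmono : ∀ μ ν, μ ≤ ν → q μ * q ν = q ν) (μ ν : ℝ) : q μ * q ν = q (max μ ν) := by
  rcases le_total μ ν with h | h
  · rw [hmono μ ν h, max_eq_right h]
  · have := congrArg star (hmono ν μ h)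
    rw [star_mul, (hq _).isSelfAdjoint.star_eq, (hq _).isSelfAdjoint.star_eq] at this
    rw [this, max_eq_left h]

theorem aeval_innerDerivation_projectionSum_eq_zero (hq : ∀ μ, IsStarProjection (q μ))
    (hmono : ∀ μ ν, μ ≤ ν → q μ * q ν = q ν) {n K : ℕ} (hn : 0 < n) (h0 : q 0 = 1)
    (hK : q (K / n) = 0) (j : ℤ) {x : M}
    (hx : ∀ ν, q (ν + j / n) * x * q ν = x * q ν) :
    Polynomial.aeval (innerDerivation (projectionSum q n K))
      (∏ m ∈ Finset.Icc j K, (Polynomial.X - Polynomial.C ((m : ℂ) / n))) x = 0 := by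
  set h := projectionSum q n K with hh
  set P : Polynomial ℂ := ∏ m ∈ Finset.Icc j K, (Polynomial.X - Polynomial.C ((m : ℂ) / n)) with hP
  set p : ℕ → M := fun k => q (k / n) - q ((k + 1 : ℕ) / n) with hp
  have hn' : (0 : ℝ) < n := Nat.cast_pos.mpr hn
  have hsum : ∑ k ∈ Finset.range K, p k = 1 := by
    rw [Finset.sum_range_sub' (fun k : ℕ => q (k / n)), hK]
    simp [h0]
  have hle : ∀ (i k : ℤ), i ≤ k → (i : ℝ) / n ≤ k / n := fun i k hik => by
    gcongr
  have hqq := projection_mul_projection hq hmono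
  have hpq : ∀ (k : ℕ) (i : ℤ), p k * q (i / n) = if i ≤ k then p k else 0 := fun k i => by
    simp only [hp, sub_mul, hqq]
    split_ifs with hik
    · rw [max_eq_left, max_eq_left]
      · simpa using hle i (k + 1) (by lia)
      · simpa using hle i k hik
    · rw [max_eq_right, max_eq_right, sub_self]
      · simpa using hle (k + 1) i (by lia)
      · simpa using hle k i (by lia)
  have hqp : ∀ (k : ℕ) (i : ℤ), q (i / n) * p k = if i ≤ k then p k else 0 := fun k i => by
    have hps : star (p k) = p k := by
      rw [star_sub, (hq _).isSelfAdjoint.star_eq, (hq _).isSelfAdjoint.star_eq]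
    have := congrArg star (hpq k i)
    rw [star_mul, (hq _).isSelfAdjoint.star_eq, hps] at this
    rw [this]
    split_ifs <;> simp [hps]
  have hcount : ∀ k < K, ∑ i ∈ Finset.range K, (if ((i + 1 : ℕ) : ℤ) ≤ k then p k else 0)
      = (k : ℂ) • p k := fun k hk => by
    rw [← Finset.sum_filter, Finset.sum_const, Nat.cast_smul_eq_nsmul]
    congr 1
    have : (Finset.range K).filter (fun i => ((i + 1 : ℕ) : ℤ) ≤ k) = Finset.range k := by
      ext i; simp; lia
    rw [this, Finset.card_range]
  have hhp : ∀ k < K, h * p k = ((k : ℂ) / n) • p k := fun k hk => by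
    rw [hh, projectionSum, smul_mul_assoc, Finset.sum_mul, div_eq_inv_mul, mul_smul, ← hcount k hk]
    congr 1
    refine Finset.sum_congr rfl fun i _ => ?_
    rw [← hqp, Int.cast_natCast]
  have hph : ∀ k < K, p k * h = ((k : ℂ) / n) • p k := fun k hk => by
    rw [hh, projectionSum, mul_smul_comm, Finset.mul_sum, div_eq_inv_mul, mul_smul, ← hcount k hk]
    congr 1
    refine Finset.sum_congr rfl fun i _ => ?_
    rw [← hpq, Int.cast_natCast]
  have hpxp : ∀ l k : ℕ, (l : ℤ) < j + k → p l * x * p k = 0 := fun l k hlk => by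
    have h1 : q (k / n) * p k = p k := by
      have := hqp k k
      rwa [if_pos le_rfl, Int.cast_natCast] at this
    have h2 : p l * q (((k + j : ℤ) : ℝ) / n) = 0 := by rw [hpq, if_neg (by lia)]
    have h3 := hx (k / n)
    rw [← add_div] at h3
    push_cast at h2
    rw [← h1, mul_assoc, ← mul_assoc x, ← h3, ← mul_assoc, ← mul_assoc, ← mul_assoc, h2]
    simp
  have hzero : ∀ l < K, ∀ k < K, p l * Polynomial.aeval (innerDerivation h) P x * p k = 0 := by
    intro l hl k hk
    rw [mul_aeval_innerDerivation_mul (hph l hl) (hhp k hk)]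
    rcases lt_or_ge (l : ℤ) (j + k) with hlk | hlk
    · rw [hpxp l k hlk, smul_zero]
    · have : P.eval ((l : ℂ) / n - k / n) = 0 := by
        rw [hP, Polynomial.eval_prod]
        refine Finset.prod_eq_zero (i := (l : ℤ) - k) (Finset.mem_Icc.mpr ⟨by lia, by lia⟩) ?_
        simp [sub_div]
      rw [this, zero_smul]
  calc Polynomial.aeval (innerDerivation h) P x
      = (∑ l ∈ Finset.range K, p l) * Polynomial.aeval (innerDerivation h) P x *
        ∑ k ∈ Finset.range K, p k := by rw [hsum, one_mul, mul_one]
    _ = 0 := by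
      rw [Finset.sum_mul, Finset.sum_mul]
      refine Finset.sum_eq_zero fun l hl => ?_
      rw [Finset.mul_sum]
      exact Finset.sum_eq_zero fun k hk =>
        hzero l (Finset.mem_range.mp hl) k (Finset.mem_range.mp hk)

theorem norm_projectionSum_two_mul_sub_le (hq : ∀ μ, IsStarProjection (q μ))
    (hmono : ∀ μ ν, μ ≤ ν → q μ * q ν = q ν) {n : ℕ} (hn : 0 < n) (K : ℕ) :
    ‖projectionSum q (2 * n) (2 * K) - projectionSum q n K‖ ≤ 1 / (2 * n) := by
  have hn' : (0 : ℝ) < n := Nat.cast_pos.mpr hn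
  set a : ℕ → ℝ := fun i => i / (2 * n) with ha
  set e : ℕ → M := fun i => q (a (2 * i + 1)) - q (a (2 * i + 2)) with he
  have hqq := projection_mul_projection hq hmono
  have hmax : ∀ i j : ℕ, max (a i) (a j) = a (max i j) := fun i j => by
    have hmon : Monotone a := fun i j hij => by simp only [ha]; gcongr
    exact (hmon.map_max).symm
  have hee : ∀ i j, e i * e j = if i = j then e i else 0 := fun i j => by
    simp only [he, sub_mul, mul_sub, hqq, hmax]
    split_ifs with hij
    · subst hij
      simp
    · rcases lt_or_gt_of_ne hij with h | h
      · rw [max_eq_right (by lia : 2 * i + 1 ≤ 2 * j + 1),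
          max_eq_right (by lia : 2 * i + 1 ≤ 2 * j + 2),
          max_eq_right (by lia : 2 * i + 2 ≤ 2 * j + 1),
          max_eq_right (by lia : 2 * i + 2 ≤ 2 * j + 2)]
        simp
      · rw [max_eq_left (by lia : 2 * j + 1 ≤ 2 * i + 1),
          max_eq_left (by lia : 2 * j + 2 ≤ 2 * i + 1),
          max_eq_left (by lia : 2 * j + 1 ≤ 2 * i + 2),
          max_eq_left (by lia : 2 * j + 2 ≤ 2 * i + 2)]
        simp
  set s : M := ∑ i ∈ Finset.range K, e i with hs
  have hss : star s * s = s := by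
    have hstar : star s = s := by
      rw [hs, star_sum]
      refine Finset.sum_congr rfl fun i _ => ?_
      rw [star_sub, (hq _).isSelfAdjoint.star_eq, (hq _).isSelfAdjoint.star_eq]
    rw [hstar, hs, Finset.sum_mul]
    refine Finset.sum_congr rfl fun i hi => ?_
    rw [Finset.mul_sum]
    simp [hee, Finset.mem_range.mp hi]
  have hnorm : ‖s‖ ≤ 1 := by
    have := CStarRing.norm_star_mul_self (x := s)
    rw [hss] at this
    nlinarith [norm_nonneg s]
  have hdiff : projectionSum q (2 * n) (2 * K) - projectionSum q n K
      = ((2 * n : ℕ) : ℂ)⁻¹ • s := by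
    have hsplit : ∀ (f : ℕ → M) (L : ℕ), ∑ i ∈ Finset.range (2 * L), f i =
        ∑ i ∈ Finset.range L, (f (2 * i) + f (2 * i + 1)) := by
      intro f L
      induction L with
      | zero => simp
      | succ L ih => 
        rw [mul_add, mul_one, Finset.sum_range_succ, Finset.sum_range_succ, ih,
          Finset.sum_range_succ _ L, add_assoc]
    have hn2 : projectionSum q n K = ((2 * n : ℕ) : ℂ)⁻¹ •
        ∑ i ∈ Finset.range K, (2 : ℂ) • q (a (2 * i + 2)) := by
      rw [projectionSum, ← Finset.smul_sum, smul_smul]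
      congr 1
      · push_cast
        rw [mul_inv]
        ring_nf
      · refine Finset.sum_congr rfl fun i _ => ?_
        congr 1
        simp only [ha]
        push_cast
        field_simp
    rw [hn2, projectionSum, hsplit, ← smul_sub, ← Finset.sum_sub_distrib, hs]
    congr 1
    refine Finset.sum_congr rfl fun i _ => ?_
    simp only [he, ha, two_smul]
    push_cast
    rw [show (2 * (i : ℝ) + 1 + 1) = 2 * i + 2 by ring]
    abel
  rw [hdiff, norm_smul, norm_inv, Complex.norm_natCast]
  push_cast
  rw [one_div]
  exact mul_le_of_le_one_right (by positivity) hnorm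

end Discretization

section FourierKernel

open MeasureTheory Real FourierTransform

theorem integral_Ioi_mul_cexp_neg {r : ℂ} (hr : 0 < r.re) :
    IntegrableOn (fun x : ℝ => (x : ℂ) * Complex.exp (-(r * x))) (Set.Ioi 0) ∧
      ∫ x in Set.Ioi (0 : ℝ), (x : ℂ) * Complex.exp (-(r * x)) = (r ^ 2)⁻¹ := by
  have hr0 : r ≠ 0 := fun h => by simp [h] at hr
  have hnorm : ∀ x : ℝ, ‖Complex.exp (-(r * x))‖ = Real.exp (-r.re * x) := fun x => by
    rw [Complex.norm_exp]; simp
  have hint : IntegrableOn (fun x : ℝ => (x : ℂ) * Complex.exp (-(r * x))) (Set.Ioi 0) := by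
    have h := integrableOn_rpow_mul_exp_neg_mul_rpow (p := 1) (s := 1) (by norm_num) one_pos hr
    refine Integrable.mono' h (by fun_prop) ?_
    filter_upwards [ae_restrict_mem measurableSet_Ioi] with x hx
    rw [norm_mul, hnorm, Complex.norm_real, Real.norm_of_nonneg (le_of_lt hx)]
    simp
  refine ⟨hint, ?_⟩
  have hderiv : ∀ x ∈ Set.Ici (0 : ℝ), HasDerivAt
      (fun x : ℝ => -((x : ℂ) / r + (r ^ 2)⁻¹) * Complex.exp (-(r * x)))
      ((x : ℂ) * Complex.exp (-(r * x))) x := fun x _ => by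
    have h1 : HasDerivAt (fun x : ℝ => (x : ℂ)) 1 x := Complex.ofRealCLM.hasDerivAt
    have h2 : HasDerivAt (fun x : ℝ => -((x : ℂ) / r + (r ^ 2)⁻¹)) (-(1 / r)) x :=
      ((h1.div_const r).add_const _).neg
    have h3 : HasDerivAt (fun x : ℝ => -(r * (x : ℂ))) (-(r * 1)) x := (h1.const_mul r).neg
    refine (h2.mul h3.cexp).congr_deriv ?_
    field_simp
    ring
  have hlim : Tendsto (fun x : ℝ => -((x : ℂ) / r + (r ^ 2)⁻¹) * Complex.exp (-(r * x)))
      atTop (𝓝 0) := by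
    have h0 : Tendsto (fun x : ℝ => Complex.exp (-(r * x))) atTop (𝓝 0) := by
      rw [tendsto_zero_iff_norm_tendsto_zero]
      simp_rw [hnorm]
      exact Real.tendsto_exp_atBot.comp (tendsto_id.const_mul_atTop_of_neg (by linarith))
    have h1 : Tendsto (fun x : ℝ => (x : ℂ) * Complex.exp (-(r * x))) atTop (𝓝 0) := by
      rw [tendsto_zero_iff_norm_tendsto_zero]
      refine (tendsto_rpow_mul_exp_neg_mul_atTop_nhds_zero 1 r.re hr).congr' ?_
      filter_upwards [eventually_ge_atTop 0] with x hx
      rw [norm_mul, hnorm, Complex.norm_real, Real.norm_of_nonneg hx, Real.rpow_one]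
    have := ((h1.const_mul r⁻¹).add (h0.const_mul (r ^ 2)⁻¹)).neg
    simp only [mul_zero, add_zero, neg_zero] at this
    refine this.congr fun x => ?_
    rw [div_eq_mul_inv]; ring
  rw [integral_Ioi_of_hasDerivAt_of_tendsto' hderiv hint hlim]
  simp

/-- The Fourier transform of `x ↦ x exp (-x)`, supported on the positive half-line. -/
noncomputable def halfLineKernel (r ξ : ℝ) : ℂ := (((r : ℂ) + 2 * π * ξ * I) ^ 2)⁻¹

theorem norm_sq_add_two_pi_mul_I (r ξ : ℝ) :
    ‖(r : ℂ) + 2 * π * ξ * I‖ ^ 2 = r ^ 2 + (2 * π * ξ) ^ 2 := by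
  rw [← Complex.normSq_eq_norm_sq, show (2 * π * ξ : ℂ) = ((2 * π * ξ : ℝ) : ℂ) by push_cast; ring,
    Complex.normSq_add_mul_I]

theorem norm_sq_add_two_pi_mul_I_ge {r : ℝ} (hr : 1 / 2 ≤ r) (ξ : ℝ) :
    (1 + ξ ^ 2) / 4 ≤ ‖(r : ℂ) + 2 * π * ξ * I‖ ^ 2 := by
  rw [norm_sq_add_two_pi_mul_I]
  have := Real.pi_gt_three
  have h : ξ ^ 2 ≤ (2 * π * ξ) ^ 2 := by
    rw [mul_pow]
    exact le_mul_of_one_le_left (sq_nonneg _) (by nlinarith)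
  nlinarith [sq_nonneg ξ]

theorem add_two_pi_mul_I_ne_zero {r : ℝ} (hr : 1 / 2 ≤ r) (ξ : ℝ) :
    (r : ℂ) + 2 * π * ξ * I ≠ 0 := fun h => by
  have := norm_sq_add_two_pi_mul_I_ge hr ξ
  rw [h] at this
  norm_num at this
  nlinarith [sq_nonneg ξ]

theorem norm_halfLineKernel_le {r : ℝ} (hr : 1 / 2 ≤ r) (ξ : ℝ) :
    ‖halfLineKernel r ξ‖ ≤ 4 * (1 + ξ ^ 2)⁻¹ := by
  rw [halfLineKernel, norm_inv, norm_pow]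
  calc _ ≤ ((1 + ξ ^ 2) / 4)⁻¹ := by
        gcongr
        exact norm_sq_add_two_pi_mul_I_ge hr ξ
    _ = _ := by rw [inv_div, div_eq_mul_inv]

theorem continuous_halfLineKernel {r : ℝ} (hr : 1 / 2 ≤ r) : Continuous (halfLineKernel r) :=
  Continuous.inv₀ (by fun_prop) fun ξ => pow_ne_zero 2 (add_two_pi_mul_I_ne_zero hr ξ)

theorem integrable_halfLineKernel {r : ℝ} (hr : 1 / 2 ≤ r) : Integrable (halfLineKernel r) :=
  Integrable.mono' (integrable_inv_one_add_sq.const_mul 4)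
    (continuous_halfLineKernel hr).aestronglyMeasurable
    (Eventually.of_forall (norm_halfLineKernel_le hr))

theorem integral_halfLineKernel_mul_exp {α : ℝ} (hα : 0 < α) :
    ∫ ξ : ℝ, halfLineKernel 1 ξ * Complex.exp (2 * π * ξ * I * α) = α * Real.exp (-α) := by
  set f : ℝ → ℂ := fun x => ((max x 0 : ℝ) : ℂ) * Complex.exp (-x) with hf
  have hind : ∀ w : ℝ, (fun v : ℝ => Complex.exp (↑(-2 * π * v * w) * I) • f v) =
      (Set.Ioi (0 : ℝ)).indicator
        fun x : ℝ => (x : ℂ) * Complex.exp (-((((1 : ℝ) : ℂ) + 2 * π * w * I) * x)) := fun w => by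
    ext x
    by_cases hx : 0 < x
    · rw [Set.indicator_of_mem (Set.mem_Ioi.mpr hx), hf]
      simp only [max_eq_left hx.le, smul_eq_mul]
      rw [mul_left_comm, ← Complex.exp_add]
      congr 2
      push_cast
      ring
    · rw [Set.indicator_of_notMem (Set.notMem_Ioi.mpr (not_lt.mp hx)), hf]
      simp [max_eq_right (not_lt.mp hx)]
  have hre : ∀ w : ℝ, 0 < (((1 : ℝ) : ℂ) + 2 * π * w * I).re := fun w => by simp
  have hfour : 𝓕 f = halfLineKernel 1 := by
    ext w
    rw [fourier_real_eq_integral_exp_smul, hind, integral_indicator measurableSet_Ioi,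
      (integral_Ioi_mul_cexp_neg (hre w)).2, halfLineKernel]
  have hfint : Integrable f := by
    have h0 := hind 0
    have h1 := ((integrable_indicator_iff measurableSet_Ioi).mpr
      (integral_Ioi_mul_cexp_neg (hre 0)).1)
    rw [← h0] at h1
    simpa using h1
  have hinv := Continuous.fourierInv_fourier_eq (f := f) (by fun_prop) hfint
    (hfour ▸ integrable_halfLineKernel (by norm_num))
  have := congrFun hinv α
  rw [hfour, Real.fourierInv_eq'] at this
  simp only [hf, max_eq_left hα.le] at this
  rw [Complex.ofReal_exp, Complex.ofReal_neg, ← this]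
  refine integral_congr_ae (Eventually.of_forall fun ξ => ?_)
  simp only [smul_eq_mul]
  rw [mul_comm]
  congr 2
  simp
  ring

end FourierKernel

section DecayingElement

open MeasureTheory Real

theorem norm_halfLineKernel_deriv_le {r : ℝ} (hr : 1 / 2 ≤ r) (ξ : ℝ) :
    ‖-2 * (((r : ℂ) + 2 * π * ξ * I) ^ 3)⁻¹‖ ≤ 16 * (1 + ξ ^ 2)⁻¹ := by
  set w : ℂ := (r : ℂ) + 2 * π * ξ * I with hw
  have h1 : (1 + ξ ^ 2) / 4 ≤ ‖w‖ ^ 2 := norm_sq_add_two_pi_mul_I_ge hr ξ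
  have h2 : 1 / 2 ≤ ‖w‖ := hr.trans ((le_abs_self r).trans (by
    have := Complex.abs_re_le_norm w
    simpa [hw] using this))
  rw [norm_mul, norm_inv, norm_pow, norm_neg]
  calc ‖(2 : ℂ)‖ * (‖w‖ ^ 3)⁻¹ ≤ 2 * ((1 / 2) * ((1 + ξ ^ 2) / 4))⁻¹ := by
        rw [Complex.norm_ofNat, pow_succ']
        gcongr
    _ = 16 * (1 + ξ ^ 2)⁻¹ := by field_simp; norm_num

theorem hasDerivAt_halfLineKernel {r : ℝ} (hr : 1 / 2 ≤ r) (ξ : ℝ) :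
    HasDerivAt (fun r => halfLineKernel r ξ) (-2 * (((r : ℂ) + 2 * π * ξ * I) ^ 3)⁻¹) r := by
  have h0 := add_two_pi_mul_I_ne_zero hr ξ
  have h1 : HasDerivAt (fun r : ℝ => (r : ℂ) + 2 * π * ξ * I) 1 r :=
    Complex.ofRealCLM.hasDerivAt.add_const _
  refine ((h1.pow 2).inv (pow_ne_zero 2 h0)).congr_deriv ?_
  simp only [Pi.pow_apply]
  field_simp
  norm_num

theorem hasDerivAt_halfLineKernel_right {r : ℝ} (hr : 1 / 2 ≤ r) (ξ : ℝ) :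
    HasDerivAt (halfLineKernel r)
      ((2 * π * I) * (-2 * (((r : ℂ) + 2 * π * ξ * I) ^ 3)⁻¹)) ξ := by
  have h0 := add_two_pi_mul_I_ne_zero hr ξ
  have h1 : HasDerivAt (fun ξ : ℝ => (r : ℂ) + 2 * π * ξ * I) (2 * π * 1 * I) ξ :=
    ((Complex.ofRealCLM.hasDerivAt.const_mul _).mul_const _).const_add _
  refine ((h1.pow 2).inv (pow_ne_zero 2 h0)).congr_deriv ?_
  simp only [Pi.pow_apply]
  field_simp
  norm_num

theorem exists_decaying_element {𝒜 : Type*} [NormedCommRing 𝒜] [NormedAlgebra ℂ 𝒜]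
    [CompleteSpace 𝒜] (a : 𝒜) (ha : ∀ t : ℝ, ‖NormedSpace.exp (((t : ℂ) * I) • a)‖ ≤ 1) :
    ∃ g : 𝒜, (∃ C : ℝ, ∀ s : ℝ, 0 ≤ s → ‖NormedSpace.exp ((-(s : ℂ)) • a) * g‖ ≤ C) ∧
      ∀ χ : 𝒜 →ₐ[ℂ] ℂ, Continuous χ → ∀ α : ℝ, 0 < α → χ a = α → χ g ≠ 0 := by
  set U : ℝ → 𝒜 := fun ξ => NormedSpace.exp ((2 * π * ξ * I : ℂ) • a) with hU
  have hUnorm : ∀ ξ, ‖U ξ‖ ≤ 1 := fun ξ => by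
    have := ha (2 * π * ξ)
    push_cast at this
    exact this
  have hUderiv : ∀ ξ, HasDerivAt U ((2 * π * I : ℂ) • (a * U ξ)) ξ := fun ξ => by
    have h1 : HasDerivAt (fun ξ : ℝ => (2 * π * ξ * I : ℂ)) (2 * π * 1 * I) ξ :=
      (Complex.ofRealCLM.hasDerivAt.const_mul _).mul_const _
    have := (hasDerivAt_exp_smul_const' (𝕂 := ℂ) a (2 * π * ξ * I : ℂ)).scomp ξ h1
    simp only [mul_one] at this
    exact this
  have hUcont : Continuous U := continuous_iff_continuousAt.mpr fun ξ => (hUderiv ξ).continuousAt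
  set G : ℝ → 𝒜 := fun r => ∫ ξ, halfLineKernel r ξ • U ξ with hG
  have hcont3 : ∀ r : ℝ, 1 / 2 ≤ r →
      Continuous fun ξ : ℝ => -2 * (((r : ℂ) + 2 * π * ξ * I) ^ 3)⁻¹ := fun r hr =>
    continuous_const.mul (Continuous.inv₀ (by fun_prop) fun ξ =>
      pow_ne_zero 3 (add_two_pi_mul_I_ne_zero hr ξ))
  have hbound : ∀ (k : ℂ) (ξ B : ℝ), ‖k‖ ≤ B → ‖k • U ξ‖ ≤ B := fun k ξ B hk => by
    rw [norm_smul]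
    exact (mul_le_of_le_one_right (norm_nonneg _) (hUnorm ξ)).trans hk
  have hGint : ∀ r : ℝ, 1 / 2 ≤ r → Integrable fun ξ => halfLineKernel r ξ • U ξ := fun r hr =>
    Integrable.mono' (integrable_inv_one_add_sq.const_mul 4)
      ((continuous_halfLineKernel hr).smul hUcont).aestronglyMeasurable
      (Eventually.of_forall fun ξ => hbound _ _ _ (norm_halfLineKernel_le hr ξ))
  have hGderiv : ∀ r : ℝ, 1 / 2 < r → HasDerivAt G (-(a * G r)) r := fun r hr => by
    obtain ⟨hint, hder⟩ := hasDerivAt_integral_of_dominated_loc_of_deriv_le (μ := volume)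
      (F := fun r ξ => halfLineKernel r ξ • U ξ)
      (F' := fun (r : ℝ) ξ => (-2 * (((r : ℂ) + 2 * π * ξ * I) ^ 3)⁻¹) • U ξ)
      (bound := fun ξ => 16 * (1 + ξ ^ 2)⁻¹) (Ioi_mem_nhds hr)
      (eventually_of_mem (Ioi_mem_nhds hr) fun t ht => (hGint t (le_of_lt ht)).aestronglyMeasurable)
      (hGint r hr.le) ((hcont3 r hr.le).smul hUcont).aestronglyMeasurable
      (Eventually.of_forall fun ξ t ht => hbound _ _ _ (norm_halfLineKernel_deriv_le (le_of_lt ht) ξ))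
      (integrable_inv_one_add_sq.const_mul 16)
      (Eventually.of_forall fun ξ t ht =>
        (hasDerivAt_halfLineKernel (le_of_lt ht) ξ).smul_const _)
    refine hder.congr_deriv ?_
    have hint' : Integrable fun ξ => a * (halfLineKernel r ξ • U ξ) := (hGint r hr.le).const_mul a
    have hzero := integral_eq_zero_of_hasDerivAt_of_integrable
      (f' := fun ξ => (2 * π * I : ℂ) • ((-2 * (((r : ℂ) + 2 * π * ξ * I) ^ 3)⁻¹) • U ξ +
        a * (halfLineKernel r ξ • U ξ)))
      (fun ξ => ((hasDerivAt_halfLineKernel_right hr.le ξ).smul (hUderiv ξ)).congr_deriv (by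
        simp only [smul_add, mul_smul_comm, smul_smul]
        rw [add_comm, mul_comm (halfLineKernel r ξ)]))
      ((hint.add hint').smul (2 * π * I : ℂ)) (hGint r hr.le)
    rw [integral_smul, integral_add hint hint', smul_eq_zero] at hzero
    have h2 : (2 * π * I : ℂ) ≠ 0 := Complex.two_pi_I_ne_zero
    rw [eq_neg_iff_add_eq_zero, hG]
    have h3 : a * ∫ ξ, halfLineKernel r ξ • U ξ = ∫ ξ, a * (halfLineKernel r ξ • U ξ) :=
      ((ContinuousLinearMap.mul ℂ 𝒜 a).integral_comp_comm (hGint r hr.le)).symm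
    rw [h3]
    exact hzero.resolve_left h2
  have hflow : ∀ s : ℝ, 0 ≤ s → NormedSpace.exp ((-(s : ℂ)) • a) * G 1 = G (1 + s) := fun s hs => by
    set H : ℝ → 𝒜 := fun r => NormedSpace.exp ((r : ℂ) • a) * G r with hH
    have hHd : ∀ r ∈ Set.Ioi (1 / 2 : ℝ), HasDerivAt H 0 r := fun r hr => by
      have h1 := (hasDerivAt_exp_smul_const (𝕂 := ℂ) a (r : ℂ)).scomp r
        Complex.ofRealCLM.hasDerivAt
      rw [Complex.ofRealCLM_apply, Complex.ofReal_one, one_smul] at h1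
      refine (h1.mul (hGderiv r hr)).congr_deriv ?_
      simp only [Function.comp_apply]
      ring
    have hconst : H (1 + s) = H 1 := isOpen_Ioi.is_const_of_deriv_eq_zero
      (isPreconnected_Ioi (a := (1 / 2 : ℝ)))
      (fun r hr => (hHd r hr).differentiableAt.differentiableWithinAt)
      (fun r hr => (hHd r hr).deriv) (Set.mem_Ioi.mpr (by linarith)) (Set.mem_Ioi.mpr (by norm_num))
    have h := congrArg (fun x => NormedSpace.exp ((-((1 + s : ℝ) : ℂ)) • a) * x) hconst
    simp only [hH, ← mul_assoc, ← NormedSpace.exp_add_smul_complex] at h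
    rw [neg_add_cancel, zero_smul, NormedSpace.exp_zero, one_mul] at h
    rw [h]
    congr 3
    push_cast
    ring
  refine ⟨G 1, ⟨∫ ξ : ℝ, 4 * (1 + ξ ^ 2)⁻¹, fun s hs => ?_⟩, fun χ hχ α hα hχa => ?_⟩
  · rw [hflow s hs]
    have h12 : (1 / 2 : ℝ) ≤ 1 + s := by linarith
    exact norm_integral_le_of_norm_le (integrable_inv_one_add_sq.const_mul 4)
      (Eventually.of_forall fun ξ => hbound _ _ _ (norm_halfLineKernel_le h12 ξ))
  · have h12 : (1 / 2 : ℝ) ≤ 1 := by norm_num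
    have h := (ContinuousLinearMap.mk χ.toLinearMap hχ).integral_comp_comm (hGint 1 h12)
    have h' : χ (G 1) = ∫ ξ : ℝ, halfLineKernel 1 ξ * Complex.exp (2 * π * ξ * I * α) := by
      refine h.symm.trans (integral_congr_ae (Eventually.of_forall fun ξ => ?_))
      change χ (halfLineKernel 1 ξ • U ξ) = _
      rw [map_smul, hU, NormedSpace.map_exp_complex χ hχ, map_smul, hχa, smul_eq_mul, smul_eq_mul,
        Complex.exp_eq_exp_ℂ]
    rw [h', integral_halfLineKernel_mul_exp hα]
    exact mul_ne_zero (Complex.ofReal_ne_zero.mpr hα.ne')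
      (Complex.ofReal_ne_zero.mpr (Real.exp_pos _).ne')

end DecayingElement

section BanachAlgebraGrowth

variable {𝒜 : Type*} [NormedCommRing 𝒜] [NormedAlgebra ℂ 𝒜] [CompleteSpace 𝒜]

theorem character_exp (χ : 𝒜 →ₐ[ℂ] ℂ) (hχ : Continuous χ) (a : 𝒜) :
    χ (NormedSpace.exp a) = Complex.exp (χ a) := by
  rw [NormedSpace.map_exp_complex χ hχ, Complex.exp_eq_exp_ℂ]

/-- Characters take real values on elements whose imaginary exponentials are contractions. -/
theorem character_im_eq_zero [NormOneClass 𝒜] {a : 𝒜}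
    (ha : ∀ t : ℝ, ‖NormedSpace.exp (((t : ℂ) * I) • a)‖ ≤ 1)
    (χ : 𝒜 →ₐ[ℂ] ℂ) (hχ : Continuous χ) : (χ a).im = 0 := by
  have key : ∀ t : ℝ, -(t * (χ a).im) ≤ 0 := fun t => by
    have h1 : ‖χ (NormedSpace.exp (((t : ℂ) * I) • a))‖ ≤ 1 :=
      (AlgHom.norm_apply_le_self χ _).trans (ha t)
    rw [character_exp χ hχ, Complex.norm_exp, Real.exp_le_one_iff, map_smul, smul_eq_mul] at h1
    simpa using h1
  have h1 := key 1
  have h2 := key (-1)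
  linarith

theorem re_character_le_add [NormOneClass 𝒜] {a b : 𝒜} {c : ℝ} (hc : 0 < c)
    (ha : ∀ t : ℝ, ‖NormedSpace.exp (((t : ℂ) * I) • a)‖ ≤ 1)
    (hP : ∀ j : ℤ, ∃ P : Polynomial ℂ,
      (∀ g : 𝒜, (∃ C : ℝ, ∀ s : ℝ, 0 ≤ s →
          ‖NormedSpace.exp ((-(s : ℂ)) • a) * g‖ ≤ C * Real.exp (-(j * c * s))) →
        Polynomial.aeval b P * g = 0) ∧ ∀ z : ℂ, P.eval z = 0 → j * c ≤ z.re)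
    (χ : 𝒜 →ₐ[ℂ] ℂ) (hχ : Continuous χ) : (χ a).re ≤ (χ b).re + c := by
  by_contra! h
  set j : ℤ := ⌊(χ b).re / c⌋ + 1 with hj
  have h1 : (χ b).re < j * c := by
    rw [← div_lt_iff₀ hc, hj]
    push_cast
    exact Int.lt_floor_add_one _
  have h2 : j * c ≤ (χ b).re + c := by
    have := Int.floor_le ((χ b).re / c)
    rw [le_div_iff₀ hc] at this
    rw [hj]
    push_cast
    linarith
  obtain ⟨P, hP1, hP2⟩ := hP j
  set l : ℂ := ((j * c : ℝ) : ℂ) with hl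
  have hexp : ∀ z : ℂ, NormedSpace.exp (z • (a - l • (1 : 𝒜))) =
      Complex.exp (-(z * l)) • NormedSpace.exp (z • a) := fun z => by
    have e1 : z • (a - l • (1 : 𝒜)) = algebraMap ℂ 𝒜 (-(z * l)) + z • a := by
      rw [Algebra.algebraMap_eq_smul_one, smul_sub, smul_smul, neg_smul]
      abel
    rw [e1, NormedSpace.exp_add_of_commute_complex (Commute.all _ _),
      ← NormedSpace.algebraMap_exp_comm, ← Complex.exp_eq_exp_ℂ, ← Algebra.smul_def]
  obtain ⟨g, ⟨C, hC⟩, hg⟩ := exists_decaying_element (a - l • (1 : 𝒜)) fun t => by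
    rw [hexp, norm_smul, Complex.norm_exp]
    have : (-((t : ℂ) * I * l)).re = 0 := by simp [hl]
    rw [this, Real.exp_zero, one_mul]
    exact ha t
  have hg0 := hP1 g ⟨C, fun s hs => by
    have h3 := hC s hs
    rw [hexp, smul_mul_assoc, norm_smul, Complex.norm_exp] at h3
    have e2 : (-(-(s : ℂ) * l)).re = j * c * s := by
      rw [hl, neg_mul, neg_neg, ← Complex.ofReal_mul, Complex.ofReal_re, mul_comm]
    rw [e2, mul_comm] at h3
    rw [Real.exp_neg, ← div_eq_mul_inv, le_div_iff₀ (Real.exp_pos _)]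
    exact h3⟩
  have hχg := hg χ hχ ((χ a).re - j * c) (by linarith) (by
    have him := character_im_eq_zero ha χ hχ
    apply Complex.ext <;> simp [hl, him])
  have h4 := congrArg χ hg0
  rw [map_mul, map_zero, mul_eq_zero, or_iff_left hχg, ← Polynomial.aeval_algHom_apply,
    Polynomial.coe_aeval_eq_eval] at h4
  linarith [hP2 _ h4]

/-- Growth of the exponential group in terms of characters. -/
theorem eventually_norm_exp_le [NormOneClass 𝒜] {t : 𝒜} {c c' : ℝ} (hc' : 0 ≤ c') (hcc : c < c')
    (ht : ∀ χ : 𝒜 →ₐ[ℂ] ℂ, Continuous χ → (χ t).re ≤ c) :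
    ∀ᶠ s : ℝ in atTop, ‖NormedSpace.exp ((s : ℂ) • t)‖ ≤ Real.exp ‖t‖ * Real.exp (c' * s) := by
  have : Nontrivial 𝒜 := NormOneClass.nontrivial (G := 𝒜)
  set u : 𝒜 := NormedSpace.exp t with hu
  have hr : spectralRadius ℂ u < ENNReal.ofReal (Real.exp c') := by
    obtain ⟨z, hz, hzr⟩ := spectrum.exists_nnnorm_eq_spectralRadius u
    rw [WeakDual.CharacterSpace.mem_spectrum_iff_exists] at hz
    obtain ⟨f, hf⟩ := hz
    let χ : 𝒜 →ₐ[ℂ] ℂ := WeakDual.CharacterSpace.toAlgHom f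
    have hχ : Continuous χ := map_continuous f
    have h1 : z = Complex.exp (χ t) := by
      rw [← character_exp χ hχ, ← hf]
      rfl
    rw [← hzr, ← enorm_eq_nnnorm, ← ofReal_norm, h1, Complex.norm_exp]
    exact (ENNReal.ofReal_lt_ofReal_iff (Real.exp_pos _)).2
      (Real.exp_lt_exp.2 ((ht χ hχ).trans_lt hcc))
  have hev : ∀ᶠ n : ℕ in atTop, ‖u ^ n‖ ≤ Real.exp (c' * n) := by
    filter_upwards [(spectrum.pow_norm_pow_one_div_tendsto_nhds_spectralRadius u).eventually_lt_const
      hr, eventually_gt_atTop 0] with n hn hn0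
    rw [ENNReal.ofReal_lt_ofReal_iff (Real.exp_pos _), one_div] at hn
    have h2 := pow_le_pow_left₀ (by positivity) hn.le n
    rwa [Real.rpow_inv_natCast_pow (norm_nonneg _) hn0.ne', ← Real.exp_nat_mul, mul_comm] at h2
  filter_upwards [tendsto_nat_floor_atTop.eventually hev, eventually_ge_atTop (0 : ℝ)] with s hs hs0
  have h1 : (⌊s⌋₊ : ℝ) ≤ s := Nat.floor_le hs0
  have h2 : s < ⌊s⌋₊ + 1 := Nat.lt_floor_add_one s
  have h3 : NormedSpace.exp ((s : ℂ) • t) =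
      NormedSpace.exp (((s - ⌊s⌋₊ : ℝ) : ℂ) • t) * u ^ ⌊s⌋₊ := by
    have h4 : u ^ ⌊s⌋₊ = NormedSpace.exp (((⌊s⌋₊ : ℕ) : ℂ) • t) := by
      let _ := NormedAlgebra.restrictScalars ℚ ℂ 𝒜
      rw [hu, ← NormedSpace.exp_nsmul, Nat.cast_smul_eq_nsmul]
    rw [h4, ← NormedSpace.exp_add_smul_complex]
    push_cast
    rw [sub_add_cancel]
  rw [h3]
  refine (norm_mul_le _ _).trans (mul_le_mul ?_ (hs.trans ?_) (norm_nonneg _) (Real.exp_nonneg _))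
  · refine (NormedSpace.norm_exp_le_complex _).trans (Real.exp_le_exp.2 ?_)
    rw [norm_smul, Complex.norm_real, Real.norm_of_nonneg (by linarith)]
    exact mul_le_of_le_one_left (norm_nonneg _) (by linarith)
  · exact Real.exp_le_exp.2 (mul_le_mul_of_nonneg_left h1 hc')

end BanachAlgebraGrowth

/-- Comparison of the growth of commuting elements of a Banach algebra. -/
theorem eventually_norm_exp_sub_le {R : Type*} [NormedRing R] [NormedAlgebra ℂ R] [CompleteSpace R]
    [NormOneClass R] {a b : R} (hab : Commute a b) {c c' : ℝ} (hc : 0 < c) (hcc : c < c')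
    (ha : ∀ t : ℝ, ‖NormedSpace.exp (((t : ℂ) * I) • a)‖ ≤ 1)
    (hP : ∀ j : ℤ, ∃ P : Polynomial ℂ,
      (∀ g : R, (∃ C : ℝ, ∀ s : ℝ, 0 ≤ s →
          ‖NormedSpace.exp ((-(s : ℂ)) • a) * g‖ ≤ C * Real.exp (-(j * c * s))) →
        Polynomial.aeval b P * g = 0) ∧ ∀ z : ℂ, P.eval z = 0 → j * c ≤ z.re) :
    ∀ᶠ s : ℝ in atTop, ‖NormedSpace.exp ((s : ℂ) • (a - b))‖ ≤
      Real.exp ‖a - b‖ * Real.exp (c' * s) := by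
  have hcomm : ∀ x ∈ ({a, b} : Set R), ∀ y ∈ ({a, b} : Set R), x * y = y * x := by
    rintro x (rfl | rfl) y (rfl | rfl)
    exacts [rfl, hab.eq, hab.eq.symm, rfl]
  set S₀ : Subalgebra ℂ R := Algebra.adjoin ℂ {a, b} with hS₀
  set S : Subalgebra ℂ R := S₀.topologicalClosure with hS
  have hS₀comm : ∀ x y : S₀, x * y = y * x :=
    (Algebra.isMulCommutative_adjoin ℂ hcomm).is_comm.comm
  let _ : NormedCommRing S :=
    { (inferInstance : NormedRing S) with
      mul_comm := (S₀.commRingTopologicalClosure hS₀comm).mul_comm }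
  have : CompleteSpace S := S₀.isClosed_topologicalClosure.completeSpace_coe
  have : NormOneClass S := ⟨(norm_one : ‖(1 : R)‖ = 1)⟩
  have haS : a ∈ S := S₀.le_topologicalClosure (Algebra.subset_adjoin (by simp))
  have hbS : b ∈ S := S₀.le_topologicalClosure (Algebra.subset_adjoin (by simp))
  let a' : S := ⟨a, haS⟩
  let b' : S := ⟨b, hbS⟩
  have hexp : ∀ x : S, ((NormedSpace.exp x : S) : R) = NormedSpace.exp (x : R) :=
    fun x => NormedSpace.map_exp_complex S.val continuous_subtype_val x
  have hnorm : ∀ x : S, ‖x‖ = ‖(x : R)‖ := fun _ => rfl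
  have ha' : ∀ t : ℝ, ‖NormedSpace.exp (((t : ℂ) * I) • a')‖ ≤ 1 := fun t => by
    rw [hnorm, hexp]
    exact ha t
  have hχ := re_character_le_add (a := a') (b := b') hc ha' fun j => by
    obtain ⟨P, hP1, hP2⟩ := hP j
    refine ⟨P, fun g ⟨C, hC⟩ => ?_, hP2⟩
    apply Subtype.ext
    have h1 := hP1 (g : R) ⟨C, fun s hs => by
      have h2 := hC s hs
      rw [hnorm, Subalgebra.coe_mul, hexp] at h2
      exact h2⟩
    have h3 : ((Polynomial.aeval b' P : S) : R) = Polynomial.aeval b P :=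
      (Polynomial.aeval_algHom_apply S.val b' P).symm
    rw [Subalgebra.coe_mul, h3, h1, Subalgebra.coe_zero]
  have := eventually_norm_exp_le (t := a' - b') (hc.le.trans hcc.le) hcc fun χ h => by
    have := hχ χ h
    rw [map_sub, Complex.sub_re]
    linarith
  filter_upwards [this] with s hs
  rw [hnorm, hexp] at hs
  exact hs

/-- An exponential type estimate from growth on the positive half-axis and boundedness on the
imaginary axis. -/
theorem norm_exp_smul_le_of_eventually {R : Type*} [NormedRing R] [NormedAlgebra ℂ R]
    [CompleteSpace R] [NormOneClass R] {a : R} {c K : ℝ}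
    (h : ∀ c' > c, ∀ᶠ s : ℝ in atTop, ‖NormedSpace.exp ((s : ℂ) • a)‖ ≤ K * Real.exp (c' * s))
    (him : ∀ t : ℝ, ‖NormedSpace.exp (((t : ℂ) * I) • a)‖ ≤ 1) {z : ℂ} (hz : 0 ≤ z.re) :
    ‖NormedSpace.exp (z • a)‖ ≤ Real.exp (c * z.re) := by
  have key : ∀ ε : ℝ, 0 < ε → ‖NormedSpace.exp (z • a)‖ ≤ Real.exp ((c + 2 * ε) * z.re) := by
    intro ε hε
    obtain ⟨l, hl⟩ : ∃ l, l = c + 2 * ε := ⟨_, rfl⟩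
    rw [← hl]
    have hnorm : ∀ w : ℂ, ‖Complex.exp (-(l * w)) • NormedSpace.exp (w • a)‖ =
        Real.exp (-(l * w.re)) * ‖NormedSpace.exp (w • a)‖ := fun w => by
      rw [norm_smul, Complex.norm_exp]
      simp
    have hPL := PhragmenLindelof.right_half_plane_of_tendsto_zero_on_real
      (f := fun w : ℂ => Complex.exp (-(l * w)) • NormedSpace.exp (w • a)) (C := 1) (z := z)
      ((Differentiable.smul (f := fun w : ℂ => NormedSpace.exp (w • a))
        (c := fun w : ℂ => Complex.exp (-(l * w))) (by fun_prop)
        (NormedSpace.differentiable_exp_smul a)).diffContOnCl)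
      ⟨1, by norm_num, |l| + ‖a‖, ?_⟩ ?_ ?_ hz
    · rw [hnorm, Real.exp_neg, inv_mul_le_iff₀ (Real.exp_pos _), mul_one] at hPL
      exact hPL
    · refine IsBigO.of_bound 1 (Eventually.of_forall fun w => ?_)
      rw [hnorm, Real.norm_of_nonneg (Real.exp_nonneg _), one_mul, Real.rpow_one, add_mul,
        Real.exp_add]
      refine mul_le_mul (Real.exp_le_exp.2 ?_) ((NormedSpace.norm_exp_le_complex _).trans
        (Real.exp_le_exp.2 ?_)) (norm_nonneg _) (Real.exp_nonneg _)
      · calc -(l * w.re) ≤ |l * w.re| := neg_le_abs _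
          _ = |l| * |w.re| := abs_mul _ _
          _ ≤ |l| * ‖w‖ := by gcongr; exact Complex.abs_re_le_norm w
      · rw [norm_smul, mul_comm]
    · have h1 : Tendsto (fun x : ℝ => K * Real.exp (-(ε * x))) atTop (𝓝 0) := by
        rw [← mul_zero K]
        exact (Real.tendsto_exp_neg_atTop_nhds_zero.comp
          (tendsto_id.const_mul_atTop hε)).const_mul K
      refine squeeze_zero_norm' ?_ h1
      filter_upwards [h (c + ε) (by linarith)] with x hx
      rw [hnorm, Complex.ofReal_re]
      calc Real.exp (-(l * x)) * ‖NormedSpace.exp ((x : ℂ) • a)‖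
          ≤ Real.exp (-(l * x)) * (K * Real.exp ((c + ε) * x)) := by gcongr
        _ = K * (Real.exp (-(l * x)) * Real.exp ((c + ε) * x)) := by ring
        _ = K * Real.exp (-(ε * x)) := by
          rw [← Real.exp_add, hl]
          congr 2
          ring
    · intro x
      rw [hnorm]
      simpa using him x
  have hlim : Tendsto (fun ε : ℝ => Real.exp ((c + 2 * ε) * z.re)) (𝓝[>] 0)
      (𝓝 (Real.exp (c * z.re))) := by
    have : Continuous fun ε : ℝ => Real.exp ((c + 2 * ε) * z.re) := by fun_prop
    simpa using (this.tendsto 0).mono_left nhdsWithin_le_nhds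
  exact ge_of_tendsto hlim (by filter_upwards [self_mem_nhdsWithin] with ε hε using key ε hε)

/-- Bernstein-type inequality. -/
theorem norm_le_of_norm_exp_smul_le {R : Type*} [NormedRing R] [NormedAlgebra ℂ R]
    [CompleteSpace R] {a : R} {c : ℝ} (hc : 0 < c)
    (h : ∀ z : ℂ, ‖NormedSpace.exp (z • a)‖ ≤ Real.exp (c * |z.re|)) :
    ‖a‖ ≤ Real.exp 1 * c := by
  have h1 := Complex.norm_deriv_le_of_forall_mem_sphere_norm_le (c := 0) (R := c⁻¹)
    (C := Real.exp 1) (inv_pos.2 hc)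
    (NormedSpace.differentiable_exp_smul a).diffContOnCl fun z hz => by
      refine (h z).trans (Real.exp_le_exp.2 ?_)
      rw [mem_sphere_zero_iff_norm] at hz
      calc c * |z.re| ≤ c * ‖z‖ := by gcongr; exact Complex.abs_re_le_norm z
        _ = 1 := by rw [hz, mul_inv_cancel₀ hc.ne']
  rw [(hasDerivAt_exp_smul_const a (0 : ℂ)).deriv, div_inv_eq_mul] at h1
  simpa using h1

section SakaiKadison

variable {M : Type*} [CStarAlgebra M]

/-- Approximation of a derivation by inner derivations implemented by spectral sums. -/
theorem norm_sub_innerDerivation_projectionSum_le {A : BoundedEndo M} {q : ℝ → M}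
    (hA : ∀ x y, A (x * y) = A x * y + x * A y) (hs : ∀ x, A (star x) = -star (A x))
    (hq : ∀ μ, IsStarProjection (q μ)) (hAq : ∀ μ, A (q μ) = 0)
    (hmono : ∀ μ ν, μ ≤ ν → q μ * q ν = q ν)
    (hdecay : ∀ μ, ∀ x ∈ decaySpace A μ, ∀ ν, q (ν + μ) * x * q ν = x * q ν)
    {n K : ℕ} (hn : 0 < n) (h0 : q 0 = 1) (hK : q (K / n) = 0) :
    ‖A - innerDerivation (projectionSum q n K)‖ ≤ Real.exp 1 / n := by
  rcases subsingleton_or_nontrivial M with hM | hM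
  · rw [Subsingleton.elim (A - innerDerivation (projectionSum q n K)) 0, norm_zero]
    positivity
  set h := projectionSum q n K with hh
  set B := innerDerivation h with hB
  have hsa : star h = h := isSelfAdjoint_projectionSum hq n K
  have hn' : (0 : ℝ) < n := Nat.cast_pos.mpr hn
  have hAh : A h = 0 := by
    rw [hh, projectionSum, map_smul, map_sum, Finset.sum_eq_zero fun i _ => hAq _, smul_zero]
  have hcomm : Commute A B := by
    refine ContinuousLinearMap.ext fun x => ?_
    change A (B x) = B (A x)
    rw [hB, innerDerivation_apply, innerDerivation_apply, map_sub, hA, hA, hAh]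
    simp
  set T : BoundedEndo M := A - B with hT
  have hTapp : ∀ x, T x = A x - (h * x - x * h) := fun x => rfl
  have hT1 : ∀ x y, T (x * y) = T x * y + x * T y := fun x y => by
    rw [hTapp, hTapp, hTapp, hA]
    noncomm_ring
  have hT2 : ∀ x, T (star x) = -star (T x) := fun x => by
    rw [hTapp, hTapp, hs]
    simp only [star_sub, star_mul, hsa]
    abel
  have him := norm_exp_I_smul_derivation_le T hT1 hT2
  have hP : ∀ j : ℤ, ∃ P : Polynomial ℂ,
      (∀ g : BoundedEndo M, (∃ C : ℝ, ∀ s : ℝ, 0 ≤ s →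
          ‖NormedSpace.exp ((-(s : ℂ)) • A) * g‖ ≤ C * Real.exp (-(j * (1 / n : ℝ) * s))) →
        Polynomial.aeval B P * g = 0) ∧ ∀ z : ℂ, P.eval z = 0 → j * (1 / n : ℝ) ≤ z.re := by
    intro j
    refine ⟨∏ m ∈ Finset.Icc j K, (Polynomial.X - Polynomial.C ((m : ℂ) / n)),
      fun g ⟨C, hC⟩ => ContinuousLinearMap.ext fun x => ?_, fun z hz => ?_⟩
    · refine aeval_innerDerivation_projectionSum_eq_zero hq hmono hn h0 hK j
        (hdecay _ (g x) ⟨C * ‖x‖, fun s hs0 => ?_⟩)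
      calc ‖NormedSpace.exp ((-(s : ℂ)) • A) (g x)‖
          = ‖(NormedSpace.exp ((-(s : ℂ)) • A) * g : BoundedEndo M) x‖ := rfl
        _ ≤ ‖NormedSpace.exp ((-(s : ℂ)) • A) * g‖ * ‖x‖ := ContinuousLinearMap.le_opNorm _ _
        _ ≤ C * Real.exp (-(j * (1 / n : ℝ) * s)) * ‖x‖ := by gcongr; exact hC s hs0
        _ = C * ‖x‖ * Real.exp (-(j / n * s)) := by
          rw [mul_one_div]
          ring
    · rw [Polynomial.eval_prod, Finset.prod_eq_zero_iff] at hz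
      obtain ⟨m, hm, hmz⟩ := hz
      rw [Polynomial.eval_sub, Polynomial.eval_X, Polynomial.eval_C, sub_eq_zero] at hmz
      have h1 : z.re = m / n := by
        rw [hmz, ← Complex.ofReal_intCast, ← Complex.ofReal_natCast, ← Complex.ofReal_div,
          Complex.ofReal_re]
      rw [h1, mul_one_div]
      have : (j : ℝ) ≤ m := by exact_mod_cast (Finset.mem_Icc.1 hm).1
      gcongr
  have hc : (0 : ℝ) < 1 / n := by positivity
  have hright : ∀ z : ℂ, 0 ≤ z.re → ‖NormedSpace.exp (z • T)‖ ≤ Real.exp (1 / n * z.re) :=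
    fun z hz => norm_exp_smul_le_of_eventually (K := Real.exp ‖T‖) (fun c' hc' =>
      eventually_norm_exp_sub_le hcomm hc hc' (norm_exp_I_smul_derivation_le A hA hs) hP) him hz
  rw [← mul_one_div]
  refine norm_le_of_norm_exp_smul_le hc fun z => ?_
  rcases le_total 0 z.re with hz | hz
  · rw [abs_of_nonneg hz]
    exact hright z hz
  · rw [abs_of_nonpos hz]
    refine ContinuousLinearMap.opNorm_le_bound _ (Real.exp_nonneg _) fun x => ?_
    have h1 := hright (-star z) (by simpa using hz)
    rw [← norm_star, exp_star_apply T hT2]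
    refine (ContinuousLinearMap.le_opNorm _ _).trans ?_
    rw [norm_star]
    gcongr
    simpa using h1

/-- If left annihilators in a C⋆-algebra are generated by projections, bounded `⋆`-derivations
are inner. -/
theorem exists_innerDerivation_eq
    (hsupp : ∀ S : Set M, ∃ q : M, IsStarProjection q ∧ ∀ y, (∀ x ∈ S, y * x = 0) ↔ y * q = 0)
    {A : BoundedEndo M} (hA : ∀ x y, A (x * y) = A x * y + x * A y)
    (hs : ∀ x, A (star x) = -star (A x)) :
    ∃ h : M, IsSelfAdjoint h ∧ A = innerDerivation h := by
  obtain ⟨q, hq, hAq, h0, htop, hmono, hdecay⟩ := exists_spectral_projections hsupp hA hs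
  obtain ⟨K, hK⟩ := exists_nat_gt ‖A‖
  set h : ℕ → M := fun k => projectionSum q (2 ^ k) (2 ^ k * K) with hh
  have hbound : ∀ k, ‖A - innerDerivation (h k)‖ ≤ Real.exp 1 / (2 ^ k : ℕ) := fun k =>
    norm_sub_innerDerivation_projectionSum_le hA hs hq hAq hmono hdecay (by positivity)
      (h0 0 le_rfl) (htop _ (by
        rw [Nat.cast_mul, mul_div_cancel_left₀ _ (by positivity)]
        exact hK))
  have hcauchy : CauchySeq h := cauchySeq_of_le_geometric_two (C := 1) fun k => by
    rw [dist_comm, dist_eq_norm]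
    have h1 := norm_projectionSum_two_mul_sub_le hq hmono (n := 2 ^ k) (by positivity) (2 ^ k * K)
    rw [← mul_assoc, ← pow_succ'] at h1
    refine h1.trans (le_of_eq ?_)
    push_cast
    rw [div_div]
  obtain ⟨l, hl⟩ := cauchySeq_tendsto_of_complete hcauchy
  refine ⟨l, ?_, ContinuousLinearMap.ext fun x => ?_⟩
  · exact (isClosed_eq continuous_star continuous_id).mem_of_tendsto hl
      (Eventually.of_forall fun k => isSelfAdjoint_projectionSum hq _ _)
  have hlim : Tendsto (fun k => innerDerivation (h k) x) atTop (𝓝 (innerDerivation l x)) := by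
    simp only [innerDerivation_apply]
    exact (hl.mul_const x).sub (hl.const_mul x)
  refine tendsto_nhds_unique ?_ hlim
  rw [tendsto_iff_norm_sub_tendsto_zero]
  have hz : Tendsto (fun k : ℕ => Real.exp 1 / ((2 ^ k : ℕ) : ℝ) * ‖x‖) atTop (𝓝 0) := by
    rw [← zero_mul ‖x‖]
    refine Tendsto.mul_const _ (tendsto_const_nhds.div_atTop ?_)
    exact tendsto_natCast_atTop_atTop.comp (tendsto_pow_atTop_atTop_of_one_lt one_lt_two)
  refine squeeze_zero (fun _ => norm_nonneg _) (fun k => ?_) hz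
  rw [norm_sub_rev]
  exact ((A - innerDerivation (h k)).le_opNorm x).trans (by gcongr; exact hbound k)

end SakaiKadison

/-- If left annihilators in a C⋆-algebra are generated by projections, bounded TRO-derivations
are inner. -/
theorem exists_skewAdjoint_of_triple_derivation {M : Type*} [CStarAlgebra M]
    (hsupp : ∀ S : Set M, ∃ q : M, IsStarProjection q ∧ ∀ y, (∀ x ∈ S, y * x = 0) ↔ y * q = 0)
    (D : BoundedEndo M)
    (hD : ∀ x y z, D (x * star y * z) = D x * star y * z + x * star (D y) * z + x * star y * D z) :
    ∃ α β : M, star α = -α ∧ star β = -β ∧ ∀ x, D x = α * x + x * β := by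
  set u := D 1 with hu
  have hu' : star u = -u := by
    have h := hD 1 1 1
    simp only [star_one, mul_one, one_mul] at h
    rw [← hu] at h
    have h2 : u + (star u + u) = u + 0 := by rw [← add_assoc, add_zero]; exact h.symm
    exact eq_neg_of_add_eq_zero_left (add_left_cancel h2)
  have hmul : ∀ x z, D (x * z) = D x * z - x * u * z + x * D z := fun x z => by
    have h := hD x 1 z
    simp only [star_one, mul_one] at h
    rw [h, ← hu, hu']
    noncomm_ring
  have hstar : ∀ y, D (star y) = u * star y + star (D y) + star y * u := fun y => by
    have h := hD 1 y 1
    simpa only [one_mul, mul_one] using h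
  set A : BoundedEndo M := (-I) • (D - ContinuousLinearMap.mul ℂ M u) with hA
  have hAapp : ∀ x, A x = (-I) • (D x - u * x) := fun _ => rfl
  obtain ⟨h, hh, hAh⟩ := exists_innerDerivation_eq hsupp (A := A)
    (fun x y => by
      simp only [hAapp, hmul, smul_mul_assoc, mul_smul_comm, ← smul_add]
      congr 1
      noncomm_ring)
    (fun x => by
      simp only [hAapp, hstar, star_smul, star_sub, star_mul, hu', star_neg,
        Complex.star_def, Complex.conj_I, neg_neg, neg_smul, ← smul_neg]
      congr 1
      noncomm_ring)
  have hDx : ∀ x, D x = u * x + I • (h * x - x * h) := fun x => by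
    have h1 : A x = h * x - x * h := by rw [hAh, innerDerivation_apply]
    rw [← h1, hAapp, smul_smul]
    simp
  refine ⟨u + I • h, -(I • h), ?_, ?_, fun x => ?_⟩
  · rw [star_add, hu', star_smul, hh.star_eq, Complex.star_def, Complex.conj_I, neg_smul, neg_add]
  · rw [star_neg, star_smul, hh.star_eq, Complex.star_def, Complex.conj_I, neg_smul]
  · rw [hDx, smul_sub, add_mul, mul_neg, smul_mul_assoc, mul_smul_comm]
    abel

namespace VonNeumannAlgebra

variable {H : Type*} [NormedAddCommGroup H] [InnerProductSpace ℂ H] [CompleteSpace H]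

theorem isClosed_toStarSubalgebra (M : VonNeumannAlgebra H) :
    IsClosed (M.toStarSubalgebra : Set (H →L[ℂ] H)) := by
  rw [coe_toStarSubalgebra, ← centralizer_centralizer M]
  exact Set.isClosed_centralizer _

/-- Left annihilators in a von Neumann algebra are generated by projections. -/
theorem exists_isStarProjection_mul_eq_zero_iff (M : VonNeumannAlgebra H)
    (S : Set M.toStarSubalgebra) :
    ∃ q : M.toStarSubalgebra, IsStarProjection q ∧ ∀ y, (∀ x ∈ S, y * x = 0) ↔ y * q = 0 := by
  set V : Submodule ℂ H :=
    Submodule.span ℂ {v | ∃ x ∈ S, ∃ ξ, (x : H →L[ℂ] H) ξ = v} with hV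
  set W : Submodule ℂ H := V.topologicalClosure with hW
  have : CompleteSpace W := V.isClosed_topologicalClosure.completeSpace_coe
  have hmem : ∀ x ∈ S, ∀ ξ, (x : H →L[ℂ] H) ξ ∈ W := fun x hx ξ =>
    V.le_topologicalClosure (Submodule.subset_span ⟨x, hx, ξ, rfl⟩)
  have hmin : ∀ T : Submodule ℂ H, IsClosed (T : Set H) →
      (∀ x ∈ S, ∀ ξ, (x : H →L[ℂ] H) ξ ∈ T) → W ≤ T := fun T hT h =>
    V.topologicalClosure_minimal (Submodule.span_le.2 (by
      rintro _ ⟨x, hx, ξ, rfl⟩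
      exact h x hx ξ)) hT
  have hproj : IsStarProjection W.starProjection := isStarProjection_starProjection
  have hqM : W.starProjection ∈ M := by
    rw [IsStarProjection.mem_iff hproj]
    intro y hy
    rw [Submodule.range_starProjection, Module.End.mem_invtSubmodule]
    refine hmin _ (V.isClosed_topologicalClosure.preimage y.continuous) fun x hx ξ => ?_
    have hc : (x : H →L[ℂ] H) * y = y * (x : H →L[ℂ] H) := mem_commutant_iff.1 hy _ x.2
    have h2 : y ((x : H →L[ℂ] H) ξ) = (x : H →L[ℂ] H) (y ξ) :=
      (congrArg (fun T : H →L[ℂ] H => T ξ) hc).symm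
    rw [Submodule.mem_comap]
    change y ((x : H →L[ℂ] H) ξ) ∈ W
    rw [h2]
    exact hmem x hx _
  refine ⟨⟨W.starProjection, hqM⟩, ⟨Subtype.ext hproj.isIdempotentElem,
    Subtype.ext hproj.isSelfAdjoint⟩, fun y => ⟨fun h => ?_, fun h x hx => ?_⟩⟩
  · refine Subtype.ext (ContinuousLinearMap.ext fun ξ => ?_)
    have hle := hmin (LinearMap.ker (y : H →L[ℂ] H).toLinearMap)
      (y : H →L[ℂ] H).isClosed_ker fun x hx ξ =>
      congrArg (fun T : M.toStarSubalgebra => (T : H →L[ℂ] H) ξ) (h x hx)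
    exact hle (W.starProjection_apply_mem ξ)
  · refine Subtype.ext (ContinuousLinearMap.ext fun ξ => ?_)
    have h1 : W.starProjection ((x : H →L[ℂ] H) ξ) = (x : H →L[ℂ] H) ξ :=
      Submodule.starProjection_eq_self_iff.2 (hmem x hx ξ)
    change (y : H →L[ℂ] H) ((x : H →L[ℂ] H) ξ) = 0
    rw [← h1]
    exact congrArg (fun T : M.toStarSubalgebra => (T : H →L[ℂ] H) ((x : H →L[ℂ] H) ξ)) h

end VonNeumannAlgebra

end KadisonSakai

/-- Every TRO-derivation of a von Neumann algebra `M ⊆ B(H)` is an inner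
TRO-derivation: there are skew-adjoint `α, β ∈ M` with `D x = α x + x β`. -/
theorem stmt_8 {H : Type*}
    [NormedAddCommGroup H] [InnerProductSpace ℂ H] [CompleteSpace H]
    (M : VonNeumannAlgebra H)
    (D : M.toStarSubalgebra →L[ℂ] M.toStarSubalgebra)
    (hder : ∀ x y z : M.toStarSubalgebra,
      D (x * star y * z) = D x * star y * z + x * star (D y) * z + x * star y * D z) :
    ∃ α β : M.toStarSubalgebra, star α = -α ∧ star β = -β ∧
      ∀ x : M.toStarSubalgebra, D x = α * x + x * β := by
  have : IsClosed (M.toStarSubalgebra : Set (H →L[ℂ] H)) := M.isClosed_toStarSubalgebra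
  exact exists_skewAdjoint_of_triple_derivation (M := M.toStarSubalgebra)
    M.exists_isStarProjection_mul_eq_zero_iff D hder
end

section
/- Let H and K be complex Hilbert spaces and let X be a TRO in B(K,H). A bounded linear map τ : X → X is a triple derivation (with respect to the Jordan triple product {x y z} = (x y* z + z y* x)/2) if and only if it is a TRO-derivation, i.e., τ(x y* z) = τ(x) y* z + x τ(y)* z + x y* τ(z) for all x, y, z ∈ X. -/
open ContinuousLinearMap

/-- A triadditive triple product `m a b c`, modelled on `a b* c`, which is associative
in the sense of associative triple systems of the second kind. -/
structure IsAssocTriple {X : Type*} [AddCommGroup X] (m : X →+ X →+ X →+ X) : Prop where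
  assoc_left : ∀ a b c d e, m (m a b c) d e = m a b (m c d e)
  assoc_mid : ∀ a b c d e, m a (m b c d) e = m a d (m c b e)

namespace IsAssocTriple

variable {X : Type*} [AddCommGroup X] {m : X →+ X →+ X →+ X}

/-- The defect of `D` from being a derivation of `m`. -/
def defect (m : X →+ X →+ X →+ X) (D : X →+ X) (a b c : X) : X :=
  D (m a b c) - m (D a) b c - m a (D b) c - m a b (D c)

/-- The commutator `m a b c - m c b a`. -/
def comm (m : X →+ X →+ X →+ X) (a b c : X) : X := m a b c - m c b a

/-- `D` is a derivation of the symmetrized product `m a b c + m c b a`. -/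
def IsJordanDer (m : X →+ X →+ X →+ X) (D : X →+ X) : Prop :=
  ∀ a b c, D (m a b c + m c b a) =
    (m (D a) b c + m c b (D a)) + (m a (D b) c + m c (D b) a) + (m a b (D c) + m (D c) b a)

theorem defect_swap {D : X →+ X} (hD : IsJordanDer m D) (a b c : X) :
    defect m D c b a = -defect m D a b c := by
  have h := hD a b c
  rw [map_add] at h
  rw [← sub_eq_zero] at h ⊢
  rw [← h]
  simp only [defect]
  abel

theorem IsJordanDer.map_self [IsAddTorsionFree X] {D : X →+ X} (hD : IsJordanDer m D) (a b : X) :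
    D (m a b a) = m (D a) b a + m a (D b) a + m a b (D a) := by
  have h := hD a b a
  have h2 : (2 : ℕ) • D (m a b a) = (2 : ℕ) • (m (D a) b a + m a (D b) a + m a b (D a)) := by
    rw [two_nsmul, ← map_add, h]
    abel
  exact nsmul_right_injective two_ne_zero h2

theorem defect_comm_anticomm [IsAddTorsionFree X] (hm : IsAssocTriple m) {D : X →+ X}
    (hD : IsJordanDer m D) (a b c x : X) :
    m (defect m D a b c) x (comm m a b c) + m (comm m a b c) x (defect m D a b c) = 0 := by
  have h1 : ∀ a b c, D (m a b (m c x (m c b a))) = m (D a) b (m c x (m c b a))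
      + m a (D b) (m c x (m c b a)) + m a b (m (D c) x (m c b a)) + m a b (m c (D x) (m c b a))
      + m a b (m c x (m (D c) b a)) + m a b (m c x (m c (D b) a))
      + m a b (m c x (m c b (D a))) := by
    intro a b c
    have e : m a b (m c x (m c b a)) = m a (m b (m c x c) b) a := by
      simp only [hm.assoc_mid]
    rw [e, hD.map_self, hD.map_self, hD.map_self]
    simp only [map_add, AddMonoidHom.add_apply, hm.assoc_mid]
    abel
  have h2 := hD (m a b c) x (m c b a)
  have h3 : D (m c b a) = -defect m D a b c + (m (D c) b a + m c (D b) a + m c b (D a)) := by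
    rw [← defect_swap hD, defect]; abel
  have h4 : D (m a b c) = defect m D a b c + (m (D a) b c + m a (D b) c + m a b (D c)) := by
    rw [defect]; abel
  rw [h3, h4, map_add] at h2
  simp only [hm.assoc_left, h1] at h2
  rw [← sub_eq_zero] at h2
  rw [← h2]
  simp only [comm, map_add, map_sub, map_neg, AddMonoidHom.add_apply, AddMonoidHom.sub_apply,
    AddMonoidHom.neg_apply, hm.assoc_left]
  abel

/-- Semiprimeness in the form that cubes detect zero. -/
def CubeFree (m : X →+ X →+ X →+ X) : Prop := ∀ a, m a a a = 0 → a = 0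

theorem eq_zero_of_anticomm [IsAddTorsionFree X] (hm : IsAssocTriple m) (hc : CubeFree m)
    {a b : X} (h : ∀ x, m a x b + m b x a = 0) (x : X) : m a x b = 0 := by
  have h' : ∀ x, m a x b = -m b x a := fun x => eq_neg_of_add_eq_zero_left (h x)
  have key : ∀ y, m (m a x b) y (m a x b) = 0 := by
    intro y
    have e1 : m (m a x b) y (m a x b) = -m b x (m a y (m a x b)) := by
      nth_rewrite 1 [h' x]
      simp only [map_neg, AddMonoidHom.neg_apply, hm.assoc_left]
    have e2 : m a y (m a x b) = -m b y (m a x a) := by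
      have := h' (m x a y)
      rwa [hm.assoc_mid, hm.assoc_mid] at this
    have e3 : m (m a x b) y (m a x b) = -m b x (m b y (m a x a)) := by
      have := h' (m (m x a y) b x)
      simpa only [hm.assoc_left, hm.assoc_mid] using this
    rw [e2, map_neg, neg_neg] at e1
    rw [e1] at e3 ⊢
    exact self_eq_neg.mp e3
  exact hc _ (key _)

/-- Polarization: if `f u` annihilates `g u` on the left for all `u`, then `f u` annihilates
all values of `g`. -/
theorem annihilates_of_diagonal (hm : IsAssocTriple m) (hc : CubeFree m) (f g : X → X)
    (hf : ∀ u v, f (u + v) = f u + f v) (hg : ∀ u v, g (u + v) = g u + g v)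
    (h : ∀ u x, m (f u) x (g u) = 0) (u v x : X) : m (f u) x (g v) = 0 := by
  have h1 : ∀ x, m (f u) x (g v) = -m (f v) x (g u) := by
    intro x
    have := h (u + v) x
    simp only [hf, hg, map_add, AddMonoidHom.add_apply, h] at this
    apply eq_neg_of_add_eq_zero_left
    rw [← this]; abel
  apply hc
  nth_rewrite 3 [h1 x]
  have := h u (m (m x (f v) (m (f u) x (g v))) (g v) x)
  simp only [hm.assoc_left, hm.assoc_mid, map_neg] at this ⊢
  rw [this, neg_zero]

theorem defect_annihilates_comm [IsAddTorsionFree X] (hm : IsAssocTriple m) (hc : CubeFree m)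
    {D : X →+ X} (hD : IsJordanDer m D) (a b c d e f x : X) :
    m (defect m D a b c) x (comm m d e f) = 0 := by
  have h0 : ∀ a b c x, m (defect m D a b c) x (comm m a b c) = 0 := fun a b c =>
    eq_zero_of_anticomm hm hc (hm.defect_comm_anticomm hD a b c)
  have h1 : ∀ a d b c x, m (defect m D a b c) x (comm m d b c) = 0 := fun a d b c x =>
    hm.annihilates_of_diagonal hc (fun a => defect m D a b c) (fun a => comm m a b c)
      (fun u v => by simp only [defect, map_add, AddMonoidHom.add_apply]; abel)
      (fun u v => by simp only [comm, map_add, AddMonoidHom.add_apply]; abel)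
      (fun a x => h0 a b c x) a d x
  have h2 : ∀ a d b e c x, m (defect m D a b c) x (comm m d e c) = 0 := fun a d b e c x =>
    hm.annihilates_of_diagonal hc (fun b => defect m D a b c) (fun b => comm m d b c)
      (fun u v => by simp only [defect, map_add, AddMonoidHom.add_apply]; abel)
      (fun u v => by simp only [comm, map_add, AddMonoidHom.add_apply]; abel)
      (fun b x => h1 a d b c x) b e x
  exact hm.annihilates_of_diagonal hc (fun c => defect m D a b c) (fun c => comm m d e c)
      (fun u v => by simp only [defect, map_add]; abel)
      (fun u v => by simp only [comm, map_add, AddMonoidHom.add_apply]; abel)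
      (fun c x => h2 a d b e c x) c f x

theorem comm_annihilates_defect [IsAddTorsionFree X] (hm : IsAssocTriple m) (hc : CubeFree m)
    {D : X →+ X} (hD : IsJordanDer m D) (a b c d e f x : X) :
    m (comm m d e f) x (defect m D a b c) = 0 := by
  apply hc
  set S := m (comm m d e f) x (defect m D a b c) with hS
  have h : m (defect m D a b c) S S = 0 := by
    nth_rewrite 2 [hS]
    rw [← hm.assoc_left, hm.defect_annihilates_comm hc hD]
    simp only [map_zero, AddMonoidHom.zero_apply]
  nth_rewrite 1 [hS]
  rw [hm.assoc_left, h, map_zero]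

/-- A Jordan derivation of a cube-free associative triple system is a derivation. -/
theorem defect_eq_zero [IsAddTorsionFree X] (hm : IsAssocTriple m) (hc : CubeFree m)
    {D : X →+ X} (hD : IsJordanDer m D) (a b c : X) : defect m D a b c = 0 := by
  set T := defect m D a b c with hT
  have hl : ∀ d e f x, m T x (comm m d e f) = 0 := hm.defect_annihilates_comm hc hD a b c
  have hr : ∀ d e f x, m (comm m d e f) x T = 0 := hm.comm_annihilates_defect hc hD a b c
  have hDB : D (comm m a b c) =
      T + T + comm m (D a) b c + comm m a (D b) c + comm m a b (D c) := by
    have h : T + T = defect m D a b c - defect m D c b a := by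
      rw [defect_swap hD a b c, ← hT]; abel
    rw [h]
    simp only [defect, comm, map_sub]
    abel
  have h1 : ∀ x, m (D T) x (comm m a b c) + m (comm m a b c) x (D T) + (4 : ℕ) • m T x T = 0 := by
    intro x
    have h := hD T x (comm m a b c)
    rw [hDB] at h
    simp only [map_add, AddMonoidHom.add_apply, hl, hr, map_zero] at h
    rw [← sub_eq_zero] at h
    rw [← neg_eq_zero, ← h]
    abel
  have h2 : ∀ x y, m T y (m T x T) = 0 := by
    intro x y
    have h := congrArg (m T y) (h1 x)
    have h3 := hl a b c (m x (D T) y)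
    rw [hm.assoc_mid] at h3
    rw [map_add, map_add, h3, ← hm.assoc_left, hl, map_zero, AddMonoidHom.zero_apply,
      AddMonoidHom.zero_apply, zero_add, zero_add, map_nsmul] at h
    rw [map_zero] at h
    exact (nsmul_eq_zero_iff_right four_ne_zero).mp h
  apply hc
  apply hc
  simp only [hm.assoc_left, h2, map_zero]

end IsAssocTriple

section TRO

variable {H K : Type*}
  [NormedAddCommGroup H] [InnerProductSpace ℂ H] [CompleteSpace H]
  [NormedAddCommGroup K] [InnerProductSpace ℂ K] [CompleteSpace K]

/-- The triple product `x y* z` of a ternary ring of operators. -/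
noncomputable def troProduct (X : Submodule ℂ (K →L[ℂ] H))
    (hX : ∀ x ∈ X, ∀ y ∈ X, ∀ z ∈ X, x ∘L (adjoint y) ∘L z ∈ X) : X →+ X →+ X →+ X :=
  AddMonoidHom.mk' (fun x => AddMonoidHom.mk' (fun y => AddMonoidHom.mk'
    (fun z => (⟨(x : K →L[ℂ] H) ∘L adjoint (y : K →L[ℂ] H) ∘L (z : K →L[ℂ] H),
      hX x x.2 y y.2 z z.2⟩ : X))
    (fun _ _ => by ext1; simp [comp_add]))
    (fun _ _ => by ext z : 2; simp [comp_add, add_comp]))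
    (fun _ _ => by ext y z : 3; simp [add_comp])

theorem coe_troProduct (X : Submodule ℂ (K →L[ℂ] H))
    (hX : ∀ x ∈ X, ∀ y ∈ X, ∀ z ∈ X, x ∘L (adjoint y) ∘L z ∈ X) (x y z : X) :
    (troProduct X hX x y z : K →L[ℂ] H) =
      (x : K →L[ℂ] H) ∘L adjoint (y : K →L[ℂ] H) ∘L (z : K →L[ℂ] H) := rfl

theorem isAssocTriple_troProduct (X : Submodule ℂ (K →L[ℂ] H))
    (hX : ∀ x ∈ X, ∀ y ∈ X, ∀ z ∈ X, x ∘L (adjoint y) ∘L z ∈ X) :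
    IsAssocTriple (troProduct X hX) where
  assoc_left a b c d e := by
    ext1
    simp only [coe_troProduct, comp_assoc]
  assoc_mid a b c d e := by
    ext1
    simp only [coe_troProduct, adjoint_comp, adjoint_adjoint, comp_assoc]

theorem eq_zero_of_comp_adjoint_comp_self {x : K →L[ℂ] H} (h : x ∘L adjoint x ∘L x = 0) :
    x = 0 := by
  have h1 : star (adjoint x ∘L x) * (adjoint x ∘L x) = 0 := by
    rw [star_eq_adjoint, adjoint_comp, adjoint_adjoint, mul_def, comp_assoc, h, comp_zero]
  have h2 := CStarRing.star_mul_self_eq_zero_iff _ |>.mp h1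
  have h3 := norm_adjoint_comp_self x
  rw [h2, norm_zero] at h3
  exact norm_eq_zero.mp (mul_self_eq_zero.mp h3.symm)

theorem cubeFree_troProduct (X : Submodule ℂ (K →L[ℂ] H))
    (hX : ∀ x ∈ X, ∀ y ∈ X, ∀ z ∈ X, x ∘L (adjoint y) ∘L z ∈ X) :
    IsAssocTriple.CubeFree (troProduct X hX) := fun _ h =>
  Subtype.ext (eq_zero_of_comp_adjoint_comp_self (congrArg Subtype.val h))

end TRO

/-- On a TRO `X ⊆ B(K,H)`, a bounded linear map `τ : X → X` is a triple derivation
(for the Jordan triple product `{x y z} = (x y* z + z y* x)/2`) if and only if it is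
a TRO-derivation (for the product `x y* z`). -/
theorem stmt_9 {H K : Type*}
    [NormedAddCommGroup H] [InnerProductSpace ℂ H] [CompleteSpace H]
    [NormedAddCommGroup K] [InnerProductSpace ℂ K] [CompleteSpace K]
    (X : Submodule ℂ (K →L[ℂ] H)) (hXclosed : IsClosed (X : Set (K →L[ℂ] H)))
    (hXtro : ∀ x ∈ X, ∀ y ∈ X, ∀ z ∈ X, x ∘L (adjoint y) ∘L z ∈ X)
    (τ : X →L[ℂ] X) :
    (∀ x y z w : X,
      (w : K →L[ℂ] H) = (2⁻¹ : ℂ) •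
          ((x : K →L[ℂ] H) ∘L adjoint (y : K →L[ℂ] H) ∘L (z : K →L[ℂ] H)
            + (z : K →L[ℂ] H) ∘L adjoint (y : K →L[ℂ] H) ∘L (x : K →L[ℂ] H)) →
      (τ w : K →L[ℂ] H) = (2⁻¹ : ℂ) •
          ((τ x : K →L[ℂ] H) ∘L adjoint (y : K →L[ℂ] H) ∘L (z : K →L[ℂ] H)
            + (z : K →L[ℂ] H) ∘L adjoint (y : K →L[ℂ] H) ∘L (τ x : K →L[ℂ] H))
        + (2⁻¹ : ℂ) •
          ((x : K →L[ℂ] H) ∘L adjoint (τ y : K →L[ℂ] H) ∘L (z : K →L[ℂ] H)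
            + (z : K →L[ℂ] H) ∘L adjoint (τ y : K →L[ℂ] H) ∘L (x : K →L[ℂ] H))
        + (2⁻¹ : ℂ) •
          ((x : K →L[ℂ] H) ∘L adjoint (y : K →L[ℂ] H) ∘L (τ z : K →L[ℂ] H)
            + (τ z : K →L[ℂ] H) ∘L adjoint (y : K →L[ℂ] H) ∘L (x : K →L[ℂ] H))) ↔
    (∀ x y z w : X,
      (w : K →L[ℂ] H) = (x : K →L[ℂ] H) ∘L adjoint (y : K →L[ℂ] H) ∘L (z : K →L[ℂ] H) →
      (τ w : K →L[ℂ] H) =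
        (τ x : K →L[ℂ] H) ∘L adjoint (y : K →L[ℂ] H) ∘L (z : K →L[ℂ] H)
          + (x : K →L[ℂ] H) ∘L adjoint (τ y : K →L[ℂ] H) ∘L (z : K →L[ℂ] H)
          + (x : K →L[ℂ] H) ∘L adjoint (y : K →L[ℂ] H) ∘L (τ z : K →L[ℂ] H)) := by
  constructor
  · intro h x y z w hw
    have : IsAddTorsionFree X := .of_isTorsionFree ℂ X
    have hD : IsAssocTriple.IsJordanDer (troProduct X hXtro) (τ : X →+ X) := by
      intro a b c
      have h1 := h a b c ((2⁻¹ : ℂ) • (troProduct X hXtro a b c + troProduct X hXtro c b a)) rfl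
      rw [map_smul, Submodule.coe_smul, ← smul_add, ← smul_add] at h1
      exact Subtype.ext (smul_right_injective _ (inv_ne_zero (two_ne_zero (α := ℂ))) h1)
    have h0 := (isAssocTriple_troProduct X hXtro).defect_eq_zero
      (cubeFree_troProduct X hXtro) hD x y z
    obtain rfl : w = troProduct X hXtro x y z := Subtype.ext hw
    rw [IsAssocTriple.defect, sub_sub, sub_sub, sub_eq_zero, ← add_assoc] at h0
    exact congrArg Subtype.val h0
  · intro h x y z w hw
    obtain rfl : w = (2⁻¹ : ℂ) • (troProduct X hXtro x y z + troProduct X hXtro z y x) :=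
      Subtype.ext hw
    rw [map_smul, map_add, Submodule.coe_smul, Submodule.coe_add, h x y z (troProduct X hXtro x y z) rfl,
      h z y x (troProduct X hXtro z y x) rfl,
      ← smul_add, ← smul_add]
    congr 1
    abel
end
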